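/- arXiv:2011.05464 — 2 statements merged into one kernel-verified Lean document; each statement's English description precedes it below -/
import Mathlib

section
/- For all natural numbers k, n with 1 ≤ k < n, the subspace F_n(𝔈_c) ∖ F_k(𝔈_c) of the n-th symmetric product of complete Erdős space (with the Vietoris topology) is homeomorphic to complete Erdős space 𝔈_c. -/
open Set Topology

noncomputable section

/-- The Vietoris topology on the powerset of `X` induced by a topology `τ`,
generated by the sets `{F | F ⊆ U}` and `{F | F ∩ U ≠ ∅}` for `U` a nonempty `τ`-open set. -/
def VietorisTop {X : Type*} (τ : TopologicalSpace X) : TopologicalSpace (Set X) :=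
  TopologicalSpace.generateFrom
    ({S : Set (Set X) | ∃ U : Set X, IsOpen[τ] U ∧ U.Nonempty ∧ S = {F : Set X | F ⊆ U}} ∪
     {S : Set (Set X) | ∃ U : Set X, IsOpen[τ] U ∧ U.Nonempty ∧ S = {F : Set X | (F ∩ U).Nonempty}})

/-- The hyperspace `K(X)` of nonempty compact subsets of `X`. -/
def HypK (X : Type*) [TopologicalSpace X] : Type _ := {F : Set X // F.Nonempty ∧ IsCompact F}

/-- `K(X)` carries the Vietoris topology. -/
instance (X : Type*) [τ : TopologicalSpace X] : TopologicalSpace (HypK X) :=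
  (VietorisTop τ).induced Subtype.val

/-- The `n`-th symmetric product `F_n(X)`: nonempty subsets of `X` with at most `n` points. -/
def HypFn (n : ℕ) (X : Type*) [TopologicalSpace X] : Type _ :=
  {F : Set X // F.Nonempty ∧ F.Finite ∧ F.ncard ≤ n}

/-- `F_n(X)` carries the Vietoris topology. -/
instance (n : ℕ) (X : Type*) [τ : TopologicalSpace X] : TopologicalSpace (HypFn n X) :=
  (VietorisTop τ).induced Subtype.val

/-- The hyperspace `F(X)` of nonempty finite subsets of `X`. -/
def HypFin (X : Type*) [TopologicalSpace X] : Type _ := {F : Set X // F.Nonempty ∧ F.Finite}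

/-- `F(X)` carries the Vietoris topology. -/
instance (X : Type*) [τ : TopologicalSpace X] : TopologicalSpace (HypFin X) :=
  (VietorisTop τ).induced Subtype.val

/-- A space is almost zero-dimensional if every point has a neighborhood basis consisting of
sets each of which is an intersection of clopen sets. -/
def IsAZD (X : Type*) [TopologicalSpace X] : Prop :=
  ∀ x : X, ∀ U ∈ nhds x, ∃ V ∈ nhds x, V ⊆ U ∧
    ∃ C : Set (Set X), (∀ c ∈ C, IsClopen c) ∧ V = ⋂₀ C

/-- `X` is `𝒜`-cohesive: every point has a neighborhood containing no nonempty proper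
subset of an element `A ∈ 𝒜` that is clopen in the subspace topology of `A`. -/
def CohesiveWrt (X : Type*) [TopologicalSpace X] (𝒜 : Set (Set X)) : Prop :=
  ∀ x : X, ∃ U ∈ nhds x, ∀ A ∈ 𝒜, ∀ C : Set X,
    C ⊆ U → C ⊆ A → C.Nonempty → C ≠ A → ¬ IsClopen {y : A | (y : X) ∈ C}

/-- A space is cohesive if it is `{X}`-cohesive. -/
def Cohesive (X : Type*) [TopologicalSpace X] : Prop := CohesiveWrt X {Set.univ}

/-- Erdős space: the rational points of the Hilbert space `ℓ²`. -/
def ErdosSpace : Type :=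
  {x : lp (fun _ : ℕ => ℝ) 2 // ∀ n : ℕ, ∃ q : ℚ, x.val n = (q : ℝ)}

instance : TopologicalSpace ErdosSpace := by unfold ErdosSpace; infer_instance

/-- Complete Erdős space: points of `ℓ²` all of whose coordinates lie in `{0} ∪ {1/m : m ≥ 1}`. -/
def CompleteErdosSpace : Type :=
  {x : lp (fun _ : ℕ => ℝ) 2 // ∀ n : ℕ, x.val n = 0 ∨ ∃ m : ℕ, 0 < m ∧ x.val n = 1 / (m : ℝ)}

instance : TopologicalSpace CompleteErdosSpace := by unfold CompleteErdosSpace; infer_instance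

/-- The subspace `F_n(X) \ F_k(X)` of the Vietoris hyperspace: nonempty finite subsets of
`X` of cardinality strictly greater than `k` and at most `n`. -/
def HypFnDiff (k n : ℕ) (X : Type*) [TopologicalSpace X] : Type _ :=
  {F : Set X // F.Nonempty ∧ F.Finite ∧ k < F.ncard ∧ F.ncard ≤ n}

/-- `F_n(X) \ F_k(X)` carries the (induced) Vietoris topology. -/
instance (k n : ℕ) (X : Type*) [τ : TopologicalSpace X] : TopologicalSpace (HypFnDiff k n X) :=
  (VietorisTop τ).induced Subtype.val

section Lelek

open Filter
open scoped ENNReal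

/-- A lower semicontinuous function whose finite values are dense and which, arbitrarily close to
any point, takes values in every interval above its value there. -/
structure IsLelek {C : Type*} [TopologicalSpace C] (N : C → ℝ≥0∞) : Prop where
  lsc : LowerSemicontinuous N
  dense : Dense {x | N x ≠ ∞}
  frequently : ∀ x s t, N x ≤ s → s < t → ∃ᶠ y in 𝓝 x, s < N y ∧ N y < t

/-- The infimum of `N` over the set `P`. -/
def cellInf {C : Type*} (N : C → ℝ≥0∞) (P : Set C) : ℝ≥0∞ := ⨅ x ∈ P, N x

/-- The difference between the infimum of `M` over `Q` and that of `N` over `P`. -/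
def defect {C D : Type*} (N : C → ℝ≥0∞) (M : D → ℝ≥0∞) (P : Set C) (Q : Set D) : ℝ :=
  (cellInf M Q).toReal - (cellInf N P).toReal

variable {C D : Type*} {N : C → ℝ≥0∞} {M : D → ℝ≥0∞}

lemma defect_swap (P : Set C) (Q : Set D) : defect M N Q P = -defect N M P Q := by
  simp [defect]

lemma cellInf_le {P : Set C} {x : C} (hx : x ∈ P) : cellInf N P ≤ N x :=
  iInf₂_le x hx

lemma le_cellInf {P : Set C} {s : ℝ≥0∞} (h : ∀ x ∈ P, s ≤ N x) : s ≤ cellInf N P :=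
  le_iInf₂ h

lemma cellInf_anti {P P' : Set C} (h : P' ⊆ P) : cellInf N P ≤ cellInf N P' :=
  le_cellInf fun _ hx => cellInf_le (h hx)

/-- Two sets are matched within `ε` of `d` if they are both empty, or both nonempty with defect
at distance at most `ε` from `d`. -/
def Matched (N : C → ℝ≥0∞) (M : D → ℝ≥0∞) (P : Set C) (Q : Set D) (d ε : ℝ) : Prop :=
  (P.Nonempty ↔ Q.Nonempty) ∧ (P.Nonempty → |defect N M P Q - d| ≤ ε)

lemma Matched.swap {P : Set C} {Q : Set D} {d ε : ℝ} (h : Matched N M P Q d ε) :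
    Matched M N Q P (-d) ε := by
  refine ⟨h.1.symm, fun hQ => ?_⟩
  rw [defect_swap, ← neg_sub', abs_neg]
  exact h.2 (h.1.2 hQ)

lemma matched_self {P : Set C} {Q : Set D} {ε : ℝ} (h : P.Nonempty ↔ Q.Nonempty) (hε : 0 ≤ ε) :
    Matched N M P Q (defect N M P Q) ε :=
  ⟨h, fun _ => by simpa using hε⟩

variable [TopologicalSpace C] [TopologicalSpace D]

lemma IsLelek.cellInf_ne_top (hN : IsLelek N) {P : Set C} (hP : IsOpen P) (hne : P.Nonempty) :
    cellInf N P ≠ ∞ := by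
  obtain ⟨x, hx, hxP⟩ := hN.dense.inter_open_nonempty P hP hne |>.imp fun _ h => h.symm
  exact ne_top_of_le_ne_top hx (cellInf_le hxP)

lemma IsLelek.exists_eq_cellInf [CompactSpace C] (hN : IsLelek N) {P : Set C} (hP : IsClosed P)
    (hne : P.Nonempty) : ∃ x ∈ P, N x = cellInf N P := by
  obtain ⟨x, hx, hmin⟩ := LowerSemicontinuousOn.exists_isMinOn hne hP.isCompact
    (hN.lsc.lowerSemicontinuousOn P)
  exact ⟨x, hx, le_antisymm (le_cellInf fun y hy => hmin hy) (cellInf_le hx)⟩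

/-- One can cut off from a clopen set a clopen piece with prescribed infimum, up to `ε`, without
changing the infimum over the remainder. -/
lemma IsLelek.exists_clopen_piece [CompactSpace D] [T2Space D] [TotallyDisconnectedSpace D]
    (hM : IsLelek M) {Q : Set D} (hQ : IsClopen Q) (hne : Q.Nonempty) {r ε : ℝ} (hr : 0 ≤ r)
    (hε : 0 < ε) :
    ∃ Q', IsClopen Q' ∧ Q' ⊆ Q ∧ Q'.Nonempty ∧ (Q \ Q').Nonempty ∧
      cellInf M (Q \ Q') = cellInf M Q ∧
      |(cellInf M Q').toReal - ((cellInf M Q).toReal + r)| ≤ ε := by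
  obtain ⟨y₀, hy₀, hmin⟩ := hM.exists_eq_cellInf hQ.1 hne
  have hfin : cellInf M Q ≠ ∞ := hM.cellInf_ne_top hQ.2 hne
  set s := cellInf M Q + ENNReal.ofReal r with hs
  have hsfin : s ≠ ∞ := by simp [hs, hfin]
  have hst : s < s + ENNReal.ofReal ε := ENNReal.lt_add_right hsfin (by simpa using hε)
  have hy₀s : M y₀ ≤ s := hmin.trans_le le_self_add
  obtain ⟨y, ⟨hsy, hyt⟩, hyQ⟩ :=
    ((hM.frequently y₀ s _ hy₀s hst).and_eventually (hQ.2.mem_nhds hy₀)).exists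
  obtain ⟨Q', hQ', hyQ', hsub⟩ := compact_exists_isClopen_in_isOpen
    (hQ.2.inter (hM.lsc.isOpen_preimage s)) ⟨hyQ, hsy⟩
  have hy₀Q' : y₀ ∈ Q \ Q' := ⟨hy₀, fun h => (hsub h).2.not_ge hy₀s⟩
  refine ⟨Q', hQ', fun z hz => (hsub hz).1, ⟨y, hyQ'⟩, ⟨y₀, hy₀Q'⟩,
    le_antisymm ((cellInf_le hy₀Q').trans_eq hmin) (cellInf_anti sdiff_subset), ?_⟩
  have h1 : s ≤ cellInf M Q' := le_cellInf fun z hz => (hsub hz).2.le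
  have h2 : cellInf M Q' ≤ s + ENNReal.ofReal ε := (cellInf_le hyQ').trans hyt.le
  have hsr : s.toReal = (cellInf M Q).toReal + r := by
    rw [hs, ENNReal.toReal_add hfin ENNReal.ofReal_ne_top, ENNReal.toReal_ofReal hr]
  have h3 := ENNReal.toReal_mono (hM.cellInf_ne_top hQ'.2 ⟨y, hyQ'⟩) h1
  have h4 := ENNReal.toReal_mono (by simp [hsfin]) h2
  rw [ENNReal.toReal_add hsfin ENNReal.ofReal_ne_top, ENNReal.toReal_ofReal hε.le] at h4
  rw [abs_le]
  constructor <;> linarith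

/-- Splitting a clopen set in two can be copied in a matched clopen set, when the first half has
the same infimum as the whole. -/
lemma IsLelek.exists_split_of_cellInf_eq [CompactSpace D] [T2Space D] [TotallyDisconnectedSpace D]
    (hN : IsLelek N) (hM : IsLelek M) {P E : Set C} {Q : Set D} (hP : IsClopen P)
    (hQ : IsClopen Q) (hPQ : P.Nonempty ↔ Q.Nonempty) (hE : IsClopen E) {ε : ℝ} (hε : 0 < ε)
    (hne : (P \ E).Nonempty) (hinf : cellInf N (P ∩ E) = cellInf N P) (hne' : (P ∩ E).Nonempty) :
    ∃ F : Set D, IsClopen F ∧ Matched N M (P ∩ E) (Q ∩ F) (defect N M P Q) ε ∧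
      Matched N M (P \ E) (Q \ F) (defect N M P Q) ε := by
  have hQne : Q.Nonempty := hPQ.1 (hne.mono sdiff_subset)
  have hr : 0 ≤ (cellInf N (P \ E)).toReal - (cellInf N P).toReal :=
    sub_nonneg.2 (ENNReal.toReal_mono (hN.cellInf_ne_top (hP.diff hE).2 hne)
      (cellInf_anti sdiff_subset))
  obtain ⟨Q', hQ', hsub, hQ'ne, hdne, hdinf, hQ'inf⟩ := hM.exists_clopen_piece hQ hQne hr hε
  refine ⟨Q'ᶜ, hQ'.compl, ?_, ?_⟩
  · rw [← sdiff_eq]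
    refine ⟨iff_of_true hne' hdne, fun _ => ?_⟩
    simpa [defect, hinf, hdinf] using hε.le
  · rw [sdiff_compl, inter_eq_self_of_subset_right hsub]
    refine ⟨iff_of_true hne hQ'ne, fun _ => ?_⟩
    convert hQ'inf using 2
    simp only [defect]
    ring

/-- Splitting a clopen set in two can be copied in a matched clopen set. -/
lemma IsLelek.exists_split [CompactSpace D] [T2Space D] [TotallyDisconnectedSpace D]
    (hN : IsLelek N) (hM : IsLelek M) {P E : Set C} {Q : Set D} (hP : IsClopen P)
    (hQ : IsClopen Q) (hPQ : P.Nonempty ↔ Q.Nonempty) (hE : IsClopen E) {ε : ℝ} (hε : 0 < ε) :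
    ∃ F : Set D, IsClopen F ∧ Matched N M (P ∩ E) (Q ∩ F) (defect N M P Q) ε ∧
      Matched N M (P \ E) (Q \ F) (defect N M P Q) ε := by
  rcases (P ∩ E).eq_empty_or_nonempty with h1 | h1
  · have h2 : P \ E = P := by rw [← sdiff_self_inter, h1, sdiff_empty]
    refine ⟨∅, isClopen_empty, ?_, ?_⟩
    · simp [Matched, h1]
    · rw [h2, sdiff_empty]
      exact matched_self hPQ hε.le
  rcases (P \ E).eq_empty_or_nonempty with h2 | h2
  · have h3 : P ∩ E = P := inter_eq_left.2 (sdiff_eq_empty.1 h2)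
    refine ⟨univ, isClopen_univ, ?_, ?_⟩
    · rw [h3, inter_univ]
      exact matched_self hPQ hε.le
    · simp [Matched, h2]
  have hmin : cellInf N P = cellInf N (P ∩ E) ⊓ cellInf N (P \ E) := by
    conv_lhs => rw [← inter_union_sdiff P E]
    simp only [cellInf, iInf_union]
  rcases le_total (cellInf N (P ∩ E)) (cellInf N (P \ E)) with h | h
  · rw [inf_eq_left.2 h] at hmin
    exact hN.exists_split_of_cellInf_eq hM hP hQ hPQ hE hε h2 hmin.symm h1
  · rw [inf_eq_right.2 h] at hmin
    obtain ⟨F, hF, hF1, hF2⟩ := hN.exists_split_of_cellInf_eq hM hP hQ hPQ hE.compl hε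
      (by rwa [sdiff_compl]) (by rw [← sdiff_eq]; exact hmin.symm) (by rwa [← sdiff_eq])
    rw [← sdiff_eq] at hF1
    rw [sdiff_compl] at hF2
    exact ⟨Fᶜ, hF.compl, by rwa [← sdiff_eq], by rwa [sdiff_compl]⟩

/-- A binary tree of clopen sets, in which each clopen set is used for splitting at all nodes
of some level. -/
structure SplitTree (P : List Bool → Set C) : Prop where
  root : P [] = univ
  split : ∀ l, ∃ A, IsClopen A ∧ P (true :: l) = P l ∩ A ∧ P (false :: l) = P l \ A
  exhaust : ∀ E, IsClopen E → ∃ n, ∀ l : List Bool, l.length = n → P (true :: l) = P l ∩ E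

namespace SplitTree

variable {P : List Bool → Set C} {Q : List Bool → Set D}

lemma isClopen (h : SplitTree P) (l : List Bool) : IsClopen (P l) := by
  induction l with
  | nil => rw [h.root]; exact isClopen_univ
  | cons b l ih =>
    obtain ⟨A, hA, h1, h0⟩ := h.split l
    cases b
    · rw [h0]; exact ih.diff hA
    · rw [h1]; exact ih.inter hA

lemma cons_subset (h : SplitTree P) (b : Bool) (l : List Bool) : P (b :: l) ⊆ P l := by
  obtain ⟨A, -, h1, h0⟩ := h.split l
  cases b
  · rw [h0]; exact sdiff_subset
  · rw [h1]; exact inter_subset_left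

lemma exists_mem (h : SplitTree P) (x : C) (n : ℕ) : ∃ l : List Bool, l.length = n ∧ x ∈ P l := by
  induction n with
  | zero => exact ⟨[], rfl, by simp [h.root]⟩
  | succ n ih =>
    obtain ⟨l, hl, hx⟩ := ih
    obtain ⟨A, -, h1, h0⟩ := h.split l
    by_cases hxA : x ∈ A
    · exact ⟨true :: l, by simp [hl], by rw [h1]; exact ⟨hx, hxA⟩⟩
    · exact ⟨false :: l, by simp [hl], by rw [h0]; exact ⟨hx, hxA⟩⟩

lemma eq_of_mem (h : SplitTree P) {x : C} :
    ∀ {l l' : List Bool}, l.length = l'.length → x ∈ P l → x ∈ P l' → l = l'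
  | [], [], _, _, _ => rfl
  | b :: l, b' :: l', hlen, hx, hx' => by
    obtain rfl : l = l' := h.eq_of_mem (by simpa using hlen) (h.cons_subset b l hx)
      (h.cons_subset b' l' hx')
    obtain ⟨A, -, h1, h0⟩ := h.split l
    cases b <;> cases b' <;> simp_all

/-- Points with the same address in a split tree coincide. -/
lemma eq_of_forall_mem_iff [CompactSpace C] [T2Space C] [TotallyDisconnectedSpace C]
    (h : SplitTree P) {x y : C} (hxy : ∀ l, x ∈ P l ↔ y ∈ P l) : x = y := by
  by_contra hne
  obtain ⟨E, hE, hxE, hyE⟩ := exists_isClopen_of_totally_separated hne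
  obtain ⟨n, hn⟩ := h.exhaust E hE
  obtain ⟨l, hl, hxl⟩ := h.exists_mem x n
  have := hxy (true :: l)
  rw [hn l hl] at this
  exact hyE (this.1 ⟨hxl, hxE⟩).2

lemma exists_forall_mem_iff [CompactSpace D] (hP : SplitTree P) (hQ : SplitTree Q)
    (hPQ : ∀ l, (P l).Nonempty ↔ (Q l).Nonempty) (x : C) : ∃ y, ∀ l, x ∈ P l ↔ y ∈ Q l := by
  choose p hp hxp using hP.exists_mem x
  have hsucc : ∀ n, ∃ b, p (n + 1) = b :: p n := by
    intro n
    obtain ⟨b, l, hbl⟩ := List.exists_cons_of_length_eq_add_one (hp (n + 1))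
    refine ⟨b, ?_⟩
    have hx := hxp (n + 1)
    rw [hbl] at hx
    rw [hbl, hP.eq_of_mem (by simpa [hbl, hp n] using hp (n + 1)) (hP.cons_subset b l hx) (hxp n)]
  obtain ⟨y, hy⟩ := IsCompact.nonempty_iInter_of_sequence_nonempty_isCompact_isClosed
    (fun n => Q (p n))
    (fun n => by obtain ⟨b, hb⟩ := hsucc n; simp only [hb]; exact hQ.cons_subset b _)
    (fun n => (hPQ _).1 ⟨x, hxp n⟩) (hQ.isClopen _).1.isCompact (fun n => (hQ.isClopen _).1)
  rw [mem_iInter] at hy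
  refine ⟨y, fun l => ⟨fun hl => ?_, fun hl => ?_⟩⟩
  · rw [hP.eq_of_mem (hp l.length).symm hl (hxp _)]
    exact hy _
  · rw [hQ.eq_of_mem (hp l.length).symm hl (hy _)]
    exact hxp _

/-- Split trees with the same pattern of empty nodes induce a homeomorphism. -/
lemma exists_homeomorph [CompactSpace C] [T2Space C] [TotallyDisconnectedSpace C]
    [CompactSpace D] [T2Space D] [TotallyDisconnectedSpace D] (hP : SplitTree P)
    (hQ : SplitTree Q) (hPQ : ∀ l, (P l).Nonempty ↔ (Q l).Nonempty) :
    ∃ h : C ≃ₜ D, ∀ x l, x ∈ P l ↔ h x ∈ Q l := by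
  choose f hf using hP.exists_forall_mem_iff hQ hPQ
  choose g hg using hQ.exists_forall_mem_iff hP fun l => (hPQ l).symm
  let e : C ≃ D :=
    { toFun := f
      invFun := g
      left_inv := fun x => hP.eq_of_forall_mem_iff fun l => (hg _ l).symm.trans (hf x l).symm
      right_inv := fun y => hQ.eq_of_forall_mem_iff fun l => (hf _ l).symm.trans (hg y l).symm }
  have hcont : Continuous e := by
    refine continuous_iff_continuousAt.2 fun x => fun V hV => ?_
    obtain ⟨U, hUV, hU, hxU⟩ := mem_nhds_iff.1 hV
    obtain ⟨E, hE, hxE, hEU⟩ := compact_exists_isClopen_in_isOpen hU hxU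
    obtain ⟨n, hn⟩ := hQ.exhaust E hE
    obtain ⟨l, hl, hxl⟩ := hP.exists_mem x n
    have hx : x ∈ P (true :: l) := by
      rw [hf, hn l hl]
      exact ⟨(hf x l).1 hxl, hxE⟩
    refine mem_map.2 (mem_of_superset ((hP.isClopen _).2.mem_nhds hx) fun z hz => ?_)
    rw [hf, hn l hl] at hz
    exact hUV (hEU hz.2)
  exact ⟨hcont.homeoOfEquivCompactToT2, hf⟩

/-- A lower semicontinuous function is determined by its infima over the nodes of a split tree. -/
lemma le_of_forall_cellInf_le [CompactSpace C] [T2Space C] [TotallyDisconnectedSpace C]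
    (h : SplitTree P) (hN : LowerSemicontinuous N) {x : C} {s : ℝ≥0∞} {n : ℕ}
    (hs : ∀ l : List Bool, n ≤ l.length → x ∈ P l → cellInf N (P l) ≤ s) : N x ≤ s := by
  refine le_of_forall_lt fun c hc => ?_
  obtain ⟨c', hcc', hc'⟩ := exists_between hc
  obtain ⟨E, hE, hxE, hEU⟩ := compact_exists_isClopen_in_isOpen (hN.isOpen_preimage c') hc'
  obtain ⟨m, hm⟩ := h.exhaust E hE
  obtain ⟨l, hl, hxl⟩ := h.exists_mem x (max n (m + 1))
  refine hcc'.trans_le (le_trans ?_ (hs l (by simp [hl]) hxl))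
  have key : ∀ k, ∀ l : List Bool, l.length = m + 1 + k → x ∈ P l → P l ⊆ E := by
    intro k
    induction k with
    | zero =>
      intro l hl hxl
      obtain ⟨b, l', rfl⟩ := List.exists_cons_of_length_eq_add_one hl
      have hl' : l'.length = m := by simpa using hl
      have h2 : x ∈ P (true :: l') := by
        rw [hm l' hl']; exact ⟨h.cons_subset b l' hxl, hxE⟩
      rw [h.eq_of_mem (by simp) hxl h2, hm l' hl']
      exact inter_subset_right
    | succ k ih =>
      intro l hl hxl
      obtain ⟨b, l', rfl⟩ := List.exists_cons_of_length_eq_add_one (n := m + 1 + k) hl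
      exact (h.cons_subset b l').trans
        (ih l' (Nat.succ_injective hl) (h.cons_subset b l' hxl))
  obtain ⟨k, hk⟩ := Nat.exists_eq_add_of_le (le_max_right n (m + 1))
  exact le_cellInf fun z hz => (hEU (key k l (hl.trans hk) hxl hz)).le

end SplitTree
/-- Two spaces with Lelek functions have matched split trees with slowly varying defect. -/
lemma IsLelek.exists_matched_trees [CompactSpace C] [T2Space C] [TotallyDisconnectedSpace C]
    [SecondCountableTopology C] [CompactSpace D] [T2Space D] [TotallyDisconnectedSpace D]
    [SecondCountableTopology D] [Nonempty C] [Nonempty D] (hN : IsLelek N) (hM : IsLelek M) :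
    ∃ (P : List Bool → Set C) (Q : List Bool → Set D), SplitTree P ∧ SplitTree Q ∧
      (∀ l, (P l).Nonempty ↔ (Q l).Nonempty) ∧ ∀ b l, (P (b :: l)).Nonempty →
        |defect N M (P (b :: l)) (Q (b :: l)) - defect N M (P l) (Q l)| ≤ (1 / 2) ^ l.length := by
  have : Countable (TopologicalSpace.Clopens C) :=
    TopologicalSpace.Clopens.countable_iff_secondCountable.2 inferInstance
  have : Countable (TopologicalSpace.Clopens D) :=
    TopologicalSpace.Clopens.countable_iff_secondCountable.2 inferInstance
  obtain ⟨e, he⟩ := exists_surjective_nat (TopologicalSpace.Clopens C ⊕ TopologicalSpace.Clopens D)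
  have step : ∀ (n : ℕ) (S : Set C × Set D), ∃ A : Set C × Set D, IsClopen A.1 ∧ IsClopen A.2 ∧
      (∀ E, e n = Sum.inl E → A.1 = E) ∧ (∀ E, e n = Sum.inr E → A.2 = E) ∧
      (IsClopen S.1 → IsClopen S.2 → (S.1.Nonempty ↔ S.2.Nonempty) →
        Matched N M (S.1 ∩ A.1) (S.2 ∩ A.2) (defect N M S.1 S.2) ((1 / 2) ^ n) ∧
        Matched N M (S.1 \ A.1) (S.2 \ A.2) (defect N M S.1 S.2) ((1 / 2) ^ n)) := by
    intro n S
    have hε : (0 : ℝ) < (1 / 2) ^ n := by positivity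
    by_cases hS : IsClopen S.1 ∧ IsClopen S.2 ∧ (S.1.Nonempty ↔ S.2.Nonempty)
    · obtain ⟨h1, h2, h3⟩ := hS
      rcases hen : e n with E | E
      · obtain ⟨F, hF, hm⟩ := hN.exists_split hM h1 h2 h3 E.2 hε
        exact ⟨(E, F), E.2, hF, by simp +contextual, by simp, fun _ _ _ => hm⟩
      · obtain ⟨F, hF, hm1, hm2⟩ := hM.exists_split hN h2 h1 h3.symm E.2 hε
        refine ⟨(F, E), hF, E.2, by simp, by simp +contextual, fun _ _ _ => ?_⟩
        have h := hm1.swap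
        have h' := hm2.swap
        rw [← defect_swap] at h h'
        exact ⟨h, h'⟩
    · rcases hen : e n with E | E
      · exact ⟨(E, ∅), E.2, isClopen_empty, by simp +contextual, by simp,
          fun h1 h2 h3 => absurd ⟨h1, h2, h3⟩ hS⟩
      · exact ⟨(∅, E), isClopen_empty, E.2, by simp, by simp +contextual,
          fun h1 h2 h3 => absurd ⟨h1, h2, h3⟩ hS⟩
  choose A hA1 hA2 hAl hAr hAm using step
  let T : List Bool → Set C × Set D := fun l => l.rec (univ, univ) fun b l S =>
    bif b then (S.1 ∩ (A l.length S).1, S.2 ∩ (A l.length S).2)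
    else (S.1 \ (A l.length S).1, S.2 \ (A l.length S).2)
  have hT : ∀ l, IsClopen (T l).1 ∧ IsClopen (T l).2 ∧ ((T l).1.Nonempty ↔ (T l).2.Nonempty) := by
    intro l
    induction l with
    | nil => exact ⟨isClopen_univ, isClopen_univ, by simp [T]⟩
    | cons b l ih =>
      obtain ⟨h1, h2, h3⟩ := ih
      have hm := hAm l.length (T l) h1 h2 h3
      cases b
      · exact ⟨h1.diff (hA1 _ _), h2.diff (hA2 _ _), hm.2.1⟩
      · exact ⟨h1.inter (hA1 _ _), h2.inter (hA2 _ _), hm.1.1⟩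
  refine ⟨fun l => (T l).1, fun l => (T l).2, ⟨rfl, fun l => ⟨_, hA1 l.length (T l), rfl, rfl⟩, ?_⟩,
    ⟨rfl, fun l => ⟨_, hA2 l.length (T l), rfl, rfl⟩, ?_⟩, fun l => (hT l).2.2, ?_⟩
  · intro E hE
    obtain ⟨n, hn⟩ := he (Sum.inl ⟨E, hE⟩)
    refine ⟨n, fun l hl => ?_⟩
    have := hAl l.length (T l) ⟨E, hE⟩ (hl ▸ hn)
    exact congrArg ((T l).1 ∩ ·) this
  · intro E hE
    obtain ⟨n, hn⟩ := he (Sum.inr ⟨E, hE⟩)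
    refine ⟨n, fun l hl => ?_⟩
    have := hAr l.length (T l) ⟨E, hE⟩ (hl ▸ hn)
    exact congrArg ((T l).2 ∩ ·) this
  · intro b l hne
    obtain ⟨h1, h2, h3⟩ := hT l
    have hm := hAm l.length (T l) h1 h2 h3
    cases b
    · exact hm.2.2 hne
    · exact hm.1.2 hne

lemma SplitTree.abs_defect_sub_le {D : Type*} {M : D → ℝ≥0∞} {P : List Bool → Set C}
    {Q : List Bool → Set D} (hP : SplitTree P)
    (hd : ∀ b l, (P (b :: l)).Nonempty →
      |defect N M (P (b :: l)) (Q (b :: l)) - defect N M (P l) (Q l)| ≤ (1 / 2) ^ l.length)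
    {x : C} {l : List Bool} (hx : x ∈ P l) (k : ℕ) :
    ∀ l' : List Bool, l'.length = l.length + k → x ∈ P l' →
      |defect N M (P l') (Q l') - defect N M (P l) (Q l)| ≤
        2 * (1 / 2) ^ l.length - 2 * (1 / 2) ^ (l.length + k) := by
  induction k with
  | zero =>
    intro l' hl' hx'
    rw [hP.eq_of_mem hl' hx' hx]
    simp
  | succ k ih =>
    intro l' hl' hx'
    obtain ⟨b, l', rfl⟩ := List.exists_cons_of_length_eq_add_one (n := l.length + k) hl'
    have hlen : l'.length = l.length + k := Nat.succ_injective hl'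
    have h1 := ih l' hlen (hP.cons_subset b l' hx')
    have h2 := hd b l' ⟨x, hx'⟩
    have h3 := abs_sub_le (defect N M (P (b :: l')) (Q (b :: l'))) (defect N M (P l') (Q l'))
      (defect N M (P l) (Q l))
    rw [hlen] at h2
    rw [← add_assoc, pow_succ]
    linarith

lemma SplitTree.toReal_le_of_mem {P : List Bool → Set C} {Q : List Bool → Set D}
    [CompactSpace D] [T2Space D] [TotallyDisconnectedSpace D]
    (hP : SplitTree P) (hQ : SplitTree Q) (hM : IsLelek M)
    (hd : ∀ b l, (P (b :: l)).Nonempty →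
      |defect N M (P (b :: l)) (Q (b :: l)) - defect N M (P l) (Q l)| ≤ (1 / 2) ^ l.length)
    {x : C} {y : D} (hxy : ∀ l, x ∈ P l ↔ y ∈ Q l) {l : List Bool} (hx : x ∈ P l) (hNx : N x ≠ ∞) :
    M y ≠ ∞ ∧
      (M y).toReal ≤ (N x).toReal + defect N M (P l) (Q l) + 2 * (1 / 2) ^ l.length := by
  have hnonneg : 0 ≤ (N x).toReal + defect N M (P l) (Q l) + 2 * (1 / 2) ^ l.length := by
    have h1 := ENNReal.toReal_mono hNx (cellInf_le (N := N) hx)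
    have h2 : 0 ≤ (cellInf M (Q l)).toReal := ENNReal.toReal_nonneg
    have h3 : (0 : ℝ) < 2 * (1 / 2) ^ l.length := by positivity
    simp only [defect]
    linarith
  suffices h : M y ≤ ENNReal.ofReal
      ((N x).toReal + defect N M (P l) (Q l) + 2 * (1 / 2) ^ l.length) from
    ⟨ne_top_of_le_ne_top ENNReal.ofReal_ne_top h, ENNReal.toReal_le_of_le_ofReal hnonneg h⟩
  refine hQ.le_of_forall_cellInf_le hM.lsc (n := l.length) fun l' hl' hy' => ?_
  have hx' := (hxy l').2 hy'
  obtain ⟨k, hk⟩ := Nat.exists_eq_add_of_le hl'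
  have h1 := (abs_le.1 (hP.abs_defect_sub_le hd hx k l' hk hx')).2
  rw [← ENNReal.ofReal_toReal (hM.cellInf_ne_top (hQ.isClopen l').2 ⟨y, hy'⟩)]
  apply ENNReal.ofReal_le_ofReal
  have h2 := ENNReal.toReal_mono hNx (cellInf_le (N := N) hx')
  have h3 : (cellInf M (Q l')).toReal = (cellInf N (P l')).toReal + defect N M (P l') (Q l') := by
    simp [defect]
  have h4 : (0 : ℝ) < 2 * (1 / 2) ^ (l.length + k) := by positivity
  linarith

/-- Two Lelek functions on compact zero-dimensional metrizable spaces agree up to a homeomorphism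
and the addition of a continuous function. -/
theorem IsLelek.exists_homeomorph [CompactSpace C] [T2Space C] [TotallyDisconnectedSpace C]
    [SecondCountableTopology C] [CompactSpace D] [T2Space D] [TotallyDisconnectedSpace D]
    [SecondCountableTopology D] [Nonempty C] [Nonempty D] (hN : IsLelek N) (hM : IsLelek M) :
    ∃ h : C ≃ₜ D, (∀ x, N x ≠ ∞ ↔ M (h x) ≠ ∞) ∧
      ContinuousOn (fun x => (M (h x)).toReal - (N x).toReal) {x | N x ≠ ∞} := by
  obtain ⟨P, Q, hP, hQ, hPQ, hd⟩ := hN.exists_matched_trees hM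
  obtain ⟨h, hh⟩ := hP.exists_homeomorph hQ hPQ
  have hd' : ∀ b l, (Q (b :: l)).Nonempty →
      |defect M N (Q (b :: l)) (P (b :: l)) - defect M N (Q l) (P l)| ≤ (1 / 2) ^ l.length := by
    intro b l hne
    rw [defect_swap, defect_swap (N := N) (P l), ← neg_sub', abs_neg]
    exact hd b l ((hPQ _).2 hne)
  have key1 : ∀ {x l}, x ∈ P l → N x ≠ ∞ → M (h x) ≠ ∞ ∧
      (M (h x)).toReal ≤ (N x).toReal + defect N M (P l) (Q l) + 2 * (1 / 2) ^ l.length :=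
    fun hx hNx => hP.toReal_le_of_mem hQ hM hd (hh _) hx hNx
  have key2 : ∀ {x l}, x ∈ P l → M (h x) ≠ ∞ → N x ≠ ∞ ∧
      (N x).toReal ≤ (M (h x)).toReal - defect N M (P l) (Q l) + 2 * (1 / 2) ^ l.length := by
    intro x l hx hMx
    rw [sub_eq_add_neg, ← defect_swap]
    exact hQ.toReal_le_of_mem hP hN hd' (fun l => (hh x l).symm) ((hh x l).1 hx) hMx
  have hfin : ∀ x, N x ≠ ∞ ↔ M (h x) ≠ ∞ := by
    intro x
    have hx : x ∈ P [] := by simp [hP.root]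
    exact ⟨fun hx' => (key1 hx hx').1, fun hx' => (key2 hx hx').1⟩
  have key : ∀ {x l}, x ∈ P l → N x ≠ ∞ →
      |(M (h x)).toReal - (N x).toReal - defect N M (P l) (Q l)| ≤ 2 * (1 / 2) ^ l.length := by
    intro x l hx hNx
    have h1 := (key1 hx hNx).2
    have h2 := (key2 hx ((hfin x).1 hNx)).2
    rw [abs_le]
    constructor <;> linarith
  refine ⟨h, hfin, fun x hx => Metric.continuousWithinAt_iff'.2 fun ε hε => ?_⟩
  obtain ⟨n, hn⟩ := exists_pow_lt_of_lt_one (show 0 < ε / 4 by positivity)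
    (show (1 / 2 : ℝ) < 1 by norm_num)
  obtain ⟨l, hl, hxl⟩ := hP.exists_mem x n
  filter_upwards [mem_nhdsWithin_of_mem_nhds ((hP.isClopen l).2.mem_nhds hxl),
    self_mem_nhdsWithin] with z hz hNz
  have h1 := abs_le.1 (key hxl hx)
  have h2 := abs_le.1 (key hz hNz)
  rw [hl] at h1 h2
  rw [Real.dist_eq, abs_lt]
  constructor <;> linarith [h1.1, h1.2, h2.1, h2.2]

/-- `j` identifies `X` with the set where `N` is finite, and the topology of `X` is generated by
`j` together with the function `N ∘ j`. -/
structure IsChart {X C : Type*} [TopologicalSpace X] [TopologicalSpace C] (j : X → C)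
    (N : C → ℝ≥0∞) : Prop where
  injective : Function.Injective j
  mem_range_iff : ∀ c, c ∈ range j ↔ N c ≠ ∞
  continuous : Continuous j
  continuous_comp : Continuous (N ∘ j)
  le_nhds : ∀ x (l : Filter X), Tendsto j l (𝓝 (j x)) → Tendsto (N ∘ j) l (𝓝 (N (j x))) → l ≤ 𝓝 x

section Chart

variable {X Y : Type*} [TopologicalSpace X] [TopologicalSpace Y] {j : X → C} {i : Y → D}

lemma IsChart.ne_top (hj : IsChart j N) (x : X) : N (j x) ≠ ∞ :=
  (hj.mem_range_iff _).1 (mem_range_self x)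

lemma IsChart.continuous_of_comp_eq (hj : IsChart j N) (hi : IsChart i M) {h : C → D}
    (hh : Continuous h)
    (ha : ContinuousOn (fun x => (M (h x)).toReal - (N x).toReal) {x | N x ≠ ∞}) {f : X → Y}
    (hf : ∀ x, i (f x) = h (j x)) : Continuous f := by
  have hif : i ∘ f = h ∘ j := funext hf
  have h1 : Continuous fun x => (M (h (j x))).toReal - (N (j x)).toReal :=
    ha.comp_continuous hj.continuous hj.ne_top
  have h2 : Continuous fun x => (N (j x)).toReal :=
    ENNReal.continuousOn_toReal.comp_continuous hj.continuous_comp hj.ne_top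
  have h3 : Continuous fun x => ENNReal.ofReal (M (h (j x))).toReal := by
    refine (ENNReal.continuous_ofReal.comp (h1.add h2)).congr fun x => ?_
    simp
  have h4 : Continuous fun x => M (i (f x)) := by
    refine h3.congr fun x => ?_
    rw [ENNReal.ofReal_toReal, hf]
    rw [← hf]
    exact hi.ne_top _
  refine continuous_iff_continuousAt.2 fun x => hi.le_nhds _ _ ?_ (h4.tendsto x)
  rw [tendsto_map'_iff, hif, hf]
  exact (hh.comp hj.continuous).tendsto x

/-- Spaces with charts given by Lelek functions are homeomorphic. -/
theorem IsChart.nonempty_homeomorph [CompactSpace C] [T2Space C] [TotallyDisconnectedSpace C]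
    [SecondCountableTopology C] [CompactSpace D] [T2Space D] [TotallyDisconnectedSpace D]
    [SecondCountableTopology D] [Nonempty C] [Nonempty D] (hN : IsLelek N) (hM : IsLelek M)
    (hj : IsChart j N) (hi : IsChart i M) : Nonempty (X ≃ₜ Y) := by
  obtain ⟨h, hfin, ha⟩ := hN.exists_homeomorph hM
  have hf : ∀ x, ∃ y, i y = h (j x) := fun x => (hi.mem_range_iff _).2 ((hfin _).1 (hj.ne_top x))
  have hg : ∀ y, ∃ x, j x = h.symm (i y) := fun y =>
    (hj.mem_range_iff _).2 ((hfin _).2 (by simpa using hi.ne_top y))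
  choose f hf using hf
  choose g hg using hg
  have ha' : ContinuousOn (fun y => (N (h.symm y)).toReal - (M y).toReal) {y | M y ≠ ∞} := by
    have := (ha.comp h.symm.continuous.continuousOn (s := {y | M y ≠ ∞})
      fun y hy => (hfin _).2 (by simpa using hy)).neg
    refine this.congr fun y _ => ?_
    simp
  exact ⟨{
    toFun := f
    invFun := g
    left_inv := fun x => hj.injective (by rw [hg, hf, h.symm_apply_apply])
    right_inv := fun y => hi.injective (by rw [hf, hg, h.apply_symm_apply])
    continuous_toFun := hj.continuous_of_comp_eq hi h.continuous ha hf
    continuous_invFun := hi.continuous_of_comp_eq hj h.symm.continuous ha' hg }⟩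

/-- A chart may be restricted to the closure of its range, where the finite values are dense. -/
lemma IsChart.restrict_closure (hj : IsChart j N) (hlsc : LowerSemicontinuous N)
    (hfreq : ∀ x s t, N x ≤ s → s < t → ∃ᶠ y in 𝓝 x, s < N y ∧ N y < t) :
    IsLelek (fun c : closure (range j) => N c) ∧
      IsChart (fun x => (⟨j x, subset_closure (mem_range_self x)⟩ : closure (range j)))
        (fun c : closure (range j) => N c) := by
  refine ⟨⟨LowerSemicontinuous.comp hlsc continuous_subtype_val, ?_, ?_⟩, ⟨?_, ?_, ?_, ?_, ?_⟩⟩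
  · intro c
    rw [mem_closure_iff_frequently, nhds_subtype_eq_comap, frequently_comap]
    refine (mem_closure_iff_frequently.1 c.2).mono ?_
    rintro _ ⟨x, rfl⟩
    exact ⟨⟨j x, subset_closure (mem_range_self x)⟩, rfl, hj.ne_top x⟩
  · intro c s t hs hst
    rw [nhds_subtype_eq_comap, frequently_comap]
    refine (hfreq c s t hs hst).mono fun y hy => ?_
    exact ⟨⟨y, subset_closure ((hj.mem_range_iff _).2 hy.2.ne_top)⟩, rfl, hy⟩
  · exact fun x y hxy => hj.injective (congrArg Subtype.val hxy)
  · rintro ⟨c, hc⟩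
    simp only [← hj.mem_range_iff, mem_range, Subtype.mk.injEq]
  · exact hj.continuous.subtype_mk _
  · exact hj.continuous_comp
  · exact fun x l h1 h2 => hj.le_nhds x l (tendsto_subtype_rng.1 h1) h2

end Chart

end Lelek

section Vietoris

open Filter
open scoped ENNReal

lemma tendsto_induced_vietorisTop_iff {X S α : Type*} [τ : TopologicalSpace X] {v : S → Set X}
    (hv : ∀ s, (v s).Nonempty) {f : α → S} {l : Filter α} {s : S} :
    Tendsto f l (@nhds S ((VietorisTop τ).induced v) s) ↔ ∀ U : Set X, IsOpen U →
      (v s ⊆ U → ∀ᶠ a in l, v (f a) ⊆ U) ∧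
      ((v s ∩ U).Nonempty → ∀ᶠ a in l, (v (f a) ∩ U).Nonempty) := by
  let _ : TopologicalSpace (Set X) := VietorisTop τ
  rw [nhds_induced, tendsto_comap_iff]
  refine TopologicalSpace.tendsto_nhds_generateFrom_iff.trans ?_
  constructor
  · refine fun h U hU => ⟨fun hs => ?_, fun hs => ?_⟩
    · exact h _ (Or.inl ⟨U, hU, (hv s).mono hs, rfl⟩) hs
    · exact h _ (Or.inr ⟨U, hU, hs.mono inter_subset_right, rfl⟩) hs
  · rintro h _ (⟨U, hU, -, rfl⟩ | ⟨U, hU, -, rfl⟩) hs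
    · exact (h U hU).1 hs
    · exact (h U hU).2 hs

variable {X Z : Type*} [TopologicalSpace X] [TopologicalSpace Z] {k n : ℕ}

lemma HypFn.tendsto_iff {α : Type*} {f : α → HypFn n X} {l : Filter α} {F : HypFn n X} :
    Tendsto f l (𝓝 F) ↔ ∀ U : Set X, IsOpen U →
      (F.1 ⊆ U → ∀ᶠ a in l, (f a).1 ⊆ U) ∧
      ((F.1 ∩ U).Nonempty → ∀ᶠ a in l, ((f a).1 ∩ U).Nonempty) :=
  tendsto_induced_vietorisTop_iff fun F : HypFn n X => F.2.1

lemma HypFnDiff.tendsto_iff {α : Type*} {f : α → HypFnDiff k n X} {l : Filter α}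
    {F : HypFnDiff k n X} :
    Tendsto f l (𝓝 F) ↔ ∀ U : Set X, IsOpen U →
      (F.1 ⊆ U → ∀ᶠ a in l, (f a).1 ⊆ U) ∧
      ((F.1 ∩ U).Nonempty → ∀ᶠ a in l, ((f a).1 ∩ U).Nonempty) :=
  tendsto_induced_vietorisTop_iff fun F : HypFnDiff k n X => F.2.1

lemma HypFn.isOpen_setOf_subset {U : Set X} (hU : IsOpen U) :
    IsOpen {F : HypFn n X | F.1 ⊆ U} :=
  isOpen_iff_eventually.2 fun _ hF => (HypFn.tendsto_iff.1 tendsto_id U hU).1 hF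

lemma HypFn.isOpen_setOf_inter_nonempty {U : Set X} (hU : IsOpen U) :
    IsOpen {F : HypFn n X | (F.1 ∩ U).Nonempty} :=
  isOpen_iff_eventually.2 fun _ hF => (HypFn.tendsto_iff.1 tendsto_id U hU).2 hF

lemma HypFn.isClopen_setOf_inter_nonempty {B : Set X} (hB : IsClopen B) :
    IsClopen {F : HypFn n X | (F.1 ∩ B).Nonempty} := by
  refine ⟨⟨?_⟩, HypFn.isOpen_setOf_inter_nonempty hB.2⟩
  convert HypFn.isOpen_setOf_subset (n := n) hB.compl.2 using 1
  ext F
  simp [not_nonempty_iff_eq_empty, ← disjoint_iff_inter_eq_empty, subset_compl_iff_disjoint_right]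

/-- The image of a finite set under a map, as a map of symmetric products. -/
def HypFn.image (f : X → Z) (F : HypFn n X) : HypFn n Z :=
  ⟨f '' F.1, F.2.1.image f, F.2.2.1.image f, (ncard_image_le F.2.2.1).trans F.2.2.2⟩

/-- The inclusion of `F_n(X) ∖ F_k(X)` into `F_n(X)`. -/
def HypFnDiff.toHypFn (F : HypFnDiff k n X) : HypFn n X :=
  ⟨F.1, F.2.1, F.2.2.1, F.2.2.2.2⟩

lemma HypFnDiff.continuous_toHypFn : Continuous (HypFnDiff.toHypFn : HypFnDiff k n X → HypFn n X) :=
  continuous_iff_continuousAt.2 fun _ => HypFn.tendsto_iff.2 (HypFnDiff.tendsto_iff.1 tendsto_id)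

lemma HypFn.continuous_image {f : X → Z} (hf : Continuous f) :
    Continuous (HypFn.image f : HypFn n X → HypFn n Z) := by
  refine continuous_iff_continuousAt.2 fun F => HypFn.tendsto_iff.2 fun U hU => ?_
  have h := HypFn.tendsto_iff.1 (tendsto_id (x := 𝓝 F)) _ (hU.preimage hf)
  simpa only [HypFn.image, id, image_subset_iff, image_inter_nonempty_iff] using h

/-- A point of a symmetric product is the range of a tuple, which depends continuously on it. -/
instance HypFn.compactSpace [CompactSpace X] : CompactSpace (HypFn n X) := by
  rcases Nat.eq_zero_or_pos n with rfl | hn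
  · have : IsEmpty (HypFn 0 X) := ⟨fun F =>
      F.2.1.ne_empty ((ncard_eq_zero F.2.2.1).1 (Nat.le_zero.1 F.2.2.2))⟩
    infer_instance
  have : Nonempty (Fin n) := ⟨⟨0, hn⟩⟩
  let r : (Fin n → X) → HypFn n X := fun v => ⟨range v, range_nonempty v, finite_range v, by
    rw [← image_univ]
    exact (ncard_image_le finite_univ).trans (by simp [ncard_univ])⟩
  have hr : Continuous r := by
    refine continuous_iff_continuousAt.2 fun v => HypFn.tendsto_iff.2 fun U hU => ⟨?_, ?_⟩
    · intro h
      have : ∀ i, ∀ᶠ w : Fin n → X in 𝓝 v, w i ∈ U := fun i =>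
        (continuous_apply i).continuousAt.eventually_mem (hU.mem_nhds (h (mem_range_self i)))
      filter_upwards [eventually_all.2 this] with w hw
      rintro _ ⟨i, rfl⟩
      exact hw i
    · rintro ⟨_, ⟨i, rfl⟩, hi⟩
      filter_upwards [(continuous_apply i).continuousAt.eventually_mem (hU.mem_nhds hi)] with w hw
      exact ⟨w i, mem_range_self i, hw⟩
  have hsurj : Function.Surjective r := by
    rintro ⟨F, hne, hfin, hcard⟩
    have := hfin.fintype
    have := hne.to_subtype
    obtain ⟨e⟩ := Function.Embedding.nonempty_of_card_le (α := F) (β := Fin n) (by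
      rwa [← Nat.card_eq_fintype_card, Nat.card_coe_set_eq, Fintype.card_fin])
    refine ⟨fun i => (Function.invFun e i : F), Subtype.ext ?_⟩
    change range (Subtype.val ∘ Function.invFun e) = F
    rw [(Function.invFun_surjective e.injective).range_comp, Subtype.range_coe]
  exact hsurj.compactSpace hr

lemma HypFn.isOpen_setOf_lt_ncard [T2Space Z] : IsOpen {F : HypFn n Z | k < F.1.ncard} := by
  refine isOpen_iff_eventually.2 fun F hF => ?_
  obtain ⟨U, hU, hdisj⟩ := F.2.2.1.t2_separation
  have h : ∀ x ∈ F.1, ∀ᶠ G : HypFn n Z in 𝓝 F, (G.1 ∩ U x).Nonempty := fun x hx =>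
    (HypFn.isOpen_setOf_inter_nonempty (hU x).2).mem_nhds ⟨x, hx, (hU x).1⟩
  filter_upwards [(eventually_all_finite F.2.2.1).2 h] with G hG
  choose! g hgG hgU using hG
  refine lt_of_lt_of_le hF (ncard_le_ncard_of_injOn g hgG (fun x hx y hy hxy => ?_) G.2.2.1)
  by_contra hne
  exact disjoint_left.1 (hdisj hx hy hne) (hgU x hx) (hxy ▸ hgU y hy)

section Zero

variable [CompactSpace Z] [T2Space Z] [TotallyDisconnectedSpace Z]

/-- The trace of a finite set on the clopen sets. -/
def HypFn.trace (F : HypFn n Z) (B : TopologicalSpace.Clopens Z) : Bool :=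
  {F : HypFn n Z | (F.1 ∩ B).Nonempty}.boolIndicator F

lemma exists_isClopen_disjoint_finite {x : Z} {F : Set Z} (hF : F.Finite) (hx : x ∉ F) :
    ∃ B : Set Z, IsClopen B ∧ x ∈ B ∧ F ∩ B = ∅ := by
  obtain ⟨B, hB, hxB, hsub⟩ := compact_exists_isClopen_in_isOpen hF.isClosed.isOpen_compl hx
  exact ⟨B, hB, hxB, by
    rw [← disjoint_iff_inter_eq_empty]; exact (subset_compl_iff_disjoint_left.1 hsub)⟩

lemma HypFn.isEmbedding_trace : IsEmbedding (HypFn.trace : HypFn n Z → _) := by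
  refine (Continuous.isClosedEmbedding ?_ ?_).isEmbedding
  · exact continuous_pi fun B => (continuous_boolIndicator_iff_isClopen _).2
      (HypFn.isClopen_setOf_inter_nonempty B.2)
  · have key : ∀ F G : HypFn n Z, HypFn.trace F = HypFn.trace G → F.1 ⊆ G.1 := by
      intro F G h x hx
      by_contra hxG
      obtain ⟨B, hB, hxB, hGB⟩ := exists_isClopen_disjoint_finite G.2.2.1 hxG
      have h1 : HypFn.trace F ⟨B, hB⟩ = true :=
        (mem_iff_boolIndicator _ _).1 (show (F.1 ∩ B).Nonempty from ⟨x, hx, hxB⟩)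
      rw [h] at h1
      have h2 : (G.1 ∩ B).Nonempty := (mem_iff_boolIndicator _ _).2 h1
      exact h2.ne_empty hGB
    exact fun F G h => Subtype.ext (subset_antisymm (key F G h) (key G F h.symm))

instance HypFn.t2Space : T2Space (HypFn n Z) := HypFn.isEmbedding_trace.t2Space

instance HypFn.totallyDisconnectedSpace : TotallyDisconnectedSpace (HypFn n Z) :=
  HypFn.isEmbedding_trace.isTotallyDisconnected_range.1
    (isTotallyDisconnected_of_totallyDisconnectedSpace _)

instance HypFn.secondCountableTopology [SecondCountableTopology Z] :
    SecondCountableTopology (HypFn n Z) :=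
  have : Countable (TopologicalSpace.Clopens Z) :=
    TopologicalSpace.Clopens.countable_iff_secondCountable.2 inferInstance
  HypFn.isEmbedding_trace.secondCountableTopology

lemma HypFn.exists_continuous_ne_top_iff [SecondCountableTopology Z] :
    ∃ γ : HypFn n Z → ℝ≥0∞, Continuous γ ∧ ∀ F, γ F ≠ ∞ ↔ k < F.1.ncard := by
  let := TopologicalSpace.metrizableSpaceMetric (HypFn n Z)
  refine ⟨fun F => (Metric.infEDist F {F : HypFn n Z | k < F.1.ncard}ᶜ)⁻¹,
    continuous_inv.comp Metric.continuous_infEDist, fun F => ?_⟩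
  rw [Ne, ENNReal.inv_eq_top, ← Metric.mem_closure_iff_infEDist_zero,
    HypFn.isOpen_setOf_lt_ncard.isClosed_compl.closure_eq]
  simp

end Zero

end Vietoris

section HyperspaceChart

open Filter TopologicalSpace
open scoped ENNReal

lemma LowerSemicontinuous.tendsto_of_tendsto_add {α Y : Type*} [TopologicalSpace Y]
    {φ ψ : Y → ℝ≥0∞} (hφ : LowerSemicontinuous φ) (hψ : LowerSemicontinuous ψ) {u : α → Y}
    {l : Filter α} {y : Y} (hu : Tendsto u l (𝓝 y)) (hy : ψ y ≠ ∞)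
    (h : Tendsto (fun i => φ (u i) + ψ (u i)) l (𝓝 (φ y + ψ y))) :
    Tendsto (fun i => φ (u i)) l (𝓝 (φ y)) := by
  refine tendsto_order.2 ⟨fun c hc => hu.eventually (hφ y c hc), fun c hc => ?_⟩
  obtain ⟨r, hr, hrc⟩ := ENNReal.lt_iff_exists_add_pos_lt.1 hc
  rcases eq_or_ne (ψ y) 0 with h0 | h0
  · rw [h0, add_zero] at h
    filter_upwards [h.eventually_lt_const hc] with i hi
    exact lt_of_le_of_lt le_self_add hi
  · have h1 : ψ y - r < ψ y := ENNReal.sub_lt_self hy h0 (by exact_mod_cast hr.ne')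
    have h2 : φ y + ψ y < c + (ψ y - r) := calc
      φ y + ψ y ≤ φ y + r + (ψ y - r) := by
        rw [add_assoc]
        gcongr
        exact le_add_tsub
      _ < c + (ψ y - r) := ENNReal.add_lt_add_right (ne_top_of_lt h1) hrc
    filter_upwards [h.eventually_lt_const h2, hu.eventually (hψ y _ h1)] with i hi hi'
    by_contra! hc
    exact hi.not_ge (add_le_add hc hi'.le)

variable {X Z : Type*} {k n : ℕ} {N : Z → ℝ≥0∞}

/-- The supremum of `N` over the part of `F` lying in `B`. -/
def supOn (N : Z → ℝ≥0∞) (B F : Set Z) : ℝ≥0∞ := ⨆ x ∈ F ∩ B, N x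

lemma lt_supOn_iff {B F : Set Z} {c : ℝ≥0∞} :
    c < supOn N B F ↔ (F ∩ (B ∩ {x | c < N x})).Nonempty := by
  simp only [supOn, lt_iSup_iff, Set.Nonempty, mem_inter_iff, mem_ofPred_eq, exists_prop, and_assoc]

lemma le_supOn {B F : Set Z} {x : Z} (hx : x ∈ F) (hB : x ∈ B) : N x ≤ supOn N B F :=
  le_iSup₂ (f := fun x (_ : x ∈ F ∩ B) => N x) x ⟨hx, hB⟩

lemma supOn_le {B F : Set Z} {c : ℝ≥0∞} (h : ∀ x ∈ F, x ∈ B → N x ≤ c) : supOn N B F ≤ c :=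
  iSup₂_le fun x hx => h x hx.1 hx.2

lemma supOn_lt {B F : Set Z} (hF : F.Finite) {c : ℝ≥0∞} (hc : 0 < c)
    (h : ∀ x ∈ F, x ∈ B → N x < c) : supOn N B F < c := by
  rcases (F ∩ B).eq_empty_or_nonempty with h0 | h0
  · simpa [supOn, h0] using hc
  · obtain ⟨x, hx, hmax⟩ := exists_max_image _ N (hF.inter_of_left B) h0
    exact (supOn_le fun y hy hyB => hmax y ⟨hy, hyB⟩).trans_lt (h x hx.1 hx.2)

lemma supOn_mono {B B' F : Set Z} (h : B ⊆ B') : supOn N B F ≤ supOn N B' F :=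
  supOn_le fun _ hx hB => le_supOn hx (h hB)

variable [TopologicalSpace X] [TopologicalSpace Z] {w : Clopens Z → ℝ≥0∞}

/-- The weighted sum, over all clopen sets `B`, of the supremum of `N` over `F ∩ B`. -/
def wSup (w : Clopens Z → ℝ≥0∞) (N : Z → ℝ≥0∞) (F : Set Z) : ℝ≥0∞ := ∑' B, w B * supOn N B F

lemma supOn_le_supOn_top (B F : Set Z) : supOn N B F ≤ supOn N (⊤ : Clopens Z) F :=
  supOn_mono (subset_univ _)

lemma lowerSemicontinuous_supOn (hN : LowerSemicontinuous N) (B : Clopens Z) :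
    LowerSemicontinuous fun F : HypFn n Z => supOn N B F.1 := by
  refine lowerSemicontinuous_iff_isOpen_preimage.2 fun c => ?_
  convert HypFn.isOpen_setOf_inter_nonempty (n := n) (B.2.2.inter (hN.isOpen_preimage c)) using 1
  ext F
  exact lt_supOn_iff

lemma ENNReal.lowerSemicontinuous_const_mul {Y : Type*} [TopologicalSpace Y] {f : Y → ℝ≥0∞}
    (hf : LowerSemicontinuous f) {a : ℝ≥0∞} (ha : a ≠ ∞) : LowerSemicontinuous fun y => a * f y :=
  (ENNReal.continuous_const_mul ha).comp_lowerSemicontinuous hf fun _ _ h => by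
    dsimp only
    gcongr

lemma lowerSemicontinuous_wSup (hN : LowerSemicontinuous N) (hw : ∀ B, w B ≠ ∞) :
    LowerSemicontinuous fun F : HypFn n Z => wSup w N F.1 :=
  lowerSemicontinuous_tsum fun B =>
    ENNReal.lowerSemicontinuous_const_mul (lowerSemicontinuous_supOn hN B) (hw B)

lemma mul_supOn_top_le_wSup (F : Set Z) : w ⊤ * supOn N (⊤ : Clopens Z) F ≤ wSup w N F :=
  ENNReal.le_tsum (f := fun B => w B * supOn N B F) ⊤

lemma wSup_ne_top_iff (hw0 : ∀ B, w B ≠ 0) (hw : ∑' B, w B ≠ ∞) {F : Set Z} (hF : F.Finite) :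
    wSup w N F ≠ ∞ ↔ ∀ x ∈ F, N x ≠ ∞ := by
  constructor
  · intro h x hx hx'
    have h1 : supOn N (⊤ : Clopens Z) F = ∞ := top_le_iff.1 (hx' ▸ le_supOn hx (mem_univ x))
    refine h (top_le_iff.1 (le_trans ?_ (mul_supOn_top_le_wSup (w := w) F)))
    rw [h1, ENNReal.mul_top (hw0 _)]
  · intro h
    have h1 : supOn N (⊤ : Clopens Z) F < ∞ :=
      supOn_lt hF ENNReal.zero_lt_top fun x hx _ => (h x hx).lt_top
    have h2 : wSup w N F ≤ (∑' B, w B) * supOn N (⊤ : Clopens Z) F := by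
      rw [← ENNReal.tsum_mul_right]
      exact ENNReal.tsum_le_tsum fun B => by
        gcongr
        exact supOn_le_supOn_top _ _
    exact ne_top_of_le_ne_top (ENNReal.mul_ne_top hw h1.ne) h2

variable {j : X → Z}

lemma IsChart.exists_mem_nhds (hj : IsChart j N) (hN : LowerSemicontinuous N) {x : X} {U : Set X}
    (hU : U ∈ 𝓝 x) : ∃ V ∈ 𝓝 (j x), ∃ c, N (j x) < c ∧ ∀ y, j y ∈ V → N (j y) < c → y ∈ U := by
  have h := hj.le_nhds x (comap j (𝓝 (j x)) ⊓ comap (N ∘ j) (𝓝 (N (j x))))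
    (tendsto_comap.mono_left inf_le_left) (tendsto_comap.mono_left inf_le_right) hU
  obtain ⟨_, ⟨V, hV, hV'⟩, _, ⟨W, hW, hW'⟩, rfl⟩ := mem_inf_iff.1 h
  obtain ⟨c, hc, hcW⟩ := exists_Ico_subset_of_mem_nhds hW ⟨∞, (hj.ne_top x).lt_top⟩
  have hlow : ∀ᶠ z in 𝓝 (j x), N z ≤ N (j x) → N z ∈ W := by
    rcases eq_or_ne (N (j x)) 0 with h0 | h0
    · refine .of_forall fun z hz => ?_
      rw [h0] at hz hW
      rw [le_zero_iff.1 hz]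
      exact mem_of_mem_nhds hW
    · obtain ⟨b, hb, hbW⟩ := exists_Ioc_subset_of_mem_nhds hW ⟨0, pos_iff_ne_zero.2 h0⟩
      filter_upwards [hN (j x) b hb] with z hz hz'
      exact hbW ⟨hz, hz'⟩
  refine ⟨_, inter_mem hV hlow, c, hc, fun y hy hyc => ⟨hV' hy.1, hW' ?_⟩⟩
  rcases le_total (N (j y)) (N (j x)) with h | h
  · exact hy.2 h
  · exact hcW ⟨h, hyc⟩

/-- The map of hyperspaces induced by `j`. -/
def HypFnDiff.imageHypFn (j : X → Z) (F : HypFnDiff k n X) : HypFn n Z := F.toHypFn.image j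

lemma HypFnDiff.continuous_imageHypFn (hj : Continuous j) :
    Continuous (HypFnDiff.imageHypFn j : HypFnDiff k n X → HypFn n Z) :=
  (HypFn.continuous_image hj).comp HypFnDiff.continuous_toHypFn

lemma IsChart.continuous_supOn (hj : IsChart j N) (hN : LowerSemicontinuous N) (B : Clopens Z) :
    Continuous fun F : HypFnDiff k n X => supOn N B (F.imageHypFn j).1 := by
  refine continuous_iff_continuousAt.2 fun F => tendsto_order.2 ⟨fun c hc => ?_, fun c hc => ?_⟩
  · exact (HypFnDiff.continuous_imageHypFn hj.continuous).continuousAt.eventually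
      (lowerSemicontinuous_supOn hN B _ c hc)
  · have hU : IsOpen {x | j x ∈ B → N (j x) < c} := by
      have : {x | j x ∈ B → N (j x) < c} = j ⁻¹' (B : Set Z)ᶜ ∪ (N ∘ j) ⁻¹' Iio c := by
        ext x
        simp [imp_iff_not_or]
      rw [this]
      exact (B.2.compl.2.preimage hj.continuous).union (isOpen_Iio.preimage hj.continuous_comp)
    filter_upwards [(HypFnDiff.tendsto_iff.1 (tendsto_id (x := 𝓝 F)) _ hU).1 fun x hx hxB =>
      (le_supOn (mem_image_of_mem j hx) hxB).trans_lt hc] with G hG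
    refine supOn_lt (G.imageHypFn j).2.2.1 (pos_of_gt hc) ?_
    rintro _ ⟨x, hx, rfl⟩ hxB
    exact hG hx hxB

lemma IsChart.continuous_wSup (hj : IsChart j N) (hN : LowerSemicontinuous N)
    (hw : ∑' B, w B ≠ ∞) :
    Continuous fun F : HypFnDiff k n X => wSup w N (F.imageHypFn j).1 := by
  have hwB : ∀ B, w B ≠ ∞ := ENNReal.ne_top_of_tsum_ne_top hw
  have hfin : ∀ (F : HypFnDiff k n X) (B : Clopens Z), supOn N B (F.imageHypFn j).1 ≠ ∞ := by
    refine fun F B => (supOn_lt (F.imageHypFn j).2.2.1 ENNReal.zero_lt_top ?_).ne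
    rintro _ ⟨x, -, rfl⟩ -
    exact (hj.ne_top x).lt_top
  let φ : HypFnDiff k n X → ℝ≥0∞ := fun F => wSup w N (F.imageHypFn j).1
  let ψ : HypFnDiff k n X → ℝ≥0∞ := fun F => ∑' B : Clopens Z,
    w B * (supOn N (⊤ : Clopens Z) (F.imageHypFn j).1 - supOn N B (F.imageHypFn j).1)
  have hsum : ∀ F, φ F + ψ F = (∑' B, w B) * supOn N (⊤ : Clopens Z) (F.imageHypFn j).1 := by
    intro F
    simp only [φ, ψ, wSup]
    rw [← ENNReal.tsum_add, ← ENNReal.tsum_mul_right]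
    refine tsum_congr fun B => ?_
    rw [← mul_add, add_tsub_cancel_of_le (supOn_le_supOn_top _ _)]
  have hψ : LowerSemicontinuous ψ := lowerSemicontinuous_tsum fun B =>
    ENNReal.lowerSemicontinuous_const_mul (continuous_iff_continuousAt.2 fun F =>
      ENNReal.Tendsto.sub (hj.continuous_supOn hN ⊤).continuousAt
        (hj.continuous_supOn hN B).continuousAt (Or.inl (hfin F ⊤))).lowerSemicontinuous (hwB B)
  have hφ : LowerSemicontinuous φ :=
    (lowerSemicontinuous_wSup hN hwB).comp (HypFnDiff.continuous_imageHypFn hj.continuous)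
  refine continuous_iff_continuousAt.2 fun F => hφ.tendsto_of_tendsto_add hψ tendsto_id ?_ ?_
  · refine ne_top_of_le_ne_top (ENNReal.mul_ne_top hw (hfin F ⊤)) ?_
    rw [← hsum]
    exact le_add_self
  · simp only [hsum]
    exact ((ENNReal.continuous_const_mul hw).comp (hj.continuous_supOn hN ⊤)).tendsto F

lemma eventually_supOn_lt_of_tendsto_wSup (hN : LowerSemicontinuous N) (hw0 : ∀ B, w B ≠ 0)
    (hw : ∑' B, w B ≠ ∞) {α : Type*} {u : α → HypFn n Z} {l : Filter α} {F : HypFn n Z}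
    (hu : Tendsto u l (𝓝 F)) (hF : wSup w N F.1 ≠ ∞)
    (h : Tendsto (fun i => wSup w N (u i).1) l (𝓝 (wSup w N F.1))) (B : Clopens Z) {c : ℝ≥0∞}
    (hc : supOn N B F.1 < c) : ∀ᶠ i in l, supOn N B (u i).1 < c := by
  classical
  have hwB : ∀ B, w B ≠ ∞ := ENNReal.ne_top_of_tsum_ne_top hw
  let ψ : HypFn n Z → ℝ≥0∞ := fun G => ∑' B', if B' = B then 0 else w B' * supOn N B' G.1
  have hlsc : ∀ B, LowerSemicontinuous fun G : HypFn n Z => w B * supOn N B G.1 := fun B =>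
    ENNReal.lowerSemicontinuous_const_mul (lowerSemicontinuous_supOn hN B) (hwB B)
  have hψ : LowerSemicontinuous ψ := lowerSemicontinuous_tsum fun B' => by
    split_ifs
    · exact lowerSemicontinuous_const
    · exact hlsc B'
  have hsum : ∀ G : HypFn n Z, wSup w N G.1 = w B * supOn N B G.1 + ψ G := fun G =>
    ENNReal.tsum_eq_add_tsum_ite (f := fun B => w B * supOn N B G.1) B
  have h1 := (hlsc B).tendsto_of_tendsto_add hψ hu
    (ne_top_of_le_ne_top hF (le_add_self.trans_eq (hsum F).symm))
    ((h.congr fun i => hsum (u i)).trans_eq (congrArg 𝓝 (hsum F)))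
  have h2 : w B * supOn N B F.1 < w B * c :=
    (ENNReal.mul_lt_mul_iff_right (hw0 B) (hwB B)).2 hc
  filter_upwards [h1.eventually_lt_const h2] with i hi
  exact (ENNReal.mul_lt_mul_iff_right (hw0 B) (hwB B)).1 hi

lemma IsChart.le_nhds_hypFnDiff [CompactSpace Z] [T2Space Z] [TotallyDisconnectedSpace Z]
    (hj : IsChart j N) (hN : LowerSemicontinuous N)
    (hw0 : ∀ B, w B ≠ 0) (hw : ∑' B, w B ≠ ∞) {F : HypFnDiff k n X} {l : Filter (HypFnDiff k n X)}
    (hl : Tendsto (HypFnDiff.imageHypFn j) l (𝓝 (F.imageHypFn j)))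
    (h : Tendsto (fun G => wSup w N (G.imageHypFn j).1) l (𝓝 (wSup w N (F.imageHypFn j).1))) :
    l ≤ 𝓝 F := by
  have hF : wSup w N (F.imageHypFn j).1 ≠ ∞ := by
    rw [wSup_ne_top_iff hw0 hw (F.imageHypFn j).2.2.1]
    rintro _ ⟨x, -, rfl⟩
    exact hj.ne_top x
  have key : ∀ x ∈ F.1, ∀ U ∈ 𝓝 x, ∃ B : Clopens Z, j x ∈ B ∧
      ∀ᶠ G in l, ∀ y ∈ G.1, j y ∈ B → y ∈ U := by
    intro x hx U hU
    obtain ⟨V, hV, c, hc, hVU⟩ := hj.exists_mem_nhds hN hU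
    have hfin : (j '' (F.1 \ {x})).Finite := F.2.2.1.sdiff.image j
    have hx' : j x ∉ j '' (F.1 \ {x}) := by
      rintro ⟨y, hy, hxy⟩
      exact hy.2 (hj.injective hxy)
    obtain ⟨B, hB, hxB, hBV⟩ := compact_exists_isClopen_in_isOpen
      (isOpen_interior.inter hfin.isClosed.isOpen_compl) ⟨mem_interior_iff_mem_nhds.2 hV, hx'⟩
    refine ⟨⟨B, hB⟩, hxB, ?_⟩
    have hlt : supOn N (⟨B, hB⟩ : Clopens Z) (F.imageHypFn j).1 < c := by
      refine (supOn_le ?_).trans_lt hc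
      rintro _ ⟨y, hy, rfl⟩ hyB
      by_cases hyx : y = x
      · rw [hyx]
      · exact absurd ⟨y, ⟨hy, hyx⟩, rfl⟩ (hBV hyB).2
    filter_upwards [eventually_supOn_lt_of_tendsto_wSup hN hw0 hw hl hF h _ hlt] with G hG y hy hyB
    exact hVU y (interior_subset (hBV hyB).1)
      ((le_supOn (mem_image_of_mem j hy) hyB).trans_lt hG)
  rw [← tendsto_id']
  refine HypFnDiff.tendsto_iff.2 fun U hU => ⟨fun hFU => ?_, ?_⟩
  · choose! B hxB hB using fun x hx => key x hx U (hU.mem_nhds (hFU hx))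
    have h1 := (HypFn.tendsto_iff.1 hl (⋃ x ∈ F.1, B x) (isOpen_biUnion fun x _ => (B x).2.2)).1 (by
      rintro _ ⟨x, hx, rfl⟩
      exact mem_biUnion hx (hxB x hx))
    filter_upwards [h1, (eventually_all_finite F.2.2.1).2 hB] with G hG hGB y hy
    obtain ⟨x, hx, hyx⟩ := mem_iUnion₂.1 (hG (mem_image_of_mem j hy))
    exact hGB x hx y hy hyx
  · rintro ⟨x, hx, hxU⟩
    obtain ⟨B, hxB, hB⟩ := key x hx U (hU.mem_nhds hxU)
    filter_upwards [hB, (HypFn.tendsto_iff.1 hl B B.2.2).2 ⟨j x, mem_image_of_mem j hx, hxB⟩]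
      with G hG
    rintro ⟨_, ⟨y, hy, rfl⟩, hyB⟩
    exact ⟨y, hy, hG y hy hyB⟩

lemma IsChart.hypFnDiff [CompactSpace Z] [T2Space Z] [TotallyDisconnectedSpace Z]
    (hj : IsChart j N) (hN : LowerSemicontinuous N)
    (hw0 : ∀ B, w B ≠ 0) (hw : ∑' B, w B ≠ ∞) {γ : HypFn n Z → ℝ≥0∞} (hγ : Continuous γ)
    (hγtop : ∀ F, γ F ≠ ∞ ↔ k < F.1.ncard) :
    IsChart (HypFnDiff.imageHypFn j : HypFnDiff k n X → HypFn n Z)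
      (fun F => wSup w N F.1 + γ F) where
  injective F G h := Subtype.ext (hj.injective.image_injective (congrArg Subtype.val h))
  mem_range_iff F := by
    rw [ENNReal.add_ne_top, wSup_ne_top_iff hw0 hw F.2.2.1, hγtop]
    simp only [← hj.mem_range_iff]
    constructor
    · rintro ⟨G, rfl⟩
      refine ⟨fun x hx => image_subset_range _ _ hx, ?_⟩
      exact G.2.2.2.1.trans_eq (ncard_image_of_injective _ hj.injective).symm
    · rintro ⟨hF, hcard⟩
      have him : j '' (j ⁻¹' F.1) = F.1 := image_preimage_eq_of_subset hF
      have hc : (j ⁻¹' F.1).ncard = F.1.ncard := by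
        rw [← ncard_image_of_injective _ hj.injective, him]
      refine ⟨⟨j ⁻¹' F.1, F.2.1.preimage' hF, F.2.2.1.preimage hj.injective.injOn,
        hcard.trans_eq hc.symm, hc.trans_le F.2.2.2⟩, Subtype.ext him⟩
  continuous := HypFnDiff.continuous_imageHypFn hj.continuous
  continuous_comp := (hj.continuous_wSup hN hw).add
    (hγ.comp (HypFnDiff.continuous_imageHypFn hj.continuous))
  le_nhds F l h1 h2 := by
    refine hj.le_nhds_hypFnDiff hN hw0 hw h1 ?_
    refine (lowerSemicontinuous_wSup hN (ENNReal.ne_top_of_tsum_ne_top hw)).tendsto_of_tendsto_add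
      hγ.lowerSemicontinuous h1 ((hγtop _).2 ?_) h2
    exact F.2.2.2.1.trans_eq (ncard_image_of_injective _ hj.injective).symm

/-- Every point can be moved, staying close to it, so that `N` tends to infinity by small steps. -/
def HasSmallSteps (N : Z → ℝ≥0∞) : Prop :=
  ∀ δ : ℝ≥0∞, δ ≠ 0 → ∃ T : ℕ → ℕ → Z → Z, (∀ m x, T m 0 x = x) ∧
    (∀ m i x, N (T m (i + 1) x) ≤ N (T m i x) + δ) ∧
    (∀ m x, Tendsto (fun i => N (T m i x)) atTop (𝓝 ∞)) ∧
    ∀ x, ∀ U ∈ 𝓝 x, ∀ᶠ m in atTop, ∀ i, T m i x ∈ U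

lemma wSup_image_le_add {f g : Z → Z} {F : Set Z} {s r : ℝ≥0∞} (hw1 : ∑' B, w B ≤ 1)
    {I : Finset (Clopens Z)} {S : ℝ≥0∞} (hI : ∑' B : {B // B ∉ I}, w B * S ≤ r)
    (hF : wSup w N (f '' F) ≤ s) (hS : supOn N (⊤ : Clopens Z) (f '' F) ≤ S)
    (hf : ∀ x ∈ F, N (g x) ≤ N (f x) + r) (hB : ∀ x ∈ F, ∀ B ∈ I, g x ∈ B → f x ∈ B) :
    wSup w N (g '' F) ≤ s + (r + r) := by
  have hstep : ∀ B : Set Z, (∀ x ∈ F, g x ∈ B → f x ∈ B) →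
      supOn N B (g '' F) ≤ supOn N B (f '' F) + r := by
    intro B hB
    refine supOn_le ?_
    rintro _ ⟨x, hx, rfl⟩ hxB
    exact (hf x hx).trans (by gcongr; exact le_supOn (mem_image_of_mem f hx) (hB x hx hxB))
  have hterm : ∀ B : Clopens Z, w B * supOn N B (g '' F) ≤
      w B * supOn N B (f '' F) + (w B * r + {B | B ∉ I}.indicator (fun B => w B * S) B) := by
    intro B
    by_cases hBI : B ∈ I
    · rw [indicator_of_notMem (by simpa using hBI), add_zero, ← mul_add]
      gcongr
      exact hstep B fun x hx => hB x hx B hBI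
    · rw [indicator_of_mem (by simpa using hBI), ← mul_add]
      refine le_trans ?_ le_add_self
      gcongr
      calc supOn N B (g '' F) ≤ supOn N (⊤ : Clopens Z) (g '' F) := supOn_le_supOn_top _ _
        _ ≤ supOn N (⊤ : Clopens Z) (f '' F) + r := hstep _ fun x _ _ => mem_univ x
        _ ≤ r + S := by
          rw [add_comm]
          gcongr
  calc wSup w N (g '' F) ≤ _ := ENNReal.tsum_le_tsum hterm
    _ = wSup w N (f '' F) + ((∑' B, w B) * r + ∑' B : {B // B ∉ I}, w B * S) := by
      rw [ENNReal.tsum_add, ENNReal.tsum_add, ENNReal.tsum_mul_right, ← tsum_subtype]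
      rfl
    _ ≤ s + (1 * r + r) := by gcongr
    _ = s + (r + r) := by rw [one_mul]

lemma HasSmallSteps.frequently_wSup (hT : HasSmallSteps N) (hw0 : ∀ B, w B ≠ 0)
    (hw1 : ∑' B, w B ≤ 1) (F : HypFn n Z) (s t : ℝ≥0∞) (hF : wSup w N F.1 ≤ s) (hst : s < t) :
    ∃ᶠ G : HypFn n Z in 𝓝 F, s < wSup w N G.1 ∧ wSup w N G.1 < t := by
  have hw : ∑' B, w B ≠ ∞ := ne_top_of_le_ne_top ENNReal.one_ne_top hw1
  have hwtop : w ⊤ ≠ ∞ := ENNReal.ne_top_of_tsum_ne_top hw ⊤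
  obtain ⟨r, hr, hrt⟩ := ENNReal.lt_iff_exists_add_pos_lt.1 hst
  have hr2 : (r / 2 : ℝ≥0∞) ≠ 0 := (ENNReal.half_pos (by exact_mod_cast hr.ne')).ne'
  let S := s / w ⊤
  have hS : ∀ G : Set Z, wSup w N G ≤ s → supOn N (⊤ : Clopens Z) G ≤ S := fun G hG => by
    rw [ENNReal.le_div_iff_mul_le (Or.inl (hw0 _)) (Or.inl hwtop), mul_comm]
    exact (mul_supOn_top_le_wSup G).trans hG
  have hStop : S ≠ ∞ := ENNReal.div_ne_top hst.ne_top (hw0 _)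
  have htail := ENNReal.tendsto_tsum_compl_atTop_zero (f := fun B => w B * S)
    (by rw [ENNReal.tsum_mul_right]; exact ENNReal.mul_ne_top hw hStop)
  obtain ⟨I, hI⟩ := (htail.eventually_lt_const (pos_iff_ne_zero.2 hr2)).exists
  obtain ⟨T, hT0, hTstep, hTtop, hTnhds⟩ := hT _ hr2
  have hmem : ∀ᶠ m in atTop, ∀ x ∈ F.1, ∀ B ∈ I, ∀ i, T m i x ∈ B ↔ x ∈ B := by
    refine (eventually_all_finite F.2.2.1).2 fun x _ => (eventually_all_finset I).2 fun B _ => ?_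
    by_cases hx : x ∈ B
    · filter_upwards [hTnhds x B (B.2.2.mem_nhds hx)] with m hm i
      exact iff_of_true (hm i) hx
    · filter_upwards [hTnhds x (B : Set Z)ᶜ (B.2.compl.2.mem_nhds hx)] with m hm i
      exact iff_of_false (hm i) hx
  have hex : ∀ᶠ m in atTop, ∃ i, s < wSup w N (T m i '' F.1) ∧ wSup w N (T m i '' F.1) < t := by
    filter_upwards [hmem] with m hm
    have h1 : ∃ i, s < wSup w N (T m i '' F.1) := by
      obtain ⟨x, hx⟩ := F.2.1
      obtain ⟨i, hi⟩ := ((hTtop m x).eventually_const_lt hStop.lt_top).exists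
      refine ⟨i, ?_⟩
      by_contra! h
      exact hi.not_ge ((le_supOn (mem_image_of_mem _ hx) (mem_univ _)).trans (hS _ h))
    classical
    refine ⟨Nat.find h1, Nat.find_spec h1, ?_⟩
    have hne : Nat.find h1 ≠ 0 := by
      intro h0
      have h2 := Nat.find_spec h1
      rw [h0, show T m 0 = id from funext (hT0 m), image_id] at h2
      exact h2.not_ge hF
    obtain ⟨i, hi⟩ := Nat.exists_eq_succ_of_ne_zero hne
    have h3 : wSup w N (T m i '' F.1) ≤ s := not_lt.1 (Nat.find_min h1 (by omega))
    rw [hi]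
    refine (wSup_image_le_add hw1 hI.le h3 (hS _ h3) (fun x _ => hTstep m i x)
      fun x hx B hB hxB => ?_).trans_lt (by rwa [ENNReal.add_halves])
    exact (hm x hx B hB i).2 ((hm x hx B hB (i + 1)).1 hxB)
  obtain ⟨i, hi⟩ := hex.choice
  have hlim : Tendsto (fun m => HypFn.image (T m (i m)) F) atTop (𝓝 F) := by
    refine HypFn.tendsto_iff.2 fun U hU => ⟨fun hFU => ?_, ?_⟩
    · filter_upwards [(eventually_all_finite F.2.2.1).2 fun x hx =>
        hTnhds x U (hU.mem_nhds (hFU hx))] with m hm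
      rintro _ ⟨x, hx, rfl⟩
      exact hm x hx _
    · rintro ⟨x, hx, hxU⟩
      filter_upwards [hTnhds x U (hU.mem_nhds hxU)] with m hm
      exact ⟨_, mem_image_of_mem _ hx, hm _⟩
  exact hlim.frequently hi.frequently

lemma frequently_add_of_continuous {Y : Type*} [TopologicalSpace Y] {φ γ : Y → ℝ≥0∞}
    (hφ : ∀ x s t, φ x ≤ s → s < t → ∃ᶠ y in 𝓝 x, s < φ y ∧ φ y < t) (hγ : Continuous γ)
    (x : Y) (s t : ℝ≥0∞) (hx : φ x + γ x ≤ s) (hst : s < t) :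
    ∃ᶠ y in 𝓝 x, s < φ y + γ y ∧ φ y + γ y < t := by
  have hg : γ x ≠ ∞ := ne_top_of_le_ne_top hst.ne_top (le_add_self.trans hx)
  obtain ⟨r, hr, hrt⟩ := ENNReal.lt_iff_exists_add_pos_lt.1 hst
  obtain ⟨ρ, hρ, rfl⟩ : ∃ ρ : NNReal, 0 < ρ ∧ r = ρ + ρ + ρ :=
    ⟨r / 3, by positivity, (add_thirds r).symm⟩
  have hρ0 : (ρ : ℝ≥0∞) ≠ 0 := by exact_mod_cast hρ.ne'
  obtain ⟨h, rfl⟩ : ∃ h, s = h + γ x :=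
    ⟨s - γ x, (tsub_add_cancel_of_le (le_add_self.trans hx)).symm⟩
  have hh : h ≠ ∞ := (ENNReal.add_ne_top.1 hst.ne_top).1
  have hφh : φ x ≤ h := (ENNReal.add_le_add_iff_right hg).1 hx
  have hlt : h + ρ < h + ρ + ρ :=
    ENNReal.lt_add_right (ENNReal.add_ne_top.2 ⟨hh, ENNReal.coe_ne_top⟩) hρ0
  refine ((hφ x (h + ρ) (h + ρ + ρ) (hφh.trans le_self_add) hlt).and_eventually
    (hγ.continuousAt.eventually_mem (ENNReal.Icc_mem_nhds hg hρ0))).mono ?_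
  rintro y ⟨⟨h1, h2⟩, h3, h4⟩
  have h5 : γ y ≠ ∞ := ne_top_of_le_ne_top (by finiteness) h4
  constructor
  · calc h + γ x ≤ h + (ρ + γ y) := by
          gcongr
          exact tsub_le_iff_left.1 h3
      _ = h + ρ + γ y := (add_assoc _ _ _).symm
      _ < φ y + γ y := ENNReal.add_lt_add_right h5 h1
  · calc φ y + γ y ≤ h + ρ + ρ + (γ x + ρ) := add_le_add h2.le h4
      _ = h + γ x + (ρ + ρ + ρ : NNReal) := by
        push_cast
        ring
      _ < t := hrt

variable [CompactSpace Z] [T2Space Z] [TotallyDisconnectedSpace Z] [SecondCountableTopology Z]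

/-- The hyperspaces `F_n(X) ∖ F_k(X)` have charts, if `X` has a chart whose function can be
increased by small steps. -/
lemma IsChart.exists_hypFnDiff (hj : IsChart j N) (hN : LowerSemicontinuous N)
    (hT : HasSmallSteps N) (k n : ℕ) : ∃ N' : HypFn n Z → ℝ≥0∞, LowerSemicontinuous N' ∧
      (∀ F s t, N' F ≤ s → s < t → ∃ᶠ G in 𝓝 F, s < N' G ∧ N' G < t) ∧
      IsChart (HypFnDiff.imageHypFn j : HypFnDiff k n X → HypFn n Z) N' := by
  have : Countable (Clopens Z) := Clopens.countable_iff_secondCountable.2 inferInstance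
  obtain ⟨w, hw0, hw1⟩ := ENNReal.exists_pos_sum_of_countable one_ne_zero (Clopens Z)
  have hw0' : ∀ B, (w B : ℝ≥0∞) ≠ 0 := fun B => by exact_mod_cast (hw0 B).ne'
  obtain ⟨γ, hγ, hγtop⟩ := HypFn.exists_continuous_ne_top_iff (k := k) (n := n) (Z := Z)
  exact ⟨_, (lowerSemicontinuous_wSup hN fun _ => ENNReal.coe_ne_top).add hγ.lowerSemicontinuous,
    frequently_add_of_continuous (hT.frequently_wSup hw0' hw1.le) hγ,
    hj.hypFnDiff hN hw0' hw1.ne_top hγ hγtop⟩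

/-- All nonempty hyperspaces `F_n(X) ∖ F_k(X)` are homeomorphic, if `X` has a chart whose function
can be increased by small steps. -/
theorem IsChart.nonempty_homeomorph_hypFnDiff (hj : IsChart j N) (hN : LowerSemicontinuous N)
    (hT : HasSmallSteps N) (k n k' n' : ℕ) [Nonempty (HypFnDiff k n X)]
    [Nonempty (HypFnDiff k' n' X)] : Nonempty (HypFnDiff k n X ≃ₜ HypFnDiff k' n' X) := by
  obtain ⟨N₁, hN₁, hfreq₁, hj₁⟩ := hj.exists_hypFnDiff hN hT k n
  obtain ⟨N₂, hN₂, hfreq₂, hj₂⟩ := hj.exists_hypFnDiff hN hT k' n'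
  have h₁ := hj₁.restrict_closure hN₁ hfreq₁
  have h₂ := hj₂.restrict_closure hN₂ hfreq₂
  have := (range_nonempty (HypFnDiff.imageHypFn j : HypFnDiff k n X → _)).closure.to_subtype
  have := (range_nonempty (HypFnDiff.imageHypFn j : HypFnDiff k' n' X → _)).closure.to_subtype
  have := isCompact_iff_compactSpace.1
    (isClosed_closure (s := range (HypFnDiff.imageHypFn j : HypFnDiff k n X → _))).isCompact
  have := isCompact_iff_compactSpace.1
    (isClosed_closure (s := range (HypFnDiff.imageHypFn j : HypFnDiff k' n' X → _))).isCompact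
  exact h₁.2.nonempty_homeomorph h₁.1 h₂.1 h₂.2

end HyperspaceChart

section CompleteErdos

open Filter
open scoped ENNReal

/-- The set `{0} ∪ {1/m : m ≥ 1}`. -/
def unitFractions : Set ℝ := {y | y = 0 ∨ ∃ m : ℕ, 0 < m ∧ y = 1 / (m : ℝ)}

lemma unitFractions_eq : unitFractions = insert 0 (range fun m : ℕ => 1 / ((m : ℝ) + 1)) := by
  ext y
  refine or_congr_right ⟨?_, ?_⟩
  · rintro ⟨m, hm, rfl⟩
    obtain ⟨m, rfl⟩ := Nat.exists_eq_succ_of_ne_zero hm.ne'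
    exact ⟨m, by simp⟩
  · rintro ⟨m, rfl⟩
    exact ⟨m + 1, m.succ_pos, by simp⟩

instance : CompactSpace unitFractions := by
  rw [unitFractions_eq]
  exact isCompact_iff_compactSpace.1
    (tendsto_one_div_add_atTop_nhds_zero_nat (𝕜 := ℝ)).isCompact_insert_range

instance : TotallyDisconnectedSpace unitFractions := by
  rw [unitFractions_eq]
  exact totallyDisconnectedSpace_subtype_iff.2
    ((countable_range _).insert 0).isTotallyDisconnected

/-- The sum of the squares of the coordinates. -/
def sqSum (c : ℕ → unitFractions) : ℝ≥0∞ := ∑' a, ENNReal.ofReal ((c a : ℝ) ^ 2)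

lemma lowerSemicontinuous_tsum_ofReal_sq_add (x : ℕ → ℝ) :
    LowerSemicontinuous fun c : ℕ → unitFractions =>
      ∑' a, ENNReal.ofReal (((c a : ℝ) + x a) ^ 2) :=
  lowerSemicontinuous_tsum fun a => (ENNReal.continuous_ofReal.comp
    (by fun_prop : Continuous fun c : ℕ → unitFractions => ((c a : ℝ) + x a) ^ 2)).lowerSemicontinuous

lemma lowerSemicontinuous_sqSum : LowerSemicontinuous sqSum := by
  simpa [← sqSum.eq_1] using lowerSemicontinuous_tsum_ofReal_sq_add 0

lemma memℓp_two_iff_tsum_ofReal_sq_ne_top {f : ℕ → ℝ} :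
    Memℓp f 2 ↔ ∑' a, ENNReal.ofReal (f a ^ 2) ≠ ∞ := by
  rw [memℓp_gen_iff (by norm_num)]
  simp only [ENNReal.toReal_ofNat, Real.rpow_ofNat, Real.norm_eq_abs, sq_abs]
  refine ⟨fun h => h.tsum_ofReal_ne_top, fun h => ?_⟩
  simpa [sq_nonneg] using ENNReal.summable_toReal h

lemma lp.tsum_ofReal_sq (f : lp (fun _ : ℕ => ℝ) 2) :
    ∑' a, ENNReal.ofReal (f a ^ 2) = ENNReal.ofReal (‖f‖ ^ 2) := by
  have h := lp.norm_rpow_eq_tsum (by norm_num) f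
  have h' := (memℓp_gen_iff (by norm_num)).1 f.2
  simp only [ENNReal.toReal_ofNat, Real.rpow_ofNat, Real.norm_eq_abs, sq_abs] at h h'
  rw [h, ENNReal.ofReal_tsum_of_nonneg (fun _ => sq_nonneg _) h']

lemma ENNReal.ofReal_sq_parallelogram (u v : ℝ) :
    ENNReal.ofReal ((u + -v) ^ 2) + ENNReal.ofReal ((u + v) ^ 2) =
      2 * ENNReal.ofReal (u ^ 2) + 2 * ENNReal.ofReal (v ^ 2) := by
  rw [← ENNReal.ofReal_ofNat 2, ← ENNReal.ofReal_mul (by norm_num),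
    ← ENNReal.ofReal_mul (by norm_num), ← ENNReal.ofReal_add (by positivity) (by positivity),
    ← ENNReal.ofReal_add (by positivity) (by positivity)]
  congr 1
  ring

namespace CompleteErdosSpace

lemma isInducing_val : IsInducing (Subtype.val : CompleteErdosSpace → lp (fun _ : ℕ => ℝ) 2) :=
  ⟨rfl⟩

/-- The coordinates of a point of complete Erdős space. -/
def coord (x : CompleteErdosSpace) (a : ℕ) : unitFractions := ⟨x.1 a, x.2 a⟩

lemma sqSum_coord (x : CompleteErdosSpace) : sqSum x.coord = ENNReal.ofReal (‖x.1‖ ^ 2) :=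
  lp.tsum_ofReal_sq x.1

lemma isChart_coord : IsChart coord sqSum where
  injective x y h := Subtype.ext (lp.ext (funext fun a => congrArg Subtype.val (congrFun h a)))
  mem_range_iff c := by
    rw [sqSum, ← memℓp_two_iff_tsum_ofReal_sq_ne_top (f := fun a => (c a : ℝ))]
    constructor
    · rintro ⟨x, rfl⟩
      exact x.1.2
    · exact fun h => ⟨⟨⟨_, h⟩, fun a => (c a).2⟩, rfl⟩
  continuous := continuous_pi fun a => Continuous.subtype_mk
    ((continuous_apply a).comp (lp.uniformContinuous_coe.continuous.comp isInducing_val.continuous))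
    _
  continuous_comp := (ENNReal.continuous_ofReal.comp
    (isInducing_val.continuous.norm.pow 2)).congr fun x => (sqSum_coord x).symm
  le_nhds x l h1 h2 := by
    have hx : sqSum x.coord ≠ ∞ := by simp [sqSum_coord]
    have hadd : ∀ c : ℕ → unitFractions, (∑' a, ENNReal.ofReal (((c a : ℝ) + -x.1 a) ^ 2)) +
        ∑' a, ENNReal.ofReal (((c a : ℝ) + x.1 a) ^ 2) = 2 * sqSum c + 2 * sqSum x.coord := by
      intro c
      rw [sqSum, sqSum, ← ENNReal.tsum_add, ← ENNReal.tsum_mul_left, ← ENNReal.tsum_mul_left,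
        ← ENNReal.tsum_add]
      refine tsum_congr fun a => ?_
      exact ENNReal.ofReal_sq_parallelogram _ _
    have hzero : ∑' a, ENNReal.ofReal (((x.coord a : ℝ) + -x.1 a) ^ 2) = 0 := by
      simp [coord]
    have h3 := (lowerSemicontinuous_tsum_ofReal_sq_add fun a => -x.1 a).tendsto_of_tendsto_add
      (lowerSemicontinuous_tsum_ofReal_sq_add fun a => x.1 a) h1
      (ne_top_of_le_ne_top (by finiteness) (le_add_self.trans_eq (hadd x.coord))) (by
        simp only [hadd]
        exact (ENNReal.Tendsto.const_mul h2 (Or.inr ENNReal.ofNat_ne_top)).add_const _)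
    simp only [hzero] at h3
    have h4 : ∀ y : CompleteErdosSpace, ∑' a, ENNReal.ofReal (((y.coord a : ℝ) + -x.1 a) ^ 2) =
        ENNReal.ofReal (‖y.1 - x.1‖ ^ 2) := fun y => by
      rw [← lp.tsum_ofReal_sq]
      simp [coord, sub_eq_add_neg]
    simp only [h4] at h3
    have h5 : Tendsto (fun y : CompleteErdosSpace => ‖y.1 - x.1‖) l (𝓝 0) := by
      have h6 := ((ENNReal.continuousAt_toReal ENNReal.zero_ne_top).tendsto.comp h3).sqrt
      simpa [Function.comp_def] using h6
    exact (tendsto_iff_comap.1 (tendsto_iff_norm_sub_tendsto_zero.2 h5)).trans_eq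
      (isInducing_val.nhds_eq_comap x).symm

lemma hasSmallSteps_sqSum : HasSmallSteps sqSum := by
  intro δ hδ
  obtain ⟨p, hp⟩ := ENNReal.exists_inv_nat_lt hδ
  have hp0 : 0 < p := Nat.pos_of_ne_zero fun h => by simp [h] at hp
  let q : unitFractions := ⟨1 / (p : ℝ), Or.inr ⟨p, hp0, rfl⟩⟩
  have hqδ : ENNReal.ofReal ((q : ℝ) ^ 2) ≤ δ := by
    refine le_trans (ENNReal.ofReal_le_ofReal ?_) (b := ENNReal.ofReal (1 / (p : ℝ))) ?_
    · have : (1 : ℝ) ≤ p := by exact_mod_cast hp0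
      have h1 : 1 / (p : ℝ) ≤ 1 := by rw [div_le_one (by positivity)]; exact this
      exact pow_le_of_le_one (by positivity) h1 two_ne_zero
    · rw [one_div, ENNReal.ofReal_inv_of_pos (by positivity), ENNReal.ofReal_natCast]
      exact hp.le
  have hq0 : ENNReal.ofReal ((q : ℝ) ^ 2) ≠ 0 := by
    rw [Ne, ENNReal.ofReal_eq_zero, not_le]
    positivity
  let T : ℕ → ℕ → (ℕ → unitFractions) → ℕ → unitFractions := fun m i x a =>
    if m ≤ a ∧ a < m + i then q else x a
  refine ⟨T, fun m x => ?_, fun m i x => ?_, fun m x => ?_, fun x U hU => ?_⟩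
  · funext a
    exact if_neg (by omega)
  · have h : ∀ a, ENNReal.ofReal ((T m (i + 1) x a : ℝ) ^ 2) ≤
        ENNReal.ofReal ((T m i x a : ℝ) ^ 2) + if a = m + i then δ else 0 := by
      intro a
      rcases eq_or_ne a (m + i) with rfl | ha
      · simpa [T, add_assoc] using hqδ.trans le_add_self
      · have : (m ≤ a ∧ a < m + (i + 1)) ↔ (m ≤ a ∧ a < m + i) := by omega
        simp [T, this, ha]
    refine (ENNReal.tsum_le_tsum h).trans_eq ?_
    rw [ENNReal.tsum_add, tsum_ite_eq, sqSum]
  · have h : ∀ i : ℕ, (i : ℝ≥0∞) * ENNReal.ofReal ((q : ℝ) ^ 2) ≤ sqSum (T m i x) := by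
      intro i
      refine le_trans (le_of_eq ?_) (ENNReal.sum_le_tsum (Finset.Ico m (m + i)))
      rw [Finset.sum_congr rfl (g := fun _ => ENNReal.ofReal ((q : ℝ) ^ 2)) fun a ha => by
        simp only [T, Finset.mem_Ico.1 ha, and_self, if_true]]
      simp
    refine tendsto_nhds_top_mono' ?_ h
    have := ENNReal.Tendsto.mul_const (b := ENNReal.ofReal ((q : ℝ) ^ 2))
      ENNReal.tendsto_nat_nhds_top (Or.inl ENNReal.top_ne_zero)
    rwa [ENNReal.top_mul hq0] at this
  · have h : Tendsto (fun r : ℕ × ℕ => T r.1 r.2 x) (atTop ×ˢ 𝓟 univ) (𝓝 x) := by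
      refine tendsto_pi_nhds.2 fun a => tendsto_const_nhds.congr' ?_
      filter_upwards [(eventually_gt_atTop a).prod_inl _] with r hr
      simp [T, hr.not_ge]
    simpa using eventually_prod_principal_iff.1 (h.eventually_mem hU)

instance : Infinite CompleteErdosSpace := by
  refine Infinite.of_injective (α := CompleteErdosSpace) (fun m : ℕ =>
    ⟨lp.single 2 0 (1 / ((m + 1 : ℕ) : ℝ)), fun a => ?_⟩) fun m m' h => ?_
  · rcases eq_or_ne a 0 with rfl | ha
    · exact Or.inr ⟨m + 1, m.succ_pos, lp.single_apply_self _ _ _⟩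
    · exact Or.inl (lp.single_apply_ne _ _ _ ha)
  · have := congrArg (fun x : CompleteErdosSpace => x.1 0) h
    simpa [lp.single_apply_self] using this

end CompleteErdosSpace

variable {X : Type*} [TopologicalSpace X] {k n : ℕ}

lemma HypFnDiff.nonempty [Infinite X] (h : k < n) : Nonempty (HypFnDiff k n X) := by
  obtain ⟨F, hF⟩ := Infinite.exists_subset_card_eq X n
  refine ⟨⟨F, ?_, F.finite_toSet, ?_, ?_⟩⟩
  · exact Finset.card_pos.1 (by omega)
  all_goals rw [ncard_coe_finset]; omega

lemma HypFnDiff.eq_singleton (F : HypFnDiff 0 1 X) : F.1 = {F.2.1.some} := by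
  obtain ⟨x, hx⟩ := ncard_eq_one.1 (le_antisymm F.2.2.2.2 F.2.2.2.1)
  have h : F.2.1.some = x := mem_singleton_iff.1 (hx ▸ F.2.1.some_mem)
  rw [h, hx]

/-- Singletons identify a space with its first symmetric product. -/
def HypFnDiff.homeomorphSingleton : HypFnDiff 0 1 X ≃ₜ X where
  toFun F := F.2.1.some
  invFun x := ⟨{x}, singleton_nonempty x, finite_singleton x, by simp, by simp⟩
  left_inv F := Subtype.ext F.eq_singleton.symm
  right_inv x := (singleton_nonempty x).some_mem
  continuous_toFun := by
    refine continuous_iff_continuousAt.2 fun F => tendsto_nhds.2 fun U hU hF => ?_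
    filter_upwards [(HypFnDiff.tendsto_iff.1 (tendsto_id (x := 𝓝 F)) U hU).1
      (F.eq_singleton.trans_subset (singleton_subset_iff.2 hF))] with G hG
    exact hG G.2.1.some_mem
  continuous_invFun := by
    refine continuous_iff_continuousAt.2 fun x => HypFnDiff.tendsto_iff.2 fun U hU => ?_
    simp only [singleton_subset_iff, singleton_inter_nonempty, and_self]
    exact fun hx => hU.mem_nhds hx

end CompleteErdos

/-- For `1 ≤ k < n`, the subspace `F_n(𝔈_c) \ F_k(𝔈_c)` is homeomorphic to complete
Erdős space. -/
theorem hypFnDiff_completeErdos_homeomorph (k n : ℕ) (hk : 1 ≤ k) (hkn : k < n) :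
    Nonempty (HypFnDiff k n CompleteErdosSpace ≃ₜ CompleteErdosSpace) := by
  have := HypFnDiff.nonempty (X := CompleteErdosSpace) hkn
  have := HypFnDiff.nonempty (X := CompleteErdosSpace) zero_lt_one
  obtain ⟨h⟩ := CompleteErdosSpace.isChart_coord.nonempty_homeomorph_hypFnDiff
    lowerSemicontinuous_sqSum CompleteErdosSpace.hasSmallSteps_sqSum k n 0 1
  exact ⟨h.trans HypFnDiff.homeomorphSingleton⟩
end
end

section
/- For all natural numbers k, n with 1 ≤ k < n, the subspace F_n(𝔈) ∖ F_k(𝔈) of the n-th symmetric product of Erdős space (with the Vietoris topology) is homeomorphic to Erdős space 𝔈. -/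
open Set Topology

noncomputable section

/-- Finitely supported integer families, with the topology of pointwise convergence. -/
def FinSuppInt (ι : Type*) : Type _ := {f : ι → ℤ // (Function.support f).Finite}

namespace FinSuppInt

variable {ι κ : Type*}

instance : TopologicalSpace (FinSuppInt ι) := inferInstanceAs (TopologicalSpace (Subtype _))

instance : CoeFun (FinSuppInt ι) (fun _ => ι → ℤ) := ⟨Subtype.val⟩

theorem ext {f g : FinSuppInt ι} (h : ∀ i, f i = g i) : f = g := Subtype.ext (funext h)

theorem continuous_apply (i : ι) : Continuous fun f : FinSuppInt ι => f i :=
  (_root_.continuous_apply i).comp continuous_subtype_val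

theorem continuous_iff {X : Type*} [TopologicalSpace X] {F : X → FinSuppInt ι} :
    Continuous F ↔ ∀ i, Continuous fun x => F x i :=
  ⟨fun h i => (continuous_apply i).comp h,
    fun h => Continuous.subtype_mk (continuous_pi h) _⟩

instance [Countable ι] : Countable (FinSuppInt ι) := by
  have : Function.Injective fun f : FinSuppInt ι => Finsupp.ofSupportFinite f.1 f.2 := by
    intro f g h
    exact ext fun i => DFunLike.congr_fun h i
  exact this.countable

/-- Reindexing along a bijection. -/
def reindex (e : ι ≃ κ) : FinSuppInt ι ≃ₜ FinSuppInt κ where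
  toFun f := ⟨fun k => f (e.symm k), by
    have : (Function.support fun k => f (e.symm k)) = e.symm ⁻¹' Function.support f.1 := rfl
    rw [this]
    exact f.2.preimage e.symm.injective.injOn⟩
  invFun f := ⟨fun k => f (e k), by
    have : (Function.support fun k => f (e k)) = e ⁻¹' Function.support f.1 := rfl
    rw [this]
    exact f.2.preimage e.injective.injOn⟩
  left_inv f := ext fun i => by simp
  right_inv f := ext fun i => by simp
  continuous_toFun := continuous_iff.2 fun i => continuous_apply _
  continuous_invFun := continuous_iff.2 fun i => continuous_apply _

/-- A finite power is again a space of finitely supported families. -/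
def curry [Finite κ] : (κ → FinSuppInt ι) ≃ₜ FinSuppInt (κ × ι) where
  toFun f := ⟨fun p => f p.1 p.2, by
    have : (⋃ k, Prod.mk k '' Function.support (f k).1).Finite :=
      Set.finite_iUnion fun k => (f k).2.image _
    refine this.subset ?_
    rintro ⟨k, i⟩ h
    exact Set.mem_iUnion.2 ⟨k, i, h, rfl⟩⟩
  invFun g k := ⟨fun i => g (k, i),
    g.2.preimage (f := Prod.mk k) (Prod.mk_right_injective k).injOn⟩
  left_inv f := rfl
  right_inv f := rfl
  continuous_toFun := continuous_iff.2 fun p =>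
    (continuous_apply p.2).comp (_root_.continuous_apply p.1)
  continuous_invFun := continuous_pi fun k => continuous_iff.2 fun i => continuous_apply (k, i)

/-- Splitting off the first coordinate. -/
def uncons : FinSuppInt ℕ ≃ₜ ℤ × FinSuppInt ℕ where
  toFun f := (f 0, ⟨fun i => f (i + 1),
    f.2.preimage (f := fun i => i + 1) (add_left_injective 1).injOn⟩)
  invFun p := ⟨fun i => Nat.casesOn i p.1 p.2, by
    refine ((p.2.2.image (fun i => i + 1)).insert 0).subset ?_
    rintro (_ | i) h
    · exact Or.inl rfl
    · exact Or.inr ⟨i, h, rfl⟩⟩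
  left_inv f := ext fun i => by cases i <;> rfl
  right_inv p := rfl
  continuous_toFun := (continuous_apply 0).prodMk (continuous_iff.2 fun i => continuous_apply _)
  continuous_invFun := continuous_iff.2 fun i => by
    cases i with
    | zero => exact continuous_fst
    | succ i => exact (continuous_apply i).comp continuous_snd

/-- The lexicographically ordered version of `FinSuppInt ℕ`. -/
abbrev LexOrder : Type := {f : Lex (ℕ → ℤ) // (Function.support (ofLex f)).Finite}

theorem lexOrder_lt {f g : LexOrder} :
    f < g ↔ ∃ i, (∀ j < i, ofLex f.1 j = ofLex g.1 j) ∧ ofLex f.1 i < ofLex g.1 i := Iff.rfl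

/-- Adding `c` to the `n`-th coordinate. -/
def bump (f : LexOrder) (n : ℕ) (c : ℤ) : LexOrder :=
  ⟨toLex (Function.update (ofLex f.1) n (ofLex f.1 n + c)), by
    refine (f.2.insert n).subset fun i hi => ?_
    by_cases h : i = n
    · exact Or.inl h
    · exact Or.inr (by simpa [h] using hi)⟩

theorem bump_apply_of_ne (f : LexOrder) {n i : ℕ} (c : ℤ) (h : i ≠ n) :
    ofLex (bump f n c).1 i = ofLex f.1 i := by simp [bump, h]

theorem bump_apply_self (f : LexOrder) (n : ℕ) (c : ℤ) :
    ofLex (bump f n c).1 n = ofLex f.1 n + c := by simp [bump]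

theorem lt_bump (f : LexOrder) (n : ℕ) : f < bump f n 1 :=
  lexOrder_lt.2 ⟨n, fun j hj => (bump_apply_of_ne f 1 hj.ne).symm, by
    rw [bump_apply_self]; omega⟩

theorem bump_lt (f : LexOrder) (n : ℕ) : bump f n (-1) < f :=
  lexOrder_lt.2 ⟨n, fun j hj => bump_apply_of_ne f _ hj.ne, by
    rw [bump_apply_self]; omega⟩

instance : NoMaxOrder LexOrder := ⟨fun f => ⟨_, lt_bump f 0⟩⟩

instance : NoMinOrder LexOrder := ⟨fun f => ⟨_, bump_lt f 0⟩⟩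

instance : Nonempty LexOrder := ⟨⟨toLex 0, by simp⟩⟩

instance : Countable LexOrder := inferInstanceAs (Countable (FinSuppInt ℕ))

/-- Lexicographic inequalities are decided by an initial segment. -/
theorem lt_of_agree_right {f g g' : LexOrder} {i : ℕ}
    (hj : ∀ j < i, ofLex f.1 j = ofLex g.1 j) (hi : ofLex f.1 i < ofLex g.1 i)
    (h : ∀ j < i + 1, ofLex g'.1 j = ofLex g.1 j) : f < g' :=
  lexOrder_lt.2 ⟨i, fun j hlt => (hj j hlt).trans (h j (by omega)).symm, by
    rw [h i (by omega)]; exact hi⟩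

theorem lt_of_agree_left {f f' g : LexOrder} {i : ℕ}
    (hj : ∀ j < i, ofLex f.1 j = ofLex g.1 j) (hi : ofLex f.1 i < ofLex g.1 i)
    (h : ∀ j < i + 1, ofLex f'.1 j = ofLex f.1 j) : f' < g :=
  lexOrder_lt.2 ⟨i, fun j hlt => (h j (by omega)).trans (hj j hlt), by
    rw [h i (by omega)]; exact hi⟩

instance : DenselyOrdered LexOrder := ⟨fun f g hfg => by
  obtain ⟨i, hj, hi⟩ := lexOrder_lt.1 hfg
  exact ⟨bump f (i + 1) 1, lt_bump _ _,
    lt_of_agree_left hj hi fun j hlt => bump_apply_of_ne f 1 hlt.ne⟩⟩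

/-- Lexicographic intervals between vectors with a common initial segment keep that segment. -/
theorem agree_of_between {f g : LexOrder} {n : ℕ}
    (h₁ : bump f n (-1) < g) (h₂ : g < bump f n 1) : ∀ j < n, ofLex g.1 j = ofLex f.1 j := by
  obtain ⟨i, hi, hlt⟩ := lexOrder_lt.1 h₁
  obtain ⟨i', hi', hlt'⟩ := lexOrder_lt.1 h₂
  by_cases hn : n ≤ i
  · intro j hj
    rw [← hi j (by omega), bump_apply_of_ne f _ hj.ne]
  by_cases hn' : n ≤ i'
  · intro j hj
    rw [hi' j (by omega), bump_apply_of_ne f _ hj.ne]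
  exfalso
  rw [bump_apply_of_ne f _ (by omega)] at hlt hlt'
  rcases lt_trichotomy i i' with h | h | h
  · have := hi' i h
    rw [bump_apply_of_ne f _ (by omega)] at this
    omega
  · subst h; omega
  · have := hi i' h
    rw [bump_apply_of_ne f _ (by omega)] at this
    omega

theorem nonempty_homeomorph_rat : Nonempty (FinSuppInt ℕ ≃ₜ ℚ) := by
  obtain ⟨e⟩ := Order.iso_of_countable_dense LexOrder ℚ
  let e' : FinSuppInt ℕ ≃ ℚ := e.toEquiv
  refine ⟨⟨e', ?_, ?_⟩⟩
  · have cyl : ∀ (s : FinSuppInt ℕ) (n : ℕ), ∀ᶠ x in 𝓝 s, ∀ j < n, x j = s j := by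
      intro s n
      have : ∀ j ∈ Finset.range n, ∀ᶠ x in 𝓝 s, x j = s j := fun j _ =>
        (continuous_apply j).continuousAt.eventually (IsOpen.mem_nhds (isOpen_discrete {s j}) rfl)
      filter_upwards [(Finset.eventually_all _).2 this] with x hx j hj
      exact hx j (Finset.mem_range.2 hj)
    refine continuous_iff_continuousAt.2 fun s => ?_
    refine tendsto_order.2 ⟨fun a ha => ?_, fun a ha => ?_⟩
    · obtain ⟨i, hj, hi⟩ := lexOrder_lt.1 (e.symm_apply_lt.2 ha)
      filter_upwards [cyl s (i + 1)] with x hx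
      exact e.symm_apply_lt.1 (lt_of_agree_right (g' := x) hj hi hx)
    · obtain ⟨i, hj, hi⟩ := lexOrder_lt.1 (e.lt_symm_apply.2 ha)
      filter_upwards [cyl s (i + 1)] with x hx
      exact e.lt_symm_apply.1 (lt_of_agree_left (f' := x) hj hi hx)
  · refine continuous_iff.2 fun i => continuous_iff_continuousAt.2 fun q => ?_
    have hmem : Set.Ioo (e (bump (e.symm q) (i + 1) (-1))) (e (bump (e.symm q) (i + 1) 1)) ∈ 𝓝 q :=
      Ioo_mem_nhds (e.lt_symm_apply.1 (bump_lt _ _)) (e.symm_apply_lt.1 (lt_bump _ _))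
    refine tendsto_nhds_of_eventually_eq ?_
    filter_upwards [hmem] with r hr
    exact agree_of_between (g := e.symm r) (e.lt_symm_apply.2 hr.1) (e.symm_apply_lt.2 hr.2)
      i (by omega)

end FinSuppInt

/-- Finite nonzero powers of `ℚ` are homeomorphic to `ℚ`. -/
theorem nonempty_pi_rat_homeomorph_rat (κ : Type*) [Finite κ] [Nonempty κ] :
    Nonempty ((κ → ℚ) ≃ₜ ℚ) := by
  obtain ⟨e⟩ := FinSuppInt.nonempty_homeomorph_rat
  obtain ⟨d⟩ : Nonempty (κ × ℕ ≃ ℕ) := nonempty_equiv_of_countable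
  exact ⟨(Homeomorph.piCongrRight fun _ => e.symm).trans
    (FinSuppInt.curry.trans ((FinSuppInt.reindex d).trans e))⟩

/-- Countable topological sums of copies of `ℚ` are homeomorphic to `ℚ`. -/
theorem nonempty_prod_rat_homeomorph_rat (I : Type*) [Countable I] [Nonempty I]
    [TopologicalSpace I] [DiscreteTopology I] : Nonempty (I × ℚ ≃ₜ ℚ) := by
  obtain ⟨e⟩ := FinSuppInt.nonempty_homeomorph_rat
  obtain ⟨d⟩ : Nonempty (I × ℤ ≃ ℤ) := nonempty_equiv_of_countable
  let u : ℚ ≃ₜ ℤ × ℚ :=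
    e.symm.trans (FinSuppInt.uncons.trans ((Homeomorph.refl ℤ).prodCongr e))
  exact ⟨((Homeomorph.refl I).prodCongr u).trans
    ((Homeomorph.prodAssoc I ℤ ℚ).symm.trans
      (((Homeomorph.ofDiscrete d).prodCongr (Homeomorph.refl ℚ)).trans u.symm))⟩

/-- Nonempty open order-convex subsets of `ℚ` are homeomorphic to `ℚ`. -/
theorem nonempty_homeomorph_rat_of_ordConnected {J : Set ℚ} (hne : J.Nonempty) (ho : IsOpen J)
    [hc : J.OrdConnected] : Nonempty (J ≃ₜ ℚ) := by
  have : Nonempty J := hne.to_subtype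
  have : NoMaxOrder J := ⟨fun x => by
    obtain ⟨b, hb, hs⟩ := exists_Ico_subset_of_mem_nhds (ho.mem_nhds x.2) (exists_gt _)
    obtain ⟨c, hc⟩ := exists_between hb
    exact ⟨⟨c, hs ⟨hc.1.le, hc.2⟩⟩, hc.1⟩⟩
  have : NoMinOrder J := ⟨fun x => by
    obtain ⟨b, hb, hs⟩ := exists_Ioc_subset_of_mem_nhds (ho.mem_nhds x.2) (exists_lt _)
    obtain ⟨c, hc⟩ := exists_between hb
    exact ⟨⟨c, hs ⟨hc.1, hc.2.le⟩⟩, hc.2⟩⟩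
  obtain ⟨e⟩ := Order.iso_of_countable_dense J ℚ
  exact ⟨e.toHomeomorph⟩

/-- Square-summable rational families. -/
structure RatL2 (ι : Type*) where
  /-- The underlying family. -/
  val : ι → ℚ
  summable_sq : Summable fun i => (val i : ℝ) ^ 2

namespace RatL2

variable {ι κ : Type*}

instance : CoeFun (RatL2 ι) (fun _ => ι → ℚ) := ⟨val⟩

theorem ext {x y : RatL2 ι} (h : ∀ i, x i = y i) : x = y := by
  cases x; cases y; congr; exact funext h

instance : Zero (RatL2 ι) := ⟨⟨0, by simp⟩⟩

@[simp] theorem zero_apply (i : ι) : (0 : RatL2 ι) i = 0 := rfl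

/-- The inclusion into the real Hilbert space. -/
def toLp (x : RatL2 ι) : lp (fun _ : ι => ℝ) 2 :=
  ⟨fun i => (x i : ℝ), by
    refine (memℓp_gen_iff (by norm_num)).2 (x.summable_sq.congr fun i => ?_)
    rw [ENNReal.toReal_ofNat, Real.rpow_ofNat, Real.norm_eq_abs, sq_abs]⟩

@[simp] theorem toLp_apply (x : RatL2 ι) (i : ι) : (toLp x : ι → ℝ) i = x i := rfl

theorem toLp_injective : Function.Injective (toLp (ι := ι)) := fun x y h =>
  ext fun i => by
    have := congrArg (fun z : lp (fun _ : ι => ℝ) 2 => (z : ι → ℝ) i) h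
    exact_mod_cast (by simpa using this : (x i : ℝ) = y i)

instance : MetricSpace (RatL2 ι) := MetricSpace.induced toLp toLp_injective inferInstance

theorem isometry_toLp : Isometry (toLp (ι := ι)) := fun _ _ => rfl

theorem hasSum_dist_sq (x y : RatL2 ι) :
    HasSum (fun i => ((x i : ℝ) - y i) ^ 2) (dist x y ^ 2) := by
  have h := lp.hasSum_norm (p := 2) (by norm_num) (toLp x - toLp y)
  have h2 : dist x y = ‖toLp x - toLp y‖ := dist_eq_norm (toLp x) (toLp y)
  rw [h2]
  simpa using h

theorem abs_sub_le_dist (x y : RatL2 ι) (i : ι) : |(x i : ℝ) - y i| ≤ dist x y := by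
  have h := le_hasSum (hasSum_dist_sq x y) i fun j _ => sq_nonneg _
  exact abs_le_of_sq_le_sq h dist_nonneg

theorem continuous_apply (i : ι) : Continuous fun x : RatL2 ι => x i := by
  refine Rat.isEmbedding_coe_real.continuous_iff.2 ?_
  refine continuous_iff_continuousAt.2 fun x => tendsto_iff_dist_tendsto_zero.2 ?_
  refine squeeze_zero (fun _ => dist_nonneg) (fun y => ?_)
    (tendsto_iff_dist_tendsto_zero.1 (Filter.tendsto_id (x := 𝓝 x)))
  simpa [Real.dist_eq] using abs_sub_le_dist y x i

/-- Coordinates of a fixed point tend to zero. -/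
theorem tendsto_apply_atTop (x : RatL2 ℕ) :
    Filter.Tendsto (fun n => |(x n : ℝ)|) Filter.atTop (𝓝 0) := by
  have h := x.summable_sq.tendsto_atTop_zero.sqrt
  simpa [Real.sqrt_sq_eq_abs] using h

/-- Moving a point by at most `ρ` so that its `n`-th coordinate becomes at least `ρ / 2`. -/
theorem exists_dist_le_coord (x : RatL2 ℕ) (n : ℕ) {ρ : ℝ} (hρ : 0 ≤ ρ) :
    ∃ y : RatL2 ℕ, dist y x ≤ ρ ∧ ρ / 2 ≤ |(y n : ℝ)| := by
  obtain ⟨q, hq1, hq2⟩ : ∃ q : ℚ, ρ / 2 ≤ q ∧ (q : ℝ) ≤ ρ := by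
    rcases hρ.eq_or_lt with h | h
    · exact ⟨0, by simp [← h], by simp [← h]⟩
    · obtain ⟨q, h1, h2⟩ := exists_rat_btwn (half_lt_self h)
      exact ⟨q, h1.le, h2.le⟩
  have hq0 : (0 : ℝ) ≤ q := by linarith
  obtain ⟨c, hc, hcx⟩ : ∃ c : ℚ, |(c : ℝ)| = q ∧ (q : ℝ) ≤ |(x n : ℝ) + c| := by
    rcases le_total 0 (x n : ℝ) with h | h
    · exact ⟨q, abs_of_nonneg hq0, by rw [abs_of_nonneg (by linarith)]; linarith⟩
    · refine ⟨-q, by push_cast; rw [abs_neg, abs_of_nonneg hq0], ?_⟩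
      push_cast
      rw [abs_of_nonpos (by linarith)]
      linarith
  have hs : Summable fun i => ((Function.update x.val n (x n + c) i : ℚ) : ℝ) ^ 2 := by
    refine (summable_congr_cofinite ?_).1 x.summable_sq
    refine (Set.finite_singleton n).subset fun i hi => ?_
    by_contra h
    exact hi (by simp [Function.update_of_ne (show i ≠ n from h)])
  let y : RatL2 ℕ := ⟨Function.update x.val n (x n + c), hs⟩
  have hyn : y n = x n + c := Function.update_self ..
  refine ⟨y, ?_, ?_⟩
  · have h1 := hasSum_dist_sq y x
    have h2 : HasSum (fun i => ((y i : ℝ) - x i) ^ 2) (((y n : ℝ) - x n) ^ 2) :=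
      hasSum_single n fun i hi => by
        simp [show y i = x i from Function.update_of_ne hi ..]
    have h3 := h1.unique h2
    rw [hyn, Rat.cast_add, add_sub_cancel_left, ← sq_abs (c : ℝ), hc] at h3
    exact (abs_le_of_sq_le_sq h3.le hq0 |> (le_abs_self _).trans).trans hq2
  · rw [hyn]
    push_cast
    linarith

theorem summable_comp_equiv (x : RatL2 ι) (e : κ ≃ ι) : Summable fun k => (x (e k) : ℝ) ^ 2 :=
  x.summable_sq.comp_injective e.injective

/-- Reindexing along a bijection. -/
def reindex (e : ι ≃ κ) : RatL2 ι ≃ₜ RatL2 κ :=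
  IsometryEquiv.toHomeomorph
    { toFun := fun x => ⟨fun k => x (e.symm k), x.summable_comp_equiv e.symm⟩
      invFun := fun x => ⟨fun k => x (e k), x.summable_comp_equiv e⟩
      left_inv := fun x => ext fun i => by simp
      right_inv := fun x => ext fun i => by simp
      isometry_toFun := Isometry.of_dist_eq fun x y => by
        have h := hasSum_dist_sq ⟨fun k => x (e.symm k), x.summable_comp_equiv e.symm⟩
          ⟨fun k => y (e.symm k), y.summable_comp_equiv e.symm⟩
        have h' : HasSum (fun k => ((x (e.symm k) : ℝ) - y (e.symm k)) ^ 2) (dist x y ^ 2) :=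
          e.symm.hasSum_iff.2 (hasSum_dist_sq x y)
        exact (sq_eq_sq₀ dist_nonneg dist_nonneg).1 (h.unique h') }

@[simp] theorem reindex_zero (e : ι ≃ κ) : reindex e 0 = 0 := rfl

theorem summable_uncurry [Fintype κ] (f : κ → RatL2 ι) :
    Summable fun p : κ × ι => (f p.1 p.2 : ℝ) ^ 2 :=
  (summable_prod_of_nonneg fun _ => sq_nonneg _).2
    ⟨fun k => (f k).summable_sq, (hasSum_fintype _).summable⟩

/-- A row of a square-summable matrix. -/
def row (k : κ) (g : RatL2 (κ × ι)) : RatL2 ι :=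
  ⟨fun i => g (k, i), g.summable_sq.comp_injective (Prod.mk_right_injective k)⟩

theorem dist_row_le (k : κ) (g g' : RatL2 (κ × ι)) : dist (row k g) (row k g') ≤ dist g g' := by
  refine (sq_le_sq₀ dist_nonneg dist_nonneg).1 ?_
  have h := hasSum_dist_sq g g'
  have h' := hasSum_dist_sq (row k g) (row k g')
  rw [← h.tsum_eq, ← h'.tsum_eq]
  exact tsum_comp_le_tsum_of_inj h.summable (fun _ => sq_nonneg _) (Prod.mk_right_injective k)

/-- A finite power of a space of square-summable families is again such a space. -/
def curry [Fintype κ] : (κ → RatL2 ι) ≃ₜ RatL2 (κ × ι) where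
  toFun f := ⟨fun p => f p.1 p.2, summable_uncurry f⟩
  invFun g k := row k g
  left_inv _ := rfl
  right_inv _ := rfl
  continuous_toFun := by
    refine continuous_iff_continuousAt.2 fun f => tendsto_iff_dist_tendsto_zero.2 ?_
    have key : ∀ g : κ → RatL2 ι,
        dist (⟨fun p => g p.1 p.2, summable_uncurry g⟩ : RatL2 (κ × ι))
          ⟨fun p => f p.1 p.2, summable_uncurry f⟩ = √(∑ k, dist (g k) (f k) ^ 2) := by
      intro g
      have h := (hasSum_dist_sq (⟨fun p => g p.1 p.2, summable_uncurry g⟩ : RatL2 (κ × ι))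
        ⟨fun p => f p.1 p.2, summable_uncurry f⟩).prod_fiberwise
          fun k => hasSum_dist_sq (g k) (f k)
      rw [← h.unique (hasSum_fintype _), Real.sqrt_sq dist_nonneg]
    simp only [key]
    have : Continuous fun g : κ → RatL2 ι => √(∑ k, dist (g k) (f k) ^ 2) := by fun_prop
    simpa using this.tendsto f
  continuous_invFun := continuous_pi fun k =>
    (LipschitzWith.of_dist_le_mul (K := 1) fun g g' => by
      simpa using dist_row_le k g g').continuous

@[simp] theorem curry_zero [Fintype κ] : curry (0 : κ → RatL2 ι) = 0 := rfl

/-- Finite nonzero powers of `RatL2 ℕ` are homeomorphic to `RatL2 ℕ`, fixing the origin. -/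
theorem exists_pi_homeomorph (κ : Type*) [Finite κ] [Nonempty κ] :
    ∃ Θ : (κ → RatL2 ℕ) ≃ₜ RatL2 ℕ, Θ 0 = 0 := by
  have := Fintype.ofFinite κ
  obtain ⟨d⟩ : Nonempty (κ × ℕ ≃ ℕ) := nonempty_equiv_of_countable
  exact ⟨curry.trans (reindex d), by simp⟩

/-- Dropping the first `m` coordinates. -/
def shift (m : ℕ) (x : RatL2 ℕ) : RatL2 ℕ :=
  ⟨fun i => x (i + m), x.summable_sq.comp_injective (add_left_injective m)⟩

@[simp] theorem shift_apply (m : ℕ) (x : RatL2 ℕ) (i : ℕ) : shift m x i = x (i + m) := rfl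

theorem dist_sq_eq (m : ℕ) (x y : RatL2 ℕ) :
    dist x y ^ 2 = ∑ i ∈ Finset.range m, ((x i : ℝ) - y i) ^ 2 +
      dist (shift m x) (shift m y) ^ 2 := by
  have h := hasSum_dist_sq x y
  rw [← h.tsum_eq, ← h.summable.sum_add_tsum_nat_add m,
    ← (hasSum_dist_sq (shift m x) (shift m y)).tsum_eq]
  rfl

theorem dist_shift_le (m : ℕ) (x y : RatL2 ℕ) : dist (shift m x) (shift m y) ≤ dist x y := by
  refine (sq_le_sq₀ dist_nonneg dist_nonneg).1 ?_
  rw [dist_sq_eq m x y]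
  exact le_add_of_nonneg_left (Finset.sum_nonneg fun _ _ => sq_nonneg _)

theorem tendsto_dist_shift_zero (x : RatL2 ℕ) :
    Filter.Tendsto (fun m => dist (shift m x) 0) Filter.atTop (𝓝 0) := by
  have h := (tendsto_sum_nat_add fun i => (x i : ℝ) ^ 2).sqrt
  rw [Real.sqrt_zero] at h
  refine h.congr fun m => ?_
  rw [← Real.sqrt_sq (dist_nonneg (x := shift m x) (y := 0)),
    ← (hasSum_dist_sq (shift m x) 0).tsum_eq]
  simp

/-- Splitting a sequence into its first `m` coordinates and the rest. -/
def split (m : ℕ) : RatL2 ℕ ≃ₜ (Fin m → ℚ) × RatL2 ℕ := by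
  have hs : ∀ p : (Fin m → ℚ) × RatL2 ℕ,
      Summable fun i => ((if h : i < m then p.1 ⟨i, h⟩ else p.2 (i - m) : ℚ) : ℝ) ^ 2 := fun p => by
    refine (summable_nat_add_iff m).1 ?_
    simpa using p.2.summable_sq
  refine
    { toFun := fun x => (fun i => x i, shift m x)
      invFun := fun p => ⟨fun i => if h : i < m then p.1 ⟨i, h⟩ else p.2 (i - m), hs p⟩
      left_inv := fun x => ext fun i => ?_
      right_inv := fun p => Prod.ext (funext fun i => ?_) (ext fun i => ?_)
      continuous_toFun := ?_
      continuous_invFun := ?_ }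
  · by_cases h : i < m
    · simp [h]
    · simp [h, Nat.sub_add_cancel (not_lt.1 h)]
  · simp
  · simp
  · refine (continuous_pi fun i => continuous_apply _).prodMk ?_
    exact (LipschitzWith.of_dist_le_mul (K := 1) fun x y => by
      simpa using dist_shift_le m x y).continuous
  · refine continuous_iff_continuousAt.2 fun p => tendsto_iff_dist_tendsto_zero.2 ?_
    have key : ∀ q : (Fin m → ℚ) × RatL2 ℕ,
        dist (⟨fun i => if h : i < m then q.1 ⟨i, h⟩ else q.2 (i - m), hs q⟩ : RatL2 ℕ)
          ⟨fun i => if h : i < m then p.1 ⟨i, h⟩ else p.2 (i - m), hs p⟩ =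
          √(∑ i, ((q.1 i : ℝ) - p.1 i) ^ 2 + dist q.2 p.2 ^ 2) := by
      intro q
      have hsh : ∀ q : (Fin m → ℚ) × RatL2 ℕ,
          shift m ⟨fun i => if h : i < m then q.1 ⟨i, h⟩ else q.2 (i - m), hs q⟩ = q.2 :=
        fun q => ext fun i => by simp
      rw [← Real.sqrt_sq (dist_nonneg (x := (⟨_, hs q⟩ : RatL2 ℕ)) (y := ⟨_, hs p⟩)),
        dist_sq_eq m, hsh, hsh, Finset.sum_range]
      simp
    simp only [key]
    have hc : Continuous fun q : (Fin m → ℚ) × RatL2 ℕ =>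
        √(∑ i, ((q.1 i : ℝ) - p.1 i) ^ 2 + dist q.2 p.2 ^ 2) := by
      have : Continuous ((↑) : ℚ → ℝ) := Rat.continuous_coe_real
      fun_prop
    simpa using hc.tendsto p

/-- `ℚ × RatL2 ℕ` is homeomorphic to `RatL2 ℕ`. -/
def consHomeomorph : ℚ × RatL2 ℕ ≃ₜ RatL2 ℕ :=
  ((Homeomorph.funUnique (Fin 1) ℚ).symm.prodCongr (Homeomorph.refl _)).trans (split 1).symm

end RatL2

/-- Erdős space is the space of square-summable rational sequences. -/
def erdosHomeomorph : RatL2 ℕ ≃ₜ ErdosSpace := by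
  have hsurj : Function.Surjective fun x : RatL2 ℕ =>
      (⟨x.toLp, fun n => ⟨x n, rfl⟩⟩ : ErdosSpace) := fun y => by
    choose q hq using y.2
    refine ⟨⟨q, ?_⟩, Subtype.ext (Subtype.ext (funext fun n => (hq n).symm))⟩
    refine ((memℓp_gen_iff (by norm_num)).1 y.1.2).congr fun n => ?_
    rw [hq n, ENNReal.toReal_ofNat, Real.rpow_ofNat, Real.norm_eq_abs, sq_abs]
  refine (Equiv.ofBijective _ ⟨fun x y h => ?_, hsurj⟩).toHomeomorphOfIsInducing ?_
  · exact RatL2.toLp_injective (congrArg Subtype.val h)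
  · have h1 : IsInducing (Subtype.val : ErdosSpace → lp (fun _ : ℕ => ℝ) 2) :=
      IsInducing.subtypeVal
    exact h1.of_comp_iff.1 RatL2.isometry_toLp.isEmbedding.isInducing

namespace HypFnDiff

variable {X Y : Type*} [TopologicalSpace X] [TopologicalSpace Y] {k n m : ℕ}

attribute [local instance] TopologicalSpace.vietoris

/-- The underlying set. -/
def toSet (F : HypFnDiff k n X) : Set X := F.1

theorem toSet_injective : Function.Injective (toSet : HypFnDiff k n X → Set X) :=
  Subtype.val_injective

theorem isInducing_toSet : IsInducing (toSet : HypFnDiff k n X → Set X) := by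
  have hval : ∀ S, (VietorisTop inferInstance).IsOpen S →
      IsOpen (toSet ⁻¹' S : Set (HypFnDiff k n X)) := fun S hS => ⟨S, hS, rfl⟩
  refine ⟨le_antisymm (continuous_iff_le_induced.1 ?_)
    (induced_mono (TopologicalSpace.generateFrom_anti ?_))⟩
  · refine continuous_generateFrom_iff.2 ?_
    rintro _ (⟨U, hU, rfl⟩ | ⟨U, hU, rfl⟩)
    · rcases U.eq_empty_or_nonempty with rfl | h
      · convert isOpen_empty
        refine Set.eq_empty_of_forall_notMem fun F hF => ?_
        exact F.2.1.ne_empty (subset_empty_iff.1 hF)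
      · exact hval _ (.basic _ (.inl ⟨U, hU, h, rfl⟩))
    · rcases U.eq_empty_or_nonempty with rfl | h
      · convert isOpen_empty
        simp
      · exact hval _ (.basic _ (.inr ⟨U, hU, h, rfl⟩))
  · rintro _ (⟨U, hU, -, rfl⟩ | ⟨U, hU, -, rfl⟩)
    · exact .inl ⟨U, hU, rfl⟩
    · exact .inr ⟨U, hU, rfl⟩

theorem isOpen_subset {U : Set X} (hU : IsOpen U) : IsOpen {F : HypFnDiff k n X | F.toSet ⊆ U} :=
  hU.powerset_vietoris.preimage isInducing_toSet.continuous

theorem isOpen_inter_nonempty {U : Set X} (hU : IsOpen U) :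
    IsOpen {F : HypFnDiff k n X | (F.toSet ∩ U).Nonempty} :=
  (TopologicalSpace.vietoris.isOpen_inter_nonempty_of_isOpen hU).preimage
    isInducing_toSet.continuous

/-- A finite set as a nonempty compact set. -/
def toNonemptyCompacts (F : HypFnDiff k n X) : TopologicalSpace.NonemptyCompacts X :=
  ⟨⟨F.1, F.2.2.1.isCompact⟩, F.2.1⟩

theorem isInducing_toNonemptyCompacts :
    IsInducing (toNonemptyCompacts : HypFnDiff k n X → TopologicalSpace.NonemptyCompacts X) :=
  TopologicalSpace.NonemptyCompacts.isEmbedding_coe.isInducing.of_comp_iff.1 isInducing_toSet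

/-- The image of a finite set under an injective map. -/
def map (e : X → Y) (he : Function.Injective e) (F : HypFnDiff k n X) : HypFnDiff k n Y :=
  ⟨e '' F.1, F.2.1.image _, F.2.2.1.image _, by
    rw [Set.ncard_image_of_injective _ he]
    exact F.2.2.2⟩

theorem continuous_map {e : X → Y} (he : Function.Injective e) (hc : Continuous e) :
    Continuous (map e he : HypFnDiff k n X → HypFnDiff k n Y) :=
  isInducing_toSet.continuous_iff.2 (hc.image_vietoris.comp isInducing_toSet.continuous)

/-- Homeomorphic spaces have homeomorphic hyperspaces. -/
def congr (e : X ≃ₜ Y) : HypFnDiff k n X ≃ₜ HypFnDiff k n Y where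
  toFun := map e e.injective
  invFun := map e.symm e.symm.injective
  left_inv F := toSet_injective (e.symm_image_image F.1)
  right_inv F := toSet_injective (e.image_symm_image F.1)
  continuous_toFun := continuous_map _ e.continuous
  continuous_invFun := continuous_map _ e.symm.continuous

/-- Inclusion of a smaller symmetric product. -/
def incl (h : n ≤ m) (F : HypFnDiff k n X) : HypFnDiff k m X :=
  ⟨F.1, F.2.1, F.2.2.1, F.2.2.2.1, F.2.2.2.2.trans h⟩

theorem isInducing_incl (h : n ≤ m) : IsInducing (incl h : HypFnDiff k n X → HypFnDiff k m X) :=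
  isInducing_toSet.of_comp_iff.1 isInducing_toSet

theorem incl_injective (h : n ≤ m) :
    Function.Injective (incl h : HypFnDiff k n X → HypFnDiff k m X) :=
  fun F F' hF => toSet_injective (show F.toSet = F'.toSet from congrArg (fun G => G.toSet) hF)

/-- The range of an injective tuple. -/
def ofTuple (hkn : k < n) (x : Fin n → X) (hx : Function.Injective x) :
    HypFnDiff k n X :=
  ⟨range x, ⟨x ⟨0, by omega⟩, mem_range_self _⟩, finite_range x, by
    rw [← image_univ, ncard_image_of_injective _ hx, ncard_univ, Nat.card_fin]
    exact ⟨hkn, le_rfl⟩⟩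

theorem ncard_ofTuple (hkn : k < n) (x : Fin n → X) (hx : Function.Injective x) :
    (ofTuple hkn x hx).toSet.ncard = n :=
  (ncard_range_of_injective hx).trans (Nat.card_fin n)

theorem continuous_ofTuple (hkn : k < n) {Z : Type*} [TopologicalSpace Z] {x : Z → Fin n → X}
    (hx : ∀ z, Function.Injective (x z)) (hc : Continuous x) :
    Continuous fun z => ofTuple hkn (x z) (hx z) :=
  isInducing_toSet.continuous_iff.2
    (TopologicalSpace.vietoris.continuous_range_of_finite.comp hc)

theorem toSet_eq_range {F : HypFnDiff k n X} {y : Fin n → X} (hy : Function.Injective y)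
    (hF : ∀ p, y p ∈ F.toSet) : F.toSet = range y := by
  refine (eq_of_subset_of_ncard_le (range_subset_iff.2 hF) ?_ F.2.2.1).symm
  rw [ncard_range_of_injective hy, Nat.card_fin]
  exact F.2.2.2.2

end HypFnDiff

section Matching

variable {I J : Type*}

theorem tendsto_one_div_encode_add_one (I : Type*) [Encodable I] :
    Filter.Tendsto (fun i : I => 1 / ((Encodable.encode i : ℝ) + 1)) Filter.cofinite (𝓝 0) := by
  have h := (Encodable.encode_injective (α := I)).tendsto_cofinite
  rw [Nat.cofinite_eq_atTop] at h
  exact tendsto_one_div_add_atTop_nhds_zero_nat.comp h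

/-- Countably many infinite sets have an injective choice function. -/
theorem exists_injective_forall_mem_of_infinite [Encodable I] (T : I → Set J)
    (hT : ∀ i, (T i).Infinite) : ∃ f : I → J, Function.Injective f ∧ ∀ i, f i ∈ T i := by
  classical
  choose t ht hcard using fun i => (hT i).exists_subset_card_eq (Encodable.encode i + 1)
  obtain ⟨f, hf, hft⟩ := (Finset.all_card_le_biUnion_card_iff_exists_injective t).1 fun s => by
    rcases s.eq_empty_or_nonempty with rfl | hs
    · simp
    obtain ⟨i, hi, hmax⟩ := s.exists_max_image Encodable.encode hs
    calc s.card = (s.image Encodable.encode).card :=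
          (Finset.card_image_of_injective _ Encodable.encode_injective).symm
      _ ≤ (Finset.range (Encodable.encode i + 1)).card := by
          refine Finset.card_le_card fun j hj => ?_
          obtain ⟨k, hk, rfl⟩ := Finset.mem_image.1 hj
          exact Finset.mem_range.2 (Nat.lt_succ_of_le (hmax k hk))
      _ = (t i).card := by rw [Finset.card_range, hcard]
      _ ≤ _ := Finset.card_le_card (Finset.subset_biUnion_of_mem t hi)
  exact ⟨f, hf, fun i => ht i (hft i)⟩

variable {A : Type*} [PseudoMetricSpace A]

/-- Two families, each visiting every nonempty open set infinitely often, are asymptotically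
equal up to a bijection of the index sets. -/
theorem exists_equiv_tendsto_dist [Countable I] [Countable J] (b : I → A) (b' : J → A)
    (hb : ∀ U : Set A, IsOpen U → U.Nonempty → {i | b i ∈ U}.Infinite)
    (hb' : ∀ U : Set A, IsOpen U → U.Nonempty → {i | b' i ∈ U}.Infinite) :
    ∃ σ : I ≃ J, Filter.Tendsto (fun i => dist (b i) (b' (σ i))) Filter.cofinite (𝓝 0) := by
  have := Encodable.ofCountable I
  have := Encodable.ofCountable J
  obtain ⟨f, hf, hfb⟩ := exists_injective_forall_mem_of_infinite
    (fun i => {j | b' j ∈ Metric.ball (b i) (1 / ((Encodable.encode i : ℝ) + 1))})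
    fun i => hb' _ Metric.isOpen_ball ⟨b i, Metric.mem_ball_self (by positivity)⟩
  obtain ⟨g, hg, hgb⟩ := exists_injective_forall_mem_of_infinite
    (fun j => {i | b i ∈ Metric.ball (b' j) (1 / ((Encodable.encode j : ℝ) + 1))})
    fun j => hb _ Metric.isOpen_ball ⟨b' j, Metric.mem_ball_self (by positivity)⟩
  obtain ⟨h, hbij, hR⟩ := Function.Embedding.schroeder_bernstein_of_rel hf hg
    (fun i j => dist (b i) (b' j) ≤
      1 / ((Encodable.encode i : ℝ) + 1) + 1 / ((Encodable.encode j : ℝ) + 1))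
    (fun i => by
      have : dist (b' (f i)) (b i) < 1 / ((Encodable.encode i : ℝ) + 1) := hfb i
      have h0 : 0 ≤ 1 / ((Encodable.encode (f i) : ℝ) + 1) := by positivity
      rw [dist_comm]
      linarith)
    (fun j => by
      have : dist (b (g j)) (b' j) < 1 / ((Encodable.encode j : ℝ) + 1) := hgb j
      have h0 : 0 ≤ 1 / ((Encodable.encode (g j) : ℝ) + 1) := by positivity
      linarith)
  refine ⟨Equiv.ofBijective h hbij, squeeze_zero (fun _ => dist_nonneg) hR ?_⟩
  simpa using (tendsto_one_div_encode_add_one I).add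
    ((tendsto_one_div_encode_add_one J).comp hbij.1.tendsto_cofinite)

/-- The filter of indices going to infinity along which `b` converges to `a`. -/
def limitIndices (b : I → A) (a : A) : Filter I := Filter.cofinite ⊓ Filter.comap b (𝓝 a)

theorem tendsto_limitIndices {b : I → A} {b' : J → A} {σ : I → J} (hσ : Function.Injective σ)
    (h : Filter.Tendsto (fun i => dist (b i) (b' (σ i))) Filter.cofinite (𝓝 0)) (a : A) :
    Filter.Tendsto σ (limitIndices b a) (limitIndices b' a) := by
  refine Filter.tendsto_inf.2 ⟨hσ.tendsto_cofinite.mono_left inf_le_left,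
    Filter.tendsto_comap_iff.2 ?_⟩
  have h1 : Filter.Tendsto b (limitIndices b a) (𝓝 a) :=
    Filter.tendsto_comap.mono_left inf_le_right
  exact h1.congr_dist (h.mono_left inf_le_left)

theorem map_limitIndices {b : I → A} {b' : J → A} (σ : I ≃ J)
    (h : Filter.Tendsto (fun i => dist (b i) (b' (σ i))) Filter.cofinite (𝓝 0)) (a : A) :
    Filter.map σ (limitIndices b a) = limitIndices b' a := by
  refine le_antisymm (tendsto_limitIndices σ.injective h a) ?_
  have h' : Filter.Tendsto (fun j => dist (b' j) (b (σ.symm j))) Filter.cofinite (𝓝 0) := by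
    simpa [Function.comp_def, dist_comm] using h.comp σ.symm.injective.tendsto_cofinite
  have := Filter.map_mono (m := σ) (tendsto_limitIndices σ.symm.injective h' a)
  simpa [Filter.map_map] using this

end Matching

section Attachment

variable {A I J P X Y : Type*} [PseudoMetricSpace A] [TopologicalSpace P]
  [TopologicalSpace X] [TopologicalSpace Y]

/-- The neighbourhood filters of the space obtained from `A` by attaching a copy of `P` for every
index `i : I`, such that the copies accumulate at `A` along `b` and `𝒵`. -/
def attachNhds (𝒵 : Filter P) (b : I → A) : A ⊕ I × P → Filter (A ⊕ I × P)
  | .inl a => Filter.map Sum.inl (𝓝 a) ⊔ Filter.map Sum.inr (limitIndices b a ×ˢ 𝒵)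
  | .inr q => Filter.map (fun p => Sum.inr (q.1, p)) (𝓝 q.2)

theorem map_attachNhds (𝒵 : Filter P) {b : I → A} {b' : J → A} (σ : I ≃ J)
    (h : Filter.Tendsto (fun i => dist (b i) (b' (σ i))) Filter.cofinite (𝓝 0))
    (x : A ⊕ I × P) :
    Filter.map (Equiv.sumCongr (Equiv.refl A) (σ.prodCongr (Equiv.refl P))) (attachNhds 𝒵 b x) =
      attachNhds 𝒵 b' (Equiv.sumCongr (Equiv.refl A) (σ.prodCongr (Equiv.refl P)) x) := by
  rcases x with a | ⟨i, p⟩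
  · simp only [attachNhds, Equiv.sumCongr_apply, Sum.map_inl, Equiv.refl_apply, Filter.map_sup,
      Filter.map_map]
    congr 1
    rw [← map_limitIndices σ h a, ← Filter.map_id (f := 𝒵), Filter.prod_map_map_eq,
      Filter.map_map, Filter.map_id]
    rfl
  · simp only [attachNhds, Equiv.sumCongr_apply, Sum.map_inr, Filter.map_map]
    rfl

/-- `X` is obtained from `A` by attaching copies of `P` along `b` and `𝒵`. -/
def IsAttachment (𝒵 : Filter P) (b : I → A) (e : X ≃ A ⊕ I × P) : Prop :=
  ∀ x, Filter.map e (𝓝 x) = attachNhds 𝒵 b (e x)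

theorem nonempty_homeomorph_of_map_nhds (e : X ≃ Y) (h : ∀ x, Filter.map e (𝓝 x) = 𝓝 (e x)) :
    Nonempty (X ≃ₜ Y) :=
  ⟨e.toHomeomorphOfIsInducing (isInducing_iff_nhds.2 fun x => by
    rw [← h x, Filter.comap_map e.injective])⟩

/-- Attaching copies of `P` along any two everywhere recurring families gives homeomorphic
spaces. -/
theorem IsAttachment.nonempty_homeomorph [Countable I] [Countable J] {𝒵 : Filter P} {b : I → A}
    {b' : J → A} (hb : ∀ U : Set A, IsOpen U → U.Nonempty → {i | b i ∈ U}.Infinite)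
    (hb' : ∀ U : Set A, IsOpen U → U.Nonempty → {i | b' i ∈ U}.Infinite)
    {e : X ≃ A ⊕ I × P} {e' : Y ≃ A ⊕ J × P} (he : IsAttachment 𝒵 b e)
    (he' : IsAttachment 𝒵 b' e') : Nonempty (X ≃ₜ Y) := by
  obtain ⟨σ, hσ⟩ := exists_equiv_tendsto_dist b b' hb hb'
  let g := Equiv.sumCongr (Equiv.refl A) (σ.prodCongr (Equiv.refl P))
  refine nonempty_homeomorph_of_map_nhds ((e.trans g).trans e'.symm) fun x => ?_
  have h1 : Filter.map (g ∘ e) (𝓝 x) = Filter.map e' (𝓝 (e'.symm (g (e x)))) := by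
    rw [he', e'.apply_symm_apply, ← Filter.map_map, he, map_attachNhds 𝒵 σ hσ]
  have h2 := congrArg (Filter.map e'.symm) h1
  simpa [Filter.map_map, Function.comp_def] using h2

end Attachment

/-- A criterion for a space to be an attachment of copies of `P` to `RatL2 ℕ`: the pieces `c i`
should shrink towards points `F i` of an ambient metric space as they approach the image of
`RatL2 ℕ`. -/
theorem exists_isAttachment {I P X M : Type*} [Countable I] [TopologicalSpace P]
    [TopologicalSpace X] [PseudoMetricSpace M] {j : X → M} (hj : IsInducing j) {𝒵 : Filter P}
    {α : RatL2 ℕ → X} (hα : IsInducing α) {c : I → P → X} (hc : ∀ i, IsOpenEmbedding (c i))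
    (hcl : ∀ i, IsClosed (range (c i)))
    (hbij : Function.Bijective (Sum.elim α fun q : I × P => c q.1 q.2))
    (hdense : Dense (range α)ᶜ) (F : I → M) (μ : I → ℝ) {η : P → ℝ}
    (hη : Filter.Tendsto η 𝒵 (𝓝 0)) (hdist : ∀ i p, dist (j (c i p)) (F i) ≤ η p + μ i)
    (h𝒵 : ∀ a, Filter.Tendsto Prod.snd
      (Filter.comap (fun q : I × P => c q.1 q.2) (𝓝 (α a))) 𝒵)
    (hμ : ∀ a, Filter.Tendsto (fun q => μ q.1)
      (Filter.comap (fun q : I × P => c q.1 q.2) (𝓝 (α a))) (𝓝 0)) :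
    ∃ (b : I → RatL2 ℕ) (e : X ≃ RatL2 ℕ ⊕ I × P),
      (∀ U : Set (RatL2 ℕ), IsOpen U → U.Nonempty → {i | b i ∈ U}.Infinite) ∧
        IsAttachment 𝒵 b e := by
  have := Encodable.ofCountable I
  set s : I × P → X := fun q => c q.1 q.2 with hs
  set ν : I → ℝ := fun i => 1 / ((Encodable.encode i : ℝ) + 1) with hν
  have hν0 : ∀ i, 0 < ν i := fun i => by positivity
  have hνlim : Filter.Tendsto ν Filter.cofinite (𝓝 0) := tendsto_one_div_encode_add_one I
  have hjα : IsInducing (j ∘ α) := hj.comp hα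
  -- nearly closest points of the image of `RatL2 ℕ`
  have hclose : ∀ i, ∃ a₀, ∀ a, dist (F i) (j (α a₀)) ≤ dist (F i) (j (α a)) + ν i := fun i => by
    obtain ⟨_, ⟨a₀, rfl⟩, h⟩ := (Metric.infDist_lt_iff (range_nonempty (j ∘ α))).1
      (lt_add_of_pos_right (Metric.infDist (F i) (range (j ∘ α))) (hν0 i))
    exact ⟨a₀, fun a => h.le.trans (by
      gcongr
      exact Metric.infDist_le_dist_of_mem (mem_range_self (f := j ∘ α) a))⟩
  choose a₀ ha₀ using hclose
  set ρ : I → ℝ := fun i => dist (F i) (j (α (a₀ i))) + |μ i| with hρ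
  have hρ0 : ∀ i, 0 ≤ ρ i := fun i => by positivity
  choose b hb1 hb2 using fun i => (a₀ i).exists_dist_le_coord (Encodable.encode i) (hρ0 i)
  -- points near `α a` lie in pieces of large index
  have hcof : ∀ a, Filter.Tendsto Prod.fst (Filter.comap s (𝓝 (α a))) Filter.cofinite := by
    intro a
    refine Filter.le_cofinite_iff_eventually_ne.2 fun i => ?_
    have hmem : (range (c i))ᶜ ∈ 𝓝 (α a) := (hcl i).isOpen_compl.mem_nhds fun ⟨p, hp⟩ => by
      have := hbij.1 (a₁ := .inr (i, p)) (a₂ := .inl a) (by simpa using hp)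
      simp at this
    refine Filter.mem_map.2 (Filter.mem_of_superset (Filter.preimage_mem_comap hmem) ?_)
    rintro ⟨i', p⟩ hq rfl
    exact hq ⟨p, rfl⟩
  have hle : ∀ a, Filter.comap s (𝓝 (α a)) ≤ limitIndices b a ×ˢ 𝒵 := by
    intro a
    set L := Filter.comap s (𝓝 (α a)) with hL
    have hsL : Filter.Tendsto (fun q => j (s q)) L (𝓝 (j (α a))) :=
      hj.continuous.continuousAt.tendsto.comp Filter.tendsto_comap
    have hF : Filter.Tendsto (fun q : I × P => F q.1) L (𝓝 (j (α a))) := by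
      refine hsL.congr_dist (squeeze_zero (fun _ => dist_nonneg) (fun q => hdist q.1 q.2) ?_)
      simpa using (hη.comp (h𝒵 a)).add (hμ a)
    have hd : Filter.Tendsto (fun q : I × P => dist (F q.1) (j (α (a₀ q.1)))) L (𝓝 0) := by
      refine squeeze_zero (fun _ => dist_nonneg) (fun q => ha₀ q.1 a) ?_
      simpa using (tendsto_iff_dist_tendsto_zero.1 hF).add (hνlim.comp (hcof a))
    have hρlim : Filter.Tendsto (fun q : I × P => ρ q.1) L (𝓝 0) := by
      simpa using hd.add (hμ a).abs
    have ha : Filter.Tendsto (fun q : I × P => a₀ q.1) L (𝓝 a) :=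
      hjα.tendsto_nhds_iff.2 (hF.congr_dist hd)
    have hblim : Filter.Tendsto (fun q : I × P => b q.1) L (𝓝 a) :=
      ha.congr_dist (squeeze_zero (fun _ => dist_nonneg)
        (fun q => (dist_comm _ _).trans_le (hb1 q.1)) hρlim)
    have h1 : Filter.Tendsto Prod.fst L (limitIndices b a) :=
      Filter.tendsto_inf.2 ⟨hcof a, Filter.tendsto_comap_iff.2 hblim⟩
    exact h1.prodMk (h𝒵 a)
  have hge : ∀ a, limitIndices b a ×ˢ 𝒵 ≤ Filter.comap s (𝓝 (α a)) := by
    intro a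
    have hblim : Filter.Tendsto b (limitIndices b a) (𝓝 a) :=
      Filter.tendsto_comap.mono_left inf_le_right
    have hbd := tendsto_iff_dist_tendsto_zero.1 hblim
    have henc : Filter.Tendsto Encodable.encode (limitIndices b a) Filter.atTop := by
      rw [← Nat.cofinite_eq_atTop]
      exact Encodable.encode_injective.tendsto_cofinite.mono_left inf_le_left
    have hρlim : Filter.Tendsto ρ (limitIndices b a) (𝓝 0) := by
      refine squeeze_zero hρ0 (g := fun i => 2 * (|(a (Encodable.encode i) : ℝ)| + dist (b i) a))
        (fun i => ?_) ?_
      · have h1 := (b i).abs_sub_le_dist a (Encodable.encode i)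
        have h2 := abs_sub_abs_le_abs_sub (b i (Encodable.encode i) : ℝ) (a (Encodable.encode i))
        have := hb2 i
        linarith
      · simpa using ((a.tendsto_apply_atTop.comp henc).add hbd).const_mul 2
    have hμlim : Filter.Tendsto μ (limitIndices b a) (𝓝 0) :=
      squeeze_zero_norm (fun i => by simp [hρ]) hρlim
    have hdlim : Filter.Tendsto (fun i => dist (F i) (j (α (a₀ i)))) (limitIndices b a) (𝓝 0) :=
      squeeze_zero (fun _ => dist_nonneg) (fun i => by simp [hρ]) hρlim
    have ha : Filter.Tendsto a₀ (limitIndices b a) (𝓝 a) :=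
      hblim.congr_dist (squeeze_zero (fun _ => dist_nonneg) hb1 hρlim)
    have hF : Filter.Tendsto F (limitIndices b a) (𝓝 (j (α a))) :=
      (hjα.continuous.continuousAt.tendsto.comp ha).congr_dist (by
        simpa [Function.comp_def, dist_comm] using hdlim)
    refine Filter.tendsto_iff_comap.1 (hj.tendsto_nhds_iff.2 ?_)
    refine (hF.comp Filter.tendsto_fst).congr_dist (squeeze_zero (fun _ => dist_nonneg)
      (fun q => (dist_comm _ _).trans_le (hdist q.1 q.2)) ?_)
    simpa using (hη.comp Filter.tendsto_snd).add (hμlim.comp Filter.tendsto_fst)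
  have heq : ∀ a, Filter.comap s (𝓝 (α a)) = limitIndices b a ×ˢ 𝒵 :=
    fun a => le_antisymm (hle a) (hge a)
  have hrange : range α ∪ range s = univ := by
    rw [← Sum.elim_range, hbij.2.range_eq]
  refine ⟨b, (Equiv.ofBijective _ hbij).symm, fun U hU ⟨a, haU⟩ hfin => ?_, fun x => ?_⟩
  · have hne : (Filter.comap s (𝓝 (α a))).NeBot := Filter.comap_neBot fun t ht => by
      obtain ⟨y, hyt, hy⟩ := mem_closure_iff_nhds.1 (hdense (α a)) t ht
      have : y ∈ range α ∪ range s := hrange ▸ mem_univ y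
      obtain ⟨q, rfl⟩ := this.resolve_left hy
      exact ⟨q, hyt⟩
    rw [heq, Filter.prod_neBot] at hne
    have := hne.1
    have h1 : {i | b i ∈ U}ᶜ ∈ limitIndices b a := Filter.mem_inf_of_left hfin.compl_mem_cofinite
    have h2 : {i | b i ∈ U} ∈ limitIndices b a :=
      Filter.mem_inf_of_right (Filter.preimage_mem_comap (hU.mem_nhds haU))
    exact Filter.empty_notMem (limitIndices b a) (by simpa using Filter.inter_mem h1 h2)
  · obtain ⟨y, rfl⟩ := (Equiv.ofBijective _ hbij).surjective x
    suffices h : 𝓝 (Equiv.ofBijective _ hbij y) =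
        Filter.map (Equiv.ofBijective _ hbij) (attachNhds 𝒵 b y) by
      rw [h, Filter.map_map, Equiv.symm_comp_self, Filter.map_id, Equiv.symm_apply_apply]
    rcases y with a | ⟨i, p⟩
    · have h1 : Filter.map α (𝓝 a) ⊔ Filter.map s (Filter.comap s (𝓝 (α a))) = 𝓝 (α a) := by
        rw [hα.nhds_eq_comap, Filter.map_comap, Filter.map_comap, ← inf_sup_left,
          Filter.sup_principal, hrange, Filter.principal_univ, inf_top_eq]
      simp only [attachNhds, Filter.map_sup, Filter.map_map, ← heq]
      exact h1.symm
    · simp only [attachNhds, Filter.map_map]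
      exact ((hc i).map_nhds_eq p).symm

/-- The index of the cell of level `m` containing `q`; the cells are the intervals of length
`2⁻ᵐ` with end points in `√2 + 2⁻ᵐ ℤ`. -/
def cell (m : ℕ) (q : ℚ) : ℤ := ⌊2 ^ m * ((q : ℝ) - √2)⌋

theorem cell_eq_of_le {m m' : ℕ} (h : m' ≤ m) {q q' : ℚ} (hq : cell m q = cell m q') :
    cell m' q = cell m' q' := by
  have key : ∀ q, cell m' q = cell m q / ((2 ^ (m - m') : ℕ) : ℤ) := fun q => by
    rw [cell, cell, ← Int.floor_div_natCast]
    congr 1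
    obtain ⟨d, rfl⟩ := Nat.exists_eq_add_of_le h
    rw [Nat.add_sub_cancel_left, pow_add]
    push_cast
    field_simp
  rw [key, key, hq]

theorem abs_sub_le_of_cell_eq {m : ℕ} {q q' : ℚ} (h : cell m q = cell m q') :
    |(q : ℝ) - q'| ≤ 1 / 2 ^ m := by
  have h1 := Int.abs_sub_lt_one_of_floor_eq_floor h
  rw [← mul_sub, sub_sub_sub_cancel_right, abs_mul, abs_of_pos (by positivity)] at h1
  rw [le_div_iff₀' (by positivity)]
  exact h1.le

theorem cell_eq_iff {m : ℕ} {q : ℚ} {z : ℤ} :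
    cell m q = z ↔ (z : ℝ) < 2 ^ m * ((q : ℝ) - √2) ∧ 2 ^ m * ((q : ℝ) - √2) < z + 1 := by
  rw [cell, Int.floor_eq_iff]
  refine and_congr_left fun _ => ⟨fun h => h.lt_of_ne fun he => ?_, le_of_lt⟩
  refine irrational_sqrt_two ⟨q - z / 2 ^ m, ?_⟩
  push_cast
  rw [he]
  field_simp
  ring

theorem continuous_cell (m : ℕ) : Continuous (cell m) := by
  refine continuous_discrete_rng.2 fun z => ?_
  have : cell m ⁻¹' {z} =
      (fun q : ℚ => 2 ^ m * ((q : ℝ) - √2)) ⁻¹' Ioo (z : ℝ) (z + 1) := by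
    ext q
    exact cell_eq_iff
  rw [this]
  have hc : Continuous ((↑) : ℚ → ℝ) := Rat.continuous_coe_real
  exact isOpen_Ioo.preimage (by fun_prop)

theorem cell_surjective (m : ℕ) : Function.Surjective (cell m) := fun z => by
  obtain ⟨q, h1, h2⟩ := exists_rat_btwn
    (show (z : ℝ) / 2 ^ m + √2 < (z + 1) / 2 ^ m + √2 by gcongr; linarith)
  refine ⟨q, cell_eq_iff.2 ⟨?_, ?_⟩⟩
  · rw [← div_lt_iff₀' (by positivity)]
    linarith
  · rw [← lt_div_iff₀' (by positivity)]
    linarith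

theorem cell_mono (m : ℕ) : Monotone (cell m) := fun q q' h => by
  unfold cell
  gcongr

theorem nonempty_homeomorph_cell (m : ℕ) (z : ℤ) : Nonempty (cell m ⁻¹' {z} ≃ₜ ℚ) :=
  have := (ordConnected_singleton (a := z)).preimage_mono (cell_mono m)
  nonempty_homeomorph_rat_of_ordConnected (cell_surjective m z)
    ((isOpen_discrete _).preimage (continuous_cell m))

namespace RatL2

/-- The cells of level `m` of the first `m` coordinates. -/
def cells (m : ℕ) (x : RatL2 ℕ) (l : Fin m) : ℤ := cell m (x l)

theorem continuous_cells (m : ℕ) : Continuous (cells m) :=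
  continuous_pi fun _ => (continuous_cell m).comp (continuous_apply _)

theorem cells_eq_of_le {m m' : ℕ} (h : m' ≤ m) {x y : RatL2 ℕ} (hxy : cells m x = cells m y) :
    cells m' x = cells m' y :=
  funext fun l => cell_eq_of_le h (congrFun hxy ⟨l, l.2.trans_le h⟩)

theorem dist_le_of_cells_eq {m : ℕ} {x y : RatL2 ℕ} (h : cells m x = cells m y) :
    dist x y ≤ dist (shift m x) (shift m y) + m / 2 ^ m := by
  refine abs_le_of_sq_le_sq (b := _) ?_ (by positivity) |> (le_abs_self _).trans
  have hsum : ∑ i ∈ Finset.range m, ((x i : ℝ) - y i) ^ 2 ≤ (m / 2 ^ m) ^ 2 := by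
    calc ∑ i ∈ Finset.range m, ((x i : ℝ) - y i) ^ 2
        ≤ ∑ i ∈ Finset.range m, (1 / 2 ^ m : ℝ) ^ 2 := by
          refine Finset.sum_le_sum fun i hi => sq_le_sq.2 ?_
          rw [abs_of_nonneg (a := (1 / 2 ^ m : ℝ)) (by positivity)]
          exact abs_sub_le_of_cell_eq (congrFun h ⟨i, Finset.mem_range.1 hi⟩)
      _ = m * (1 / 2 ^ m) ^ 2 := by simp
      _ ≤ m ^ 2 * (1 / 2 ^ m) ^ 2 := by
          gcongr
          exact_mod_cast Nat.le_self_pow two_ne_zero m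
      _ = _ := by ring
  rw [dist_sq_eq m]
  have : 0 ≤ dist (shift m x) (shift m y) * (m / 2 ^ m) := by positivity
  nlinarith

theorem tendsto_div_two_pow : Filter.Tendsto (fun m : ℕ => (m : ℝ) / 2 ^ m) Filter.atTop (𝓝 0) := by
  simpa using tendsto_pow_const_div_const_pow_of_one_lt 1 (one_lt_two (α := ℝ))

theorem exists_cells_ne {x y : RatL2 ℕ} (h : x ≠ y) : ∃ m, cells m x ≠ cells m y := by
  by_contra! hall
  refine h (dist_le_zero.1 (ge_of_tendsto' (x := Filter.atTop) ?_ fun m =>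
    (dist_le_of_cells_eq (hall m)).trans (add_le_add_left (dist_triangle_right _ _ 0) _)))
  simpa using ((tendsto_dist_shift_zero x).add (tendsto_dist_shift_zero y)).add tendsto_div_two_pow

/-- Splitting off the first `m` coordinates of each member of a tuple. -/
def splitTuple (n m : ℕ) :
    (Fin n × Fin m → ℚ) × (Fin n → RatL2 ℕ) ≃ₜ (Fin n → RatL2 ℕ) where
  toFun w p := (split m).symm (fun l => w.1 (p, l), w.2 p)
  invFun x := (fun r => x r.1 r.2, fun p => shift m (x p))
  left_inv w := by
    have h : ∀ p, split m ((split m).symm (fun l => w.1 (p, l), w.2 p)) =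
      (fun l => w.1 (p, l), w.2 p) := fun p => (split m).apply_symm_apply _
    refine Prod.ext (funext fun r => ?_) (funext fun p => ?_)
    · exact congrFun (congrArg Prod.fst (h r.1)) r.2
    · exact congrArg Prod.snd (h p)
  right_inv x := funext fun p => (split m).symm_apply_apply (x p)
  continuous_toFun := by fun_prop
  continuous_invFun := by
    refine Continuous.prodMk (continuous_pi fun r => ?_) (continuous_pi fun p => ?_)
    · exact (continuous_apply _).comp (_root_.continuous_apply r.1)
    · exact (continuous_snd.comp (split m).continuous).comp (_root_.continuous_apply p)

/-- A homeomorphism of a nontrivial finite power of `RatL2 ℕ` with `RatL2 ℕ`. -/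
def piHomeomorph (n : ℕ) [NeZero n] : (Fin n → RatL2 ℕ) ≃ₜ RatL2 ℕ :=
  (exists_pi_homeomorph (Fin n)).choose

theorem piHomeomorph_zero (n : ℕ) [NeZero n] : piHomeomorph n 0 = 0 :=
  (exists_pi_homeomorph (Fin n)).choose_spec

/-- Tuples with prescribed cells are parametrized by `ℚ × RatL2 ℕ`. -/
theorem exists_isEmbedding_cells {n m : ℕ} [NeZero n] [NeZero m] (κ : Fin n → Fin m → ℤ) :
    ∃ φ : ℚ × RatL2 ℕ → (Fin n → RatL2 ℕ), IsEmbedding φ ∧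
      range φ = {x | ∀ p, cells m (x p) = κ p} ∧
      ∀ w p, shift m (φ w p) = (piHomeomorph n).symm w.2 p := by
  obtain ⟨g⟩ := nonempty_pi_rat_homeomorph_rat (Fin n × Fin m)
  have h : ∀ r : Fin n × Fin m, cell m ⁻¹' {κ r.1 r.2} ≃ₜ ℚ := fun r =>
    (nonempty_homeomorph_cell m (κ r.1 r.2)).some
  let f : (Fin n × Fin m → ℚ) → (Fin n × Fin m → ℚ) := Pi.map fun r q => ((h r).symm q : ℚ)
  have hf : IsEmbedding f :=
    IsEmbedding.piMap fun r => IsEmbedding.subtypeVal.comp (h r).symm.isEmbedding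
  refine ⟨splitTuple n m ∘ Prod.map f id ∘ Prod.map g.symm (piHomeomorph n).symm,
    (splitTuple n m).isEmbedding.comp ((hf.prodMap .id).comp
      (g.symm.isEmbedding.prodMap (piHomeomorph n).symm.isEmbedding)), ?_, fun w p => ?_⟩
  · ext x
    constructor
    · rintro ⟨w, rfl⟩ p
      funext l
      have hx := congrFun (congrArg Prod.fst ((splitTuple n m).symm_apply_apply
        (f (g.symm w.1), (piHomeomorph n).symm w.2))) (p, l)
      refine (congrArg (cell m) hx).trans ?_
      exact ((h (p, l)).symm (g.symm w.1 (p, l))).2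
    · intro hx
      refine ⟨(g fun r => h r ⟨x r.1 r.2, congrFun (hx r.1) r.2⟩,
        piHomeomorph n fun p => shift m (x p)), ?_⟩
      refine Eq.trans ?_ ((splitTuple n m).apply_symm_apply x)
      refine congrArg (splitTuple n m) (Prod.ext ?_ ?_)
      · funext r
        simp [f, splitTuple]
      · simp [splitTuple]
  · exact congrFun (congrArg Prod.snd ((splitTuple n m).symm_apply_apply
        (f (g.symm w.1), (piHomeomorph n).symm w.2))) p

end RatL2

open RatL2

/-- `κ` prescribes pairwise distinct cells of level `m`, and `m` is the least level at which
tuples with these cells are separated. -/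
def IsSeparatingLevel {n : ℕ} (m : ℕ) (κ : Fin n → Fin m → ℤ) : Prop :=
  Function.Injective κ ∧ ∀ x : Fin n → RatL2 ℕ, (∀ p, cells m (x p) = κ p) →
    ∀ m' < m, ¬ Function.Injective fun p => cells m' (x p)

/-- The index set of the pieces into which the injective `n`-tuples are decomposed. -/
def CellIndex (n : ℕ) : Type :=
  {i : Σ m : ℕ, (Fin n → Fin m → ℤ) // IsSeparatingLevel i.1 i.2}

namespace CellIndex

variable {n : ℕ}

instance : Countable (CellIndex n) := inferInstanceAs (Countable (Subtype _))

/-- The level at which the tuples of a piece are separated. -/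
def level (i : CellIndex n) : ℕ := i.1.1

/-- The cells prescribed by an index. -/
def cell (i : CellIndex n) : Fin n → Fin i.level → ℤ := i.1.2

theorem cell_injective (i : CellIndex n) : Function.Injective i.cell := i.2.1

theorem eq_of_forall_cells_eq {i j : CellIndex n} {x : Fin n → RatL2 ℕ}
    (hi : ∀ p, cells i.level (x p) = i.cell p) (hj : ∀ p, cells j.level (x p) = j.cell p) :
    i = j := by
  have hle : ∀ {i j : CellIndex n}, (∀ p, cells i.level (x p) = i.cell p) →
      (∀ p, cells j.level (x p) = j.cell p) → i.level ≤ j.level := fun {i j} hi hj => by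
    by_contra! h
    refine i.2.2 x hi j.level h ?_
    simpa only [hj] using j.cell_injective
  obtain ⟨⟨m, κ⟩, h⟩ := i
  obtain ⟨⟨m', κ'⟩, h'⟩ := j
  obtain rfl : m = m' := le_antisymm (hle hi hj) (hle hj hi)
  obtain rfl : κ = κ' := funext fun p => (hi p).symm.trans (hj p)
  rfl

theorem exists_forall_cells_eq {x : Fin n → RatL2 ℕ} (hx : Function.Injective x) :
    ∃ i : CellIndex n, ∀ p, cells i.level (x p) = i.cell p := by
  classical
  have hex : ∃ m, Function.Injective fun p => cells m (x p) := by
    choose f hf using fun r : {r : Fin n × Fin n // r.1 ≠ r.2} =>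
      exists_cells_ne (hx.ne r.2)
    refine ⟨Finset.univ.sup f, fun p p' h => ?_⟩
    by_contra hne
    exact hf ⟨(p, p'), hne⟩ (cells_eq_of_le (Finset.le_sup (Finset.mem_univ _)) h)
  refine ⟨⟨⟨Nat.find hex, fun p => cells _ (x p)⟩, Nat.find_spec hex, fun y hy m' hm' h => ?_⟩,
    fun p => rfl⟩
  refine Nat.find_min hex hm' ?_
  have : ∀ p, cells m' (y p) = cells m' (x p) := fun p => cells_eq_of_le hm'.le (hy p)
  simpa only [this] using h

variable [n.AtLeastTwo]

instance (i : CellIndex n) : NeZero i.level := ⟨fun h => by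
  have : IsEmpty (Fin i.level) := by rw [h]; infer_instance
  have h2 : 2 ≤ n := Nat.AtLeastTwo.prop
  have := i.cell_injective (Subsingleton.elim (i.cell ⟨0, by omega⟩) (i.cell ⟨1, by omega⟩))
  simp at this⟩

/-- Parametrization of the piece with index `i`. -/
def chart (i : CellIndex n) : ℚ × RatL2 ℕ → (Fin n → RatL2 ℕ) :=
  (exists_isEmbedding_cells i.cell).choose

theorem isEmbedding_chart (i : CellIndex n) : IsEmbedding i.chart :=
  (exists_isEmbedding_cells i.cell).choose_spec.1

theorem range_chart (i : CellIndex n) :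
    range i.chart = {x | ∀ p, cells i.level (x p) = i.cell p} :=
  (exists_isEmbedding_cells i.cell).choose_spec.2.1

theorem shift_chart (i : CellIndex n) (w : ℚ × RatL2 ℕ) (p : Fin n) :
    shift i.level (i.chart w p) = (piHomeomorph n).symm w.2 p :=
  (exists_isEmbedding_cells i.cell).choose_spec.2.2 w p

theorem cells_chart (i : CellIndex n) (w : ℚ × RatL2 ℕ) (p : Fin n) :
    cells i.level (i.chart w p) = i.cell p :=
  i.range_chart.subset (mem_range_self w) p

theorem chart_apply_injective (i : CellIndex n) (w : ℚ × RatL2 ℕ) :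
    Function.Injective (i.chart w) := fun p p' h =>
  i.cell_injective (by rw [← i.cells_chart w, ← i.cells_chart w, h])

theorem isClopen_range_chart (i : CellIndex n) : IsClopen (range i.chart) := by
  have h : range i.chart =
      (fun x : Fin n → RatL2 ℕ => fun p => cells i.level (x p)) ⁻¹' {i.cell} := by
    rw [range_chart]
    ext x
    exact funext_iff.symm
  rw [h]
  exact (isClopen_discrete _).preimage
    (continuous_pi fun p => (continuous_cells _).comp (continuous_apply p))

theorem exists_chart_eq {x : Fin n → RatL2 ℕ} (hx : Function.Injective x) :
    ∃ (i : CellIndex n) (w : ℚ × RatL2 ℕ), i.chart w = x := by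
  obtain ⟨i, hi⟩ := exists_forall_cells_eq hx
  obtain ⟨w, hw⟩ : x ∈ range i.chart := i.range_chart ▸ hi
  exact ⟨i, w, hw⟩

theorem chart_injective :
    Function.Injective fun q : CellIndex n × (ℚ × RatL2 ℕ) => q.1.chart q.2 := by
  rintro ⟨i, w⟩ ⟨j, w'⟩ h
  replace h : i.chart w = j.chart w' := h
  obtain rfl : i = j :=
    eq_of_forall_cells_eq (i.cells_chart w) fun p => h ▸ j.cells_chart w' p
  exact congrArg _ (i.isEmbedding_chart.injective h)

theorem dist_chart_le (i : CellIndex n) (w : ℚ × RatL2 ℕ) :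
    dist (i.chart w) (i.chart 0) ≤
      dist ((piHomeomorph n).symm w.2) 0 + i.level / 2 ^ i.level := by
  refine (dist_pi_le_iff (by positivity)).2 fun p => ?_
  have hcells : cells i.level (i.chart w p) = cells i.level (i.chart 0 p) := by
    rw [cells_chart, cells_chart]
  refine (dist_le_of_cells_eq hcells).trans (add_le_add_left ?_ _)
  have hzero : (piHomeomorph n).symm 0 = 0 :=
    (piHomeomorph n).symm_apply_eq.2 (piHomeomorph_zero n).symm
  rw [shift_chart, shift_chart, Prod.snd_zero, hzero]
  exact dist_le_pi_dist ((piHomeomorph n).symm w.2) 0 p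

theorem tendsto_dist_piHomeomorph_symm :
    Filter.Tendsto (fun w : ℚ × RatL2 ℕ => dist ((piHomeomorph n).symm w.2) 0)
      (Filter.comap Prod.snd (𝓝 0)) (𝓝 0) := by
  have hzero : (piHomeomorph n).symm 0 = 0 :=
    (piHomeomorph n).symm_apply_eq.2 (piHomeomorph_zero n).symm
  have h : Continuous fun z => dist ((piHomeomorph n).symm z) 0 := by fun_prop
  have h0 := h.tendsto 0
  rw [hzero, dist_self] at h0
  exact h0.comp Filter.tendsto_comap

/-- As the members of an injective tuple accumulate at fewer points than there are members, the
level tends to infinity and the tails tend to zero. -/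
theorem tendsto_level_and_tendsto_snd {I : Type*} (ι : I → CellIndex n)
    {L : Filter (I × (ℚ × RatL2 ℕ))} {V : Set (RatL2 ℕ)} (hV : V.Finite) (hcard : V.ncard < n)
    (hL : ∀ ε > 0, ∀ᶠ q in L, ∀ p, ∃ v ∈ V, dist ((ι q.1).chart q.2 p) v < ε) :
    Filter.Tendsto (fun q => (ι q.1).level) L Filter.atTop ∧
      Filter.Tendsto Prod.snd L (Filter.comap Prod.snd (𝓝 0)) := by
  have hlevel : Filter.Tendsto (fun q => (ι q.1).level) L Filter.atTop := by
    refine Filter.tendsto_atTop.2 fun M => ?_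
    have hnear : ∃ ε > 0, ∀ v ∈ V, ∀ y, dist y v < ε → cells M y = cells M v := by
      have hev : ∀ v ∈ V, ∀ᶠ ε in 𝓝[>] (0 : ℝ), ∀ y, dist y v < ε → cells M y = cells M v := by
        intro v _
        obtain ⟨ε, hε, h⟩ := Metric.mem_nhds_iff.1 (((isOpen_discrete {cells M v}).preimage
          (continuous_cells M)).mem_nhds (mem_singleton (cells M v)))
        filter_upwards [Ioo_mem_nhdsGT hε] with δ hδ y hy
        exact h (Metric.mem_ball.2 (hy.trans hδ.2))
      obtain ⟨ε, h, h0⟩ := (((Filter.eventually_all_finite hV).2 hev).and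
        self_mem_nhdsWithin).exists
      exact ⟨ε, h0, h⟩
    obtain ⟨ε, hε, h⟩ := hnear
    filter_upwards [hL ε hε] with q hq
    choose f hfV hf using hq
    by_contra! hlt
    obtain ⟨p, p', hne, hpp⟩ : ∃ p p', p ≠ p' ∧ f p = f p' := by
      have := hV.fintype
      by_contra! hinj
      have hfinj : Function.Injective fun p => (⟨f p, hfV p⟩ : V) := fun p p' he => by
        by_contra hne
        exact hinj p p' hne (congrArg Subtype.val he)
      have := Nat.card_le_card_of_injective _ hfinj
      rw [Nat.card_fin, Nat.card_coe_set_eq] at this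
      omega
    refine hne ((ι q.1).cell_injective ?_)
    rw [← (ι q.1).cells_chart q.2, ← (ι q.1).cells_chart q.2]
    refine cells_eq_of_le hlt.le ?_
    rw [h _ (hfV p) _ (hf p), h _ (hfV p') _ (hf p'), hpp]
  refine ⟨hlevel, Filter.tendsto_comap_iff.2 ?_⟩
  have hsymm : Filter.Tendsto (fun q => (piHomeomorph n).symm q.2.2) L (𝓝 0) := by
    refine Metric.tendsto_nhds.2 fun ε hε => ?_
    have htail : ∀ᶠ q in L, ∀ v ∈ V, dist (shift (ι q.1).level v) 0 < ε / 2 :=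
      (Filter.eventually_all_finite hV).2 fun v _ =>
        ((tendsto_dist_shift_zero v).comp hlevel).eventually_lt_const (half_pos hε)
    filter_upwards [hL (ε / 2) (half_pos hε), htail] with q h1 h2
    refine (dist_pi_lt_iff hε).2 fun p => ?_
    obtain ⟨v, hv, hd⟩ := h1 p
    rw [← (ι q.1).shift_chart]
    calc dist (shift (ι q.1).level ((ι q.1).chart q.2 p)) 0
        ≤ dist (shift (ι q.1).level ((ι q.1).chart q.2 p)) (shift (ι q.1).level v) +
            dist (shift (ι q.1).level v) 0 := dist_triangle _ _ _
      _ < ε / 2 + ε / 2 := add_lt_add ((dist_shift_le _ _ _).trans_lt hd) (h2 v hv)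
      _ = ε := add_halves ε
  have := ((piHomeomorph n).continuous.tendsto 0).comp hsymm
  rw [piHomeomorph_zero] at this
  simpa [Function.comp_def] using this

end CellIndex

instance RatL2.nhdsNE_neBot (x : RatL2 ℕ) : (𝓝[≠] x).NeBot := by
  refine mem_closure_iff_nhdsWithin_neBot.1 (Metric.mem_closure_iff.2 fun ε hε => ?_)
  obtain ⟨N, hN⟩ := (x.tendsto_apply_atTop.eventually_lt_const
    (show 0 < ε / 4 by positivity)).exists
  obtain ⟨y, hy1, hy2⟩ := x.exists_dist_le_coord N (half_pos hε).le
  refine ⟨y, ?_, ?_⟩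
  · rintro rfl
    linarith
  · rw [dist_comm]
    linarith

/-- The square of `RatL2 ℕ` arises from its diagonal by attaching copies of `ℚ × RatL2 ℕ`. -/
theorem exists_isAttachment_diagonal :
    ∃ (b : CellIndex 2 → RatL2 ℕ)
      (e : (Fin 2 → RatL2 ℕ) ≃ RatL2 ℕ ⊕ CellIndex 2 × (ℚ × RatL2 ℕ)),
      (∀ U : Set (RatL2 ℕ), IsOpen U → U.Nonempty → {i | b i ∈ U}.Infinite) ∧
        IsAttachment (Filter.comap Prod.snd (𝓝 0)) b e := by
  have hconst : Continuous fun (a : RatL2 ℕ) (_ : Fin 2) => a := by fun_prop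
  have hlim : ∀ a : RatL2 ℕ, _ := fun a => CellIndex.tendsto_level_and_tendsto_snd id
    (L := Filter.comap (fun q : CellIndex 2 × (ℚ × RatL2 ℕ) => q.1.chart q.2) (𝓝 fun _ => a))
    (finite_singleton a) (by simp) fun ε hε => by
      filter_upwards [Filter.preimage_mem_comap (Metric.ball_mem_nhds _ hε)] with q hq p
      exact ⟨a, rfl, (dist_pi_lt_iff hε).1 hq p⟩
  refine exists_isAttachment (j := id) .id (α := fun a _ => a) (c := CellIndex.chart)
    (IsEmbedding.of_leftInverse (f := fun x => x 0) (fun _ => rfl)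
      (_root_.continuous_apply 0) hconst).isInducing
    (fun i => ⟨i.isEmbedding_chart, i.isClopen_range_chart.isOpen⟩)
    (fun i => i.isClopen_range_chart.isClosed) ⟨?_, ?_⟩ ?_ (fun i => i.chart 0)
    (fun i => (i.level : ℝ) / 2 ^ i.level) CellIndex.tendsto_dist_piHomeomorph_symm
    (fun i w => i.dist_chart_le w) (fun a => (hlim a).2)
    (fun a => tendsto_div_two_pow.comp (hlim a).1)
  · refine Function.Injective.sumElim (fun a a' h => congrFun h 0) CellIndex.chart_injective ?_
    rintro a ⟨i, w⟩ h
    have := i.chart_apply_injective w (a₁ := 0) (a₂ := 1) (by rw [← h])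
    simp at this
  · intro x
    by_cases hx : x 0 = x 1
    · exact ⟨.inl (x 0), funext (Fin.forall_fin_two.2 ⟨rfl, hx⟩)⟩
    · have hinj : Function.Injective x := fun p p' h => by
        fin_cases p <;> fin_cases p' <;> simp_all
      obtain ⟨i, w, h⟩ := CellIndex.exists_chart_eq hinj
      exact ⟨.inr (i, w), h⟩
  · intro x
    by_cases hx : x ∈ range fun (a : RatL2 ℕ) (_ : Fin 2) => a
    · obtain ⟨a, rfl⟩ := hx
      refine Metric.mem_closure_iff.2 fun ε hε => ?_
      obtain ⟨y, hya, hy⟩ := Metric.mem_closure_iff.1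
        (mem_closure_iff_nhdsWithin_neBot.2 (RatL2.nhdsNE_neBot a)) ε hε
      refine ⟨![a, y], ?_, (dist_pi_lt_iff hε).2 (Fin.forall_fin_two.2 ⟨by simpa, by simpa⟩)⟩
      rintro ⟨a', h⟩
      refine hya ?_
      have h0 := congrFun h 0
      have h1 := congrFun h 1
      simp only [Matrix.cons_val_zero, Matrix.cons_val_one] at h0 h1
      rw [← h0, ← h1]
      rfl
    · exact subset_closure hx

namespace CellIndex

variable {n : ℕ}

/-- Permuting the members of the tuples of a piece. -/
def perm (i : CellIndex n) (σ : Equiv.Perm (Fin n)) : CellIndex n :=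
  ⟨⟨i.level, i.cell ∘ σ⟩, i.cell_injective.comp σ.injective, fun x hx m' hm' h => by
    refine i.2.2 (x ∘ σ.symm) (fun p => ?_) m' hm' (h.comp σ.symm.injective)
    exact (hx (σ.symm p)).trans (congrArg i.cell (σ.apply_symm_apply p))⟩

end CellIndex

/-- The index set of the pieces into which the sets with exactly `n` points are decomposed. -/
def SetCellIndex (n : ℕ) : Type :=
  {i : CellIndex n // StrictMono fun p => Encodable.encode (i.cell p)}

namespace SetCellIndex

variable {n k : ℕ}

instance : Countable (SetCellIndex n) := inferInstanceAs (Countable (Subtype _))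

instance : TopologicalSpace (SetCellIndex n) := ⊥

instance : DiscreteTopology (SetCellIndex n) := ⟨rfl⟩

variable [n.AtLeastTwo] (hkn : k < n)

/-- Parametrization of the piece with index `i`. -/
def chart (i : SetCellIndex n) (w : ℚ × RatL2 ℕ) : HypFnDiff k n (RatL2 ℕ) :=
  .ofTuple hkn (i.1.chart w) (i.1.chart_apply_injective w)

theorem exists_chart_eq_of_mem (i : SetCellIndex n) {F : HypFnDiff k n (RatL2 ℕ)}
    {y : Fin n → RatL2 ℕ} (hF : ∀ p, y p ∈ F.toSet)
    (hy : ∀ p, cells i.1.level (y p) = i.1.cell p) :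
    ∃ w, i.1.chart w = y ∧ i.chart hkn w = F := by
  obtain ⟨w, rfl⟩ : y ∈ range i.1.chart := i.1.range_chart ▸ hy
  exact ⟨w, rfl, HypFnDiff.toSet_injective
    (HypFnDiff.toSet_eq_range (i.1.chart_apply_injective w) hF).symm⟩

theorem continuous_chart (i : SetCellIndex n) : Continuous (i.chart hkn) :=
  HypFnDiff.continuous_ofTuple hkn _ i.1.isEmbedding_chart.continuous

theorem chart_injective :
    Function.Injective fun q : SetCellIndex n × (ℚ × RatL2 ℕ) => q.1.chart hkn q.2 := by
  rintro ⟨i, w⟩ ⟨j, w'⟩ h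
  have hrange : range (i.1.chart w) = range (j.1.chart w') := congrArg HypFnDiff.toSet h
  choose s hs using fun p => hrange.symm.subset (mem_range_self p)
  have hsinj : Function.Injective s := fun p p' hp =>
    j.1.chart_apply_injective w' (by rw [← hs, ← hs, hp])
  let σ : Equiv.Perm (Fin n) := Equiv.ofBijective s (Finite.injective_iff_bijective.1 hsinj)
  have hij : j.1 = i.1.perm σ := CellIndex.eq_of_forall_cells_eq (j.1.cells_chart w') fun p => by
    rw [← hs]
    exact i.1.cells_chart w (s p)
  have hmono : StrictMono fun p => Encodable.encode (i.1.cell (s p)) := by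
    have := j.2
    rw [hij] at this
    exact this
  have heq := (hmono.range_inj i.2).1
    (Function.Surjective.range_comp (f := σ) σ.surjective fun p => Encodable.encode (i.1.cell p))
  have hsid : ∀ p, s p = p := fun p =>
    i.1.cell_injective (Encodable.encode_injective (congrFun heq p))
  have hw : i.1.chart w = j.1.chart w' := funext fun p => by rw [← hs, hsid]
  obtain ⟨h1, h2⟩ := Prod.mk.inj (CellIndex.chart_injective (a₁ := (i.1, w)) (a₂ := (j.1, w')) hw)
  exact Prod.ext (Subtype.ext h1) h2

theorem isOpenEmbedding_chart (i : SetCellIndex n) : IsOpenEmbedding (i.chart hkn) := by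
  refine .of_continuous_injective_isOpenMap (i.continuous_chart hkn)
    (fun w w' h => (Prod.mk.inj (chart_injective hkn (a₁ := (i, w)) (a₂ := (i, w')) h)).2)
    fun U hU => ?_
  obtain ⟨V, hV, rfl⟩ := i.1.isEmbedding_chart.isInducing.isOpen_iff.1 hU
  refine isOpen_iff_mem_nhds.2 ?_
  rintro _ ⟨w, hw, rfl⟩
  obtain ⟨O, hO, hOV⟩ := isOpen_pi_iff'.1 hV _ hw
  have hcell : ∀ p, IsOpen (O p ∩ cells i.1.level ⁻¹' {i.1.cell p}) := fun p =>
    (hO p).1.inter ((isOpen_discrete _).preimage (continuous_cells _))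
  have hopen : IsOpen (⋂ p, {F : HypFnDiff k n (RatL2 ℕ) |
      (F.toSet ∩ (O p ∩ cells i.1.level ⁻¹' {i.1.cell p})).Nonempty}) :=
    isOpen_iInter_of_finite fun p => HypFnDiff.isOpen_inter_nonempty (hcell p)
  refine Filter.mem_of_superset (hopen.mem_nhds (mem_iInter.2 fun p =>
    ⟨i.1.chart w p, mem_range_self p, (hO p).2, i.1.cells_chart w p⟩)) fun F hF => ?_
  choose y hyF hyO hy using fun p => mem_iInter.1 hF p
  obtain ⟨w', rfl, h⟩ := i.exists_chart_eq_of_mem hkn hyF hy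
  exact ⟨w', hOV fun p _ => hyO p, h⟩

theorem isClosed_range_chart (i : SetCellIndex n) : IsClosed (range (i.chart hkn)) := by
  have h : range (i.chart hkn) = ⋂ p, {F : HypFnDiff k n (RatL2 ℕ) |
      F.toSet ⊆ (cells i.1.level ⁻¹' {i.1.cell p})ᶜ}ᶜ := by
    ext F
    simp only [mem_iInter, mem_compl_iff, mem_ofPred_eq, subset_compl_iff_disjoint_right,
      not_disjoint_iff]
    constructor
    · rintro ⟨w, rfl⟩ p
      exact ⟨_, mem_range_self p, i.1.cells_chart w p⟩
    · intro h
      choose y hyF hy using h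
      obtain ⟨w, -, hw⟩ := i.exists_chart_eq_of_mem hkn hyF hy
      exact ⟨w, hw⟩
  rw [h]
  exact isClosed_iInter fun p => (HypFnDiff.isOpen_subset
    ((isClosed_discrete _).preimage (continuous_cells _)).isOpen_compl).isClosed_compl

theorem exists_chart_eq {F : HypFnDiff k n (RatL2 ℕ)} (hF : F.toSet.ncard = n) :
    ∃ (i : SetCellIndex n) (w : ℚ × RatL2 ℕ), i.chart hkn w = F := by
  have : Finite F.toSet := F.2.2.1
  let E : F.toSet ≃ Fin n := Finite.equivFinOfCardEq (by rw [Nat.card_coe_set_eq, hF])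
  have hx : Function.Injective fun p => (E.symm p : RatL2 ℕ) :=
    Subtype.val_injective.comp E.symm.injective
  obtain ⟨i, hi⟩ := CellIndex.exists_forall_cells_eq hx
  let f : Fin n → ℕ := fun p => Encodable.encode (i.cell p)
  have hf : Function.Injective f := Encodable.encode_injective.comp i.cell_injective
  have hmono : StrictMono (f ∘ Tuple.sort f) :=
    (Tuple.monotone_sort f).strictMono_of_injective (hf.comp (Tuple.sort f).injective)
  obtain ⟨w, -, hw⟩ := exists_chart_eq_of_mem hkn ⟨i.perm (Tuple.sort f), hmono⟩
    (fun p => (E.symm (Tuple.sort f p)).2) fun p => hi (Tuple.sort f p)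
  exact ⟨_, w, hw⟩

theorem ncard_chart (i : SetCellIndex n) (w : ℚ × RatL2 ℕ) :
    (i.chart hkn w).toSet.ncard = n := HypFnDiff.ncard_ofTuple ..

end SetCellIndex

instance RatL2.instInfinite : Infinite (RatL2 ℕ) :=
  infinite_univ_iff.1 (infinite_of_mem_nhds 0 Filter.univ_mem)

namespace HypFnDiff

variable {k n : ℕ}

theorem dist_toNonemptyCompacts_chart_le [n.AtLeastTwo] (hkn : k < n) (i : SetCellIndex n)
    (w : ℚ × RatL2 ℕ) :
    dist (i.chart hkn w).toNonemptyCompacts (i.chart hkn 0).toNonemptyCompacts ≤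
      dist ((piHomeomorph n).symm w.2) 0 + (i.1.level : ℝ) / 2 ^ i.1.level := by
  refine le_trans ?_ (i.1.dist_chart_le w)
  rw [Metric.NonemptyCompacts.dist_eq]
  refine Metric.hausdorffDist_le_of_mem_dist dist_nonneg ?_ ?_
  · rintro _ ⟨p, rfl⟩
    exact ⟨_, mem_range_self p, dist_le_pi_dist _ _ p⟩
  · rintro _ ⟨p, rfl⟩
    refine ⟨_, mem_range_self p, ?_⟩
    rw [dist_comm]
    exact dist_le_pi_dist _ _ p

theorem dense_ncard_eq : Dense {F : HypFnDiff k n (RatL2 ℕ) | F.toSet.ncard = n} := by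
  intro F
  rw [isInducing_toNonemptyCompacts.closure_eq_preimage_closure_image]
  refine Metric.mem_closure_iff.2 fun ε hε => ?_
  obtain ⟨v, hv⟩ : F.toSet.Nonempty := F.2.1
  have hfin : F.toSet.Finite := F.2.2.1
  have hk : k < F.toSet.ncard := F.2.2.2.1
  have hn : F.toSet.ncard ≤ n := F.2.2.2.2
  obtain ⟨T, hT, hTcard⟩ := ((infinite_of_mem_nhds v (Metric.ball_mem_nhds v (half_pos hε))).sdiff
    hfin).exists_subset_card_eq (n - F.toSet.ncard)
  have hcard : (F.toSet ∪ ↑T).ncard = n := by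
    rw [ncard_union_eq (disjoint_right.2 fun x hx => (hT hx).2) hfin T.finite_toSet,
      ncard_coe_finset, hTcard]
    omega
  let G : HypFnDiff k n (RatL2 ℕ) := ⟨F.toSet ∪ ↑T, ⟨v, .inl hv⟩, hfin.union T.finite_toSet,
    (hk.trans_le hn).trans_eq hcard.symm, hcard.le⟩
  refine ⟨G.toNonemptyCompacts, mem_image_of_mem _ hcard, ?_⟩
  rw [Metric.NonemptyCompacts.dist_eq]
  refine lt_of_le_of_lt (Metric.hausdorffDist_le_of_mem_dist (half_pos hε).le ?_ ?_)
    (half_lt_self hε)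
  · intro x hx
    exact ⟨x, .inl hx, by simpa using (half_pos hε).le⟩
  · rintro x (hx | hx)
    · exact ⟨x, hx, by simpa using (half_pos hε).le⟩
    · exact ⟨v, hv, (hT hx).1.le⟩

theorem nonempty_homeomorph_self_succ (k : ℕ) (hk : 1 ≤ k) :
    Nonempty (HypFnDiff k (k + 1) (RatL2 ℕ) ≃ₜ RatL2 ℕ) := by
  have : (k + 1).AtLeastTwo := ⟨by omega⟩
  have hcard : ∀ F : HypFnDiff k (k + 1) (RatL2 ℕ), F.toSet.ncard = k + 1 := fun F =>
    le_antisymm F.2.2.2.2 F.2.2.2.1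
  have hex : ∀ F : HypFnDiff k (k + 1) (RatL2 ℕ), _ := fun F =>
    SetCellIndex.exists_chart_eq k.lt_succ_self (hcard F)
  have : Nonempty (SetCellIndex (k + 1)) :=
    ⟨(hex (ofTuple k.lt_succ_self (fun p => Infinite.natEmbedding _ p)
      ((Infinite.natEmbedding _).injective.comp Fin.val_injective))).choose⟩
  let f : SetCellIndex (k + 1) × (ℚ × RatL2 ℕ) → HypFnDiff k (k + 1) (RatL2 ℕ) :=
    fun q => q.1.chart k.lt_succ_self q.2
  have hf : Function.Bijective f := ⟨SetCellIndex.chart_injective _, fun F => by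
    obtain ⟨i, w, h⟩ := hex F
    exact ⟨(i, w), h⟩⟩
  have hcont : Continuous f := continuous_prod_of_discrete_left.2 fun i => i.continuous_chart _
  have hopen : IsOpenMap f := isOpenMap_prod_of_discrete_left.2 fun i =>
    (i.isOpenEmbedding_chart _).isOpenMap
  obtain ⟨g⟩ := nonempty_prod_rat_homeomorph_rat (SetCellIndex (k + 1))
  exact ⟨(((Equiv.ofBijective f hf).toHomeomorphOfContinuousOpen hcont hopen).symm.trans
    (Homeomorph.prodAssoc _ _ _).symm).trans
      ((g.prodCongr (Homeomorph.refl _)).trans consHomeomorph)⟩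

theorem nonempty_homeomorph_succ (hk : 1 ≤ k) (hkn : k < n)
    (h : HypFnDiff k n (RatL2 ℕ) ≃ₜ RatL2 ℕ) :
    Nonempty (HypFnDiff k (n + 1) (RatL2 ℕ) ≃ₜ RatL2 ℕ) := by
  have : (n + 1).AtLeastTwo := ⟨by omega⟩
  have hkn' : k < n + 1 := by omega
  let α : RatL2 ℕ → HypFnDiff k (n + 1) (RatL2 ℕ) := incl n.le_succ ∘ h.symm
  have hα : ∀ a, (α a).toSet.ncard ≤ n := fun a => (h.symm a).2.2.2.2
  have hlim : ∀ a, _ := fun a => CellIndex.tendsto_level_and_tendsto_snd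
    (Subtype.val : SetCellIndex (n + 1) → CellIndex (n + 1))
    (L := Filter.comap (fun q : SetCellIndex (n + 1) × (ℚ × RatL2 ℕ) => q.1.chart hkn' q.2)
      (𝓝 (α a)))
    (V := (α a).toSet) (α a).2.2.1 ((hα a).trans_lt n.lt_succ_self) fun ε hε => by
      have hU : IsOpen (⋃ v ∈ (α a).toSet, Metric.ball v ε) :=
        isOpen_biUnion fun _ _ => Metric.isOpen_ball
      filter_upwards [Filter.preimage_mem_comap ((isOpen_subset hU).mem_nhds fun v hv =>
        mem_biUnion hv (Metric.mem_ball_self hε))] with q hq p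
      simpa using hq (mem_range_self p)
  have hbij : Function.Bijective (Sum.elim α fun q : SetCellIndex (n + 1) × (ℚ × RatL2 ℕ) =>
      q.1.chart hkn' q.2) := by
    constructor
    · refine ((incl_injective _).comp h.symm.injective).sumElim
        (SetCellIndex.chart_injective hkn') fun a q hq => ?_
      have := hα a
      rw [show α a = _ from hq, SetCellIndex.ncard_chart] at this
      omega
    · intro F
      rcases Nat.le_succ_iff.1 F.2.2.2.2 with hF | hF
      · refine ⟨.inl (h ⟨F.1, F.2.1, F.2.2.1, F.2.2.2.1, hF⟩), ?_⟩
        exact congrArg (incl n.le_succ) (h.symm_apply_apply ⟨F.1, _⟩)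
      · obtain ⟨i, w, hw⟩ := SetCellIndex.exists_chart_eq hkn' hF
        exact ⟨.inr (i, w), hw⟩
  have hdense : Dense (range α)ᶜ := by
    refine dense_ncard_eq.mono ?_
    rintro _ hF ⟨a, rfl⟩
    have h1 := hα a
    have h2 : (α a).toSet.ncard = n + 1 := hF
    omega
  obtain ⟨b, e, hb, he⟩ := exists_isAttachment isInducing_toNonemptyCompacts (α := α)
    (c := SetCellIndex.chart hkn') ((isInducing_incl _).comp h.symm.isInducing)
    (fun i => i.isOpenEmbedding_chart hkn') (fun i => i.isClosed_range_chart hkn') hbij hdense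
    (fun i => (i.chart hkn' 0).toNonemptyCompacts)
    (fun i => (i.1.level : ℝ) / 2 ^ i.1.level) CellIndex.tendsto_dist_piHomeomorph_symm
    (dist_toNonemptyCompacts_chart_le hkn') (fun a => (hlim a).2)
    (fun a => tendsto_div_two_pow.comp (hlim a).1)
  obtain ⟨b', e', hb', he'⟩ := exists_isAttachment_diagonal
  exact (he.nonempty_homeomorph hb hb' he').map fun g => g.trans (piHomeomorph 2)

end HypFnDiff

/-- For `1 ≤ k < n`, the subspace `F_n(𝔈) \ F_k(𝔈)` is homeomorphic to Erdős space. -/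
theorem hypFnDiff_erdos_homeomorph (k n : ℕ) (hk : 1 ≤ k) (hkn : k < n) :
    Nonempty (HypFnDiff k n ErdosSpace ≃ₜ ErdosSpace) := by
  have h : Nonempty (HypFnDiff k n (RatL2 ℕ) ≃ₜ RatL2 ℕ) := by
    induction n, Nat.succ_le_of_lt hkn using Nat.le_induction with
    | base => exact HypFnDiff.nonempty_homeomorph_self_succ k hk
    | succ m hm ih =>
      obtain ⟨h⟩ := ih hm
      exact HypFnDiff.nonempty_homeomorph_succ hk hm h
  obtain ⟨h⟩ := h
  exact ⟨(HypFnDiff.congr erdosHomeomorph.symm).trans (h.trans erdosHomeomorph)⟩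
end
end
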